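/- arXiv:math-ph/0408013 — 4 statements merged into one kernel-verified Lean document; each statement's English description precedes it below -/
import Mathlib

section
/- Suppose d ≤ 2 and the symbol s_a(θ) ≠ 0 for all θ ∈ 𝕋^d. Then there exists a constant C, depending only on d and the convolution vector a, such that for all sufficiently large l ∈ ℕ, every energy E ∈ ℝ and every ε ≥ 0, the expected number of eigenvalues of the finite-volume discrete Anderson Hamiltonian h_ω^l lying in the interval [E − ε, E] satisfies 𝔼{ tr E_ω^l([E − ε, E]) } ≤ C · Var(f) · ε · l^d. -/
/-!
Statement 0 (Lipschitz continuity of the IDS, discrete model, d ≤ 2):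
If `d ≤ 2` and the symbol `s_a` does not vanish on the torus, then there is a constant `C`
(depending only on `d` and `a`) such that for all sufficiently large `l`, all energies `E`
and all `ε ≥ 0`,
`𝔼 { tr E_ω^l([E-ε, E]) } ≤ C · Var(f) · ε · l^d`.
-/

open MeasureTheory
open scoped ENNReal BigOperators

noncomputable section

/-- The symbol `s_a(θ) = Σ_k a_k e^{i⟨k,θ⟩}` of the convolution vector `a`. -/
def andersonSymbol (d : ℕ) (a : (Fin d → ℤ) → ℝ) (θ : Fin d → ℝ) : ℂ :=
  ∑ᶠ k : Fin d → ℤ, (a k : ℂ) * Complex.exp (Complex.I * (∑ i, (k i : ℝ) * θ i : ℝ))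

/-- The `l`-periodization `ā` of the convolution vector `a`: `ā_m = Σ_{k ≡ m (mod l)} a_k`. -/
def periodization (d : ℕ) (a : (Fin d → ℤ) → ℝ) (l : ℕ) (m : Fin d → ZMod l) : ℝ :=
  ∑ᶠ (k : Fin d → ℤ) (_ : (fun i => ((k i : ZMod l))) = m), a k

/-- The alloy-type random potential `V_ω(n) = Σ_j ω_j ā_{n-j}` on the discrete torus. -/
def andersonPotential (d : ℕ) (a : (Fin d → ℤ) → ℝ) (l : ℕ) [NeZero l]
    (ω : (Fin d → ZMod l) → ℝ) (n : Fin d → ZMod l) : ℝ :=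
  ∑ j : Fin d → ZMod l, ω j * periodization d a l (n - j)

/-- Matrix of the finite-volume discrete Anderson Hamiltonian `h_ω^l` with periodic
boundary conditions: `(h_ω^l ψ)(n) = Σ_{|e|₁ = 1} ψ(n+e) + V_ω(n) ψ(n)`. -/
def andersonMatrix (d : ℕ) (a : (Fin d → ℤ) → ℝ) (l : ℕ) [NeZero l]
    (ω : (Fin d → ZMod l) → ℝ) : Matrix (Fin d → ZMod l) (Fin d → ZMod l) ℂ :=
  fun n m =>
    (∑ i : Fin d,
      ((if m = n + Pi.single i (1 : ZMod l) then (1 : ℂ) else 0)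
        + (if m = n - Pi.single i (1 : ZMod l) then (1 : ℂ) else 0)))
    + (if m = n then (andersonPotential d a l ω n : ℂ) else 0)

/-- The finite-volume Anderson Hamiltonian as an operator on `ℓ²((ℤ/lℤ)^d)`. -/
def andersonHamiltonian (d : ℕ) (a : (Fin d → ℤ) → ℝ) (l : ℕ) [NeZero l]
    (ω : (Fin d → ZMod l) → ℝ) :
    EuclideanSpace ℂ (Fin d → ZMod l) →ₗ[ℂ] EuclideanSpace ℂ (Fin d → ZMod l) :=
  Matrix.toEuclideanLin (andersonMatrix d a l ω)

/-- The number of eigenvalues (with multiplicity) of a Hermitian operator in `J`,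
i.e. `tr E_H(J)`: the dimension of the sum of the eigenspaces with eigenvalue in `J`. -/
def eigCount {E : Type*} [NormedAddCommGroup E] [InnerProductSpace ℂ E]
    (H : E →ₗ[ℂ] E) (J : Set ℝ) : ℕ :=
  Module.finrank ℂ ↥(⨆ μ ∈ J, Module.End.eigenspace H (μ : ℂ))

/-- The joint distribution of the i.i.d. coupling constants `(ω_j)`, whose common
distribution has density `f` with respect to Lebesgue measure. -/
def couplingMeasure (f : ℝ → ℝ) (ι : Type*) [Fintype ι] : Measure (ι → ℝ) :=
  volume.withDensity fun ω => ∏ i, ENNReal.ofReal (f (ω i))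

open scoped BoundedContinuousFunction

theorem aux_unit_comm {𝔅 : Type*} [NormedCommRing 𝔅] [NormedAlgebra ℂ 𝔅] [CompleteSpace 𝔅]
    [NormOneClass 𝔅] (d : ℕ) (S : Fin d → 𝔅ˣ)
    (h1 : ∀ i, ‖(S i : 𝔅)‖ ≤ 1) (h2 : ∀ i, ‖((S i)⁻¹ : 𝔅ˣ).val‖ ≤ 1)
    (a : (Fin d → ℤ) → ℝ) (ha : (Function.support a).Finite)
    (hsym : ∀ θ : Fin d → ℝ, (∀ i, θ i ∈ Set.Ioc (-Real.pi) Real.pi) →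
      andersonSymbol d a θ ≠ 0) :
    IsUnit (∑ k ∈ ha.toFinset, (a k : ℂ) • ((∏ i, (S i) ^ (k i) : 𝔅ˣ) : 𝔅)) := by
  by_contra hu
  obtain ⟨φ, hφ⟩ := WeakDual.CharacterSpace.exists_apply_eq_zero hu
  let z : Fin d → ℂˣ := fun i => Units.map (φ : 𝔅 →* ℂ) (S i)
  have hb : ∀ x : 𝔅, ‖φ x‖ ≤ ‖x‖ := fun x =>
    spectrum.norm_le_norm_of_mem (𝕜 := ℂ) (AlgHom.apply_mem_spectrum φ x)
  have hz : ∀ i, ‖(z i : ℂ)‖ = 1 := by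
    intro i
    apply le_antisymm ((hb _).trans (h1 i))
    have h3 : ‖(((z i)⁻¹ : ℂˣ) : ℂ)‖ ≤ 1 := by
      have : (z i)⁻¹ = Units.map (φ : 𝔅 →* ℂ) (S i)⁻¹ := by simp [z]
      rw [this]
      exact (hb _).trans (h2 i)
    rw [Units.val_inv_eq_inv_val, norm_inv] at h3
    have h4 : 0 < ‖(z i : ℂ)‖ := by simp
    exact (inv_le_one₀ h4).1 h3
  refine hsym (fun i => Complex.arg (z i)) (fun i => Complex.arg_mem_Ioc _) ?_
  have he : ∀ i, Complex.exp (Complex.I * (Complex.arg (z i) : ℝ)) = z i := by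
    intro i
    have := Complex.norm_mul_exp_arg_mul_I (z i)
    rw [hz i] at this
    rw [mul_comm]; simpa using this
  rw [andersonSymbol, finsum_eq_sum_of_support_subset (s := ha.toFinset)]
  · rw [← hφ, map_sum]
    refine Finset.sum_congr rfl fun k _ => ?_
    rw [map_smul, smul_eq_mul]
    congr 1
    have : φ ((∏ i, (S i) ^ (k i) : 𝔅ˣ) : 𝔅) = ((∏ i, (z i) ^ (k i) : ℂˣ) : ℂ) := by
      have : (∏ i, (z i) ^ (k i) : ℂˣ) = Units.map (φ : 𝔅 →* ℂ) (∏ i, (S i) ^ (k i)) := by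
        simp [z, map_prod, map_zpow]
      rw [this]; rfl
    rw [this]
    push_cast
    rw [Finset.mul_sum, Complex.exp_sum]
    refine Finset.prod_congr rfl fun i _ => ?_
    conv_rhs => rw [← he i]
    rw [← Complex.exp_int_mul]
    congr 1; ring
  · intro k hk
    simp only [Set.Finite.coe_toFinset, Function.mem_support] at hk ⊢
    intro h; simp [h] at hk

theorem aux_unit {𝔄 : Type*} [NormedRing 𝔄] [NormedAlgebra ℂ 𝔄] [CompleteSpace 𝔄]
    [NormOneClass 𝔄] (d : ℕ) (G : Multiplicative (Fin d → ℤ) →* 𝔄ˣ)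
    (h1 : ∀ k, ‖(G k : 𝔄)‖ ≤ 1)
    (a : (Fin d → ℤ) → ℝ) (ha : (Function.support a).Finite)
    (hsym : ∀ θ : Fin d → ℝ, (∀ i, θ i ∈ Set.Ioc (-Real.pi) Real.pi) →
      andersonSymbol d a θ ≠ 0) :
    ∃ B : 𝔄, (∑ k ∈ ha.toFinset, (a k : ℂ) • (G (Multiplicative.ofAdd k) : 𝔄)) * B = 1 := by
  let R : Set 𝔄 := Set.range (fun k => (G k : 𝔄))
  let 𝔅 : Subalgebra ℂ 𝔄 := Subalgebra.centralizer ℂ (Set.centralizer R)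
  have hR : R ⊆ Set.centralizer R := by
    rintro _ ⟨k, rfl⟩ _ ⟨k', rfl⟩
    have : (G k' * G k : 𝔄ˣ) = G k * G k' := by rw [← map_mul, ← map_mul, mul_comm]
    exact congrArg Units.val this
  have hmem : ∀ k, (G k : 𝔄) ∈ 𝔅 := fun k =>
    Set.subset_centralizer_centralizer (S := R) ⟨k, rfl⟩
  have hcl : IsClosed (𝔅 : Set 𝔄) := Set.isClosed_centralizer _
  have : CompleteSpace 𝔅 := hcl.completeSpace_coe
  let _ : NormedCommRing 𝔅 :=
    { (inferInstance : NormedRing 𝔅) with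
      mul_comm := by
        rintro ⟨x, hx⟩ ⟨y, hy⟩
        apply Subtype.ext
        have hx' : x ∈ Set.centralizer R := Set.centralizer_subset hR hx
        exact hy x hx' }
  have : NormOneClass 𝔅 := ⟨norm_one (α := 𝔄)⟩
  let G' : Multiplicative (Fin d → ℤ) →* 𝔅ˣ := MonoidHom.toHomUnits
    { toFun := fun k => ⟨G k, hmem k⟩
      map_one' := by apply Subtype.ext; simp
      map_mul' := by intro x y; apply Subtype.ext; simp }
  have hG' : ∀ k, (((G' k : 𝔅ˣ) : 𝔅) : 𝔄) = G k := fun k => rfl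
  have key := aux_unit_comm (𝔅 := 𝔅) d
    (fun i => G' (Multiplicative.ofAdd (Pi.single i 1))) (fun i => h1 _)
    (fun i => by
      rw [← map_inv]; exact h1 _) a ha hsym
  obtain ⟨u, hu⟩ := key
  refine ⟨((u⁻¹ : 𝔅ˣ) : 𝔅), ?_⟩
  have h3 : (u : 𝔅) * ((u⁻¹ : 𝔅ˣ) : 𝔅) = 1 := by simp
  rw [hu] at h3
  have h4 := congrArg (Subtype.val) h3
  have h5 : ∀ k : Fin d → ℤ, (∏ i, (G' (Multiplicative.ofAdd (Pi.single i 1))) ^ (k i))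
      = G' (Multiplicative.ofAdd k) := by
    intro k
    simp_rw [← map_zpow]
    rw [← map_prod]
    congr 1
    simp_rw [← ofAdd_zsmul]
    rw [← ofAdd_sum]
    congr 1
    conv_rhs => rw [← Finset.univ_sum_single k]
    refine Finset.sum_congr rfl fun i _ => ?_
    ext j; by_cases h : j = i <;> simp [h]
  simp_rw [h5] at h4
  rw [← (show ((1:𝔅):𝔄) = 1 from rfl), ← h4]
  refine congrArg (fun x : 𝔄 => x * (((u⁻¹ : 𝔅ˣ) : 𝔅) : 𝔄)) ?_
  symm
  exact map_sum (AddSubmonoidClass.subtype 𝔅) (fun k => (a k : ℂ) • ((G' (Multiplicative.ofAdd k) : 𝔅ˣ) : 𝔅)) ha.toFinset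

/-- shift by `k` on bounded functions on the disjoint union of all discrete tori. -/
theorem aux_wiener (d : ℕ) (a : (Fin d → ℤ) → ℝ) (ha : (Function.support a).Finite)
    (hsym : ∀ θ : Fin d → ℝ, (∀ i, θ i ∈ Set.Ioc (-Real.pi) Real.pi) →
      andersonSymbol d a θ ≠ 0) :
    ∃ C : ℝ, 0 < C ∧ ∀ (l : ℕ) (u : (Fin d → ZMod l) → ℝ), (∀ n, |u n| ≤ 1) →
      ∃ w : (Fin d → ZMod l) → ℝ, (∀ n, |w n| ≤ C) ∧
        ∀ n, ∑ k ∈ ha.toFinset, a k * w (n + fun i => (k i : ZMod l)) = u n := by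
  let J : Type := Σ l : ℕ, (Fin d → ZMod l)
  let _ : TopologicalSpace J := ⊥
  have : DiscreteTopology J := ⟨rfl⟩
  have : Nonempty J := ⟨⟨0, 0⟩⟩
  let sh : (Fin d → ℤ) → C(J, J) := fun k =>
    ⟨fun p => ⟨p.1, p.2 + fun i => (k i : ZMod p.1)⟩, continuous_of_discreteTopology⟩
  let G : Multiplicative (Fin d → ℤ) →* ((J →ᵇ ℂ) →L[ℂ] (J →ᵇ ℂ))ˣ := MonoidHom.toHomUnits
    { toFun := fun k => BoundedContinuousFunction.compContinuousCLM ℂ ℂ (sh k.toAdd)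
      map_one' := by
        ext f p
        change f _ = f _
        congr 1
        refine Sigma.ext rfl (heq_of_eq ?_)
        ext i; simp [sh]
      map_mul' := by
        intro x y
        ext f p
        change f _ = f _
        congr 1
        refine Sigma.ext rfl (heq_of_eq ?_)
        ext i; simp [sh]; ring }
  have hG : ∀ k, ‖((G k : ((J →ᵇ ℂ) →L[ℂ] (J →ᵇ ℂ))ˣ) : (J →ᵇ ℂ) →L[ℂ] (J →ᵇ ℂ))‖ ≤ 1 := by
    intro k
    refine ContinuousLinearMap.opNorm_le_bound _ zero_le_one (fun f => ?_)
    rw [one_mul]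
    exact BoundedContinuousFunction.norm_compContinuous_le f (sh k.toAdd)
  have : Nontrivial (J →ᵇ ℂ) := by
    refine ⟨0, BoundedContinuousFunction.const J 1, fun h => ?_⟩
    have := congrArg (fun f : J →ᵇ ℂ => f ⟨0, 0⟩) h
    simp at this
  obtain ⟨B, hB⟩ := aux_unit (𝔄 := (J →ᵇ ℂ) →L[ℂ] (J →ᵇ ℂ)) d G hG a ha hsym
  refine ⟨‖B‖ + 1, by positivity, fun l u hu => ?_⟩
  let U : J →ᵇ ℂ := BoundedContinuousFunction.ofNormedAddCommGroup
    (fun p => if h : p.1 = l then ((u (h ▸ p.2) : ℝ) : ℂ) else 0) continuous_of_discreteTopology 1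
    (by
      rintro ⟨l', p⟩
      by_cases h : l' = l
      · subst h; simpa using hu p
      · simp [h])
  have hU : ‖U‖ ≤ 1 := BoundedContinuousFunction.norm_ofNormedAddCommGroup_le _ zero_le_one _
  refine ⟨fun n => (B U ⟨l, n⟩).re, fun n => ?_, fun n => ?_⟩
  · calc |(B U ⟨l, n⟩).re| ≤ ‖B U ⟨l, n⟩‖ := Complex.abs_re_le_norm _
      _ ≤ ‖B U‖ := BoundedContinuousFunction.norm_coe_le_norm _ _
      _ ≤ ‖B‖ * ‖U‖ := B.le_opNorm U
      _ ≤ ‖B‖ * 1 := by gcongr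
      _ ≤ ‖B‖ + 1 := by linarith
  · have h := congrArg (fun T : (J →ᵇ ℂ) →L[ℂ] (J →ᵇ ℂ) => (T U ⟨l, n⟩).re) hB
    have h2 : U ⟨l, n⟩ = (u n : ℂ) := by
      change (if h : l = l then ((u (h ▸ n) : ℝ) : ℂ) else 0) = _
      simp
    simp only [mul_apply_eq_comp, one_apply_eq_self, h2,
      Complex.ofReal_re] at h
    rw [← h, sum_apply, BoundedContinuousFunction.sum_apply, Complex.re_sum]
    refine Finset.sum_congr rfl fun k _ => ?_
    simp only [smul_apply, BoundedContinuousFunction.coe_smul, smul_eq_mul,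
      Complex.re_ofReal_mul]
    rfl

theorem aux_var_sum (f : ℝ → ℝ) {h : ℝ} (hh : 0 < h) (x : ℝ) :
    ∑' k : ℤ, edist (f (k * h + x + h)) (f (k * h + x)) ≤ eVariationOn f Set.univ := by
  rw [ENNReal.tsum_eq_iSup_sum]
  refine iSup_le fun s => ?_
  obtain ⟨N, hN⟩ : ∃ N : ℕ, ∀ k ∈ s, k ∈ Finset.Ico (-(N:ℤ)) N := by
    refine ⟨∑ k ∈ s, (k.natAbs + 1), fun k hk => ?_⟩
    have := Finset.single_le_sum (f := fun k : ℤ => k.natAbs + 1) (fun _ _ => Nat.zero_le _) hk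
    simp only [Finset.mem_Ico]
    constructor <;> omega
  calc _ ≤ ∑ k ∈ Finset.Ico (-(N:ℤ)) N, edist (f (k * h + x + h)) (f (k * h + x)) :=
        Finset.sum_le_sum_of_subset hN
    _ = ∑ i ∈ Finset.range (2 * N), edist (f ((((i + 1 : ℕ) : ℝ) - N) * h + x))
          (f (((i : ℝ) - N) * h + x)) := by
        symm
        refine Finset.sum_bij (fun i _ => (i : ℤ) - N) ?_ ?_ ?_ ?_
        · intro i hi; simp at hi ⊢; omega
        · intro i _ j _ h; simpa using h
        · intro k hk; simp at hk
          exact ⟨(k + N).toNat, by simp; omega, by simp; omega⟩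
        · intro i _; push_cast; congr 2; ring
    _ ≤ _ := by
        refine eVariationOn.sum_le (u := fun i : ℕ => ((i : ℝ) - N) * h + x) ?_ (fun _ => trivial)
        intro i j hij
        have : (i : ℝ) ≤ j := by exact_mod_cast hij
        have : ((i : ℝ) - N) * h ≤ (j - N) * h := by gcongr
        simpa using this

theorem aux_l1_pos (f : ℝ → ℝ) (hf : Measurable f) {h : ℝ} (hh : 0 < h) :
    ∫⁻ x, edist (f (x + h)) (f x) ≤ ENNReal.ofReal h * eVariationOn f Set.univ := by
  have hm : Measurable fun x => edist (f (x + h)) (f x) :=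
    (hf.comp (measurable_id.add_const h)).edist hf
  rw [(isAddFundamentalDomain_Ioc hh 0 volume).lintegral_eq_tsum'']
  let e : ℤ ≃ AddSubgroup.zmultiples h :=
    Equiv.ofInjective (fun n : ℤ => n • h) (zsmul_left_strictMono hh).injective
  rw [← e.tsum_eq, ← lintegral_tsum]
  · calc _ ≤ ∫⁻ x in Set.Ioc 0 (0 + h), eVariationOn f Set.univ := by
          refine lintegral_mono fun x => ?_
          refine le_trans (le_of_eq ?_) (aux_var_sum f hh x)
          refine tsum_congr fun k => ?_
          have : (e k +ᵥ x : ℝ) = k * h + x := by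
            change (k • h) + x = _
            simp
          rw [this]
      _ = _ := by simp [mul_comm]
  · intro k
    exact (hm.comp (measurable_const_vadd (e k))).aemeasurable

theorem aux_l1 (f : ℝ → ℝ) (hf : Measurable f) (h : ℝ) :
    ∫⁻ x, edist (f (x + h)) (f x) ≤ ENNReal.ofReal |h| * eVariationOn f Set.univ := by
  rcases lt_trichotomy h 0 with h0 | h0 | h0
  · rw [abs_of_neg h0, ← lintegral_add_right_eq_self _ (-h)]
    refine le_trans (le_of_eq ?_) (aux_l1_pos f hf (neg_pos.2 h0))
    refine lintegral_congr fun x => ?_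
    rw [edist_comm]; simp
  · subst h0; simp
  · rw [abs_of_pos h0]; exact aux_l1_pos f hf h0

theorem aux_int_prod {ι : Type*} [Fintype ι] (g : ι → ℝ → ℝ) (h0 : ∀ i x, 0 ≤ g i x)
    (hi : ∀ i, Integrable (g i)) :
    ∫⁻ ω : ι → ℝ, ENNReal.ofReal (∏ i, g i (ω i)) = ∏ i, ∫⁻ x, ENNReal.ofReal (g i x) := by
  have hp : Integrable (fun ω : ι → ℝ => ∏ i, g i (ω i)) := Integrable.fintype_prod (f := g) hi
  rw [← ofReal_integral_eq_lintegral_ofReal hp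
    (Filter.Eventually.of_forall fun ω => Finset.prod_nonneg fun i _ => h0 i _),
    integral_fintype_prod_volume_eq_prod,
    ENNReal.ofReal_prod_of_nonneg (fun i _ => integral_nonneg (h0 i))]
  refine Finset.prod_congr rfl fun i _ => ?_
  rw [ofReal_integral_eq_lintegral_ofReal (hi i) (Filter.Eventually.of_forall (h0 i))]

theorem aux_int_one {f : ℝ → ℝ} (h0 : ∀ x, 0 ≤ f x) (h1 : ∫ x, f x = 1) :
    Integrable f ∧ ∫⁻ x, ENNReal.ofReal (f x) = 1 := by
  have hi : Integrable f := by
    by_contra h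
    rw [integral_undef h] at h1; norm_num at h1
  refine ⟨hi, ?_⟩
  rw [← ofReal_integral_eq_lintegral_ofReal hi (Filter.Eventually.of_forall h0), h1]; simp

theorem aux_single {ι : Type*} [Fintype ι] [DecidableEq ι] {f : ℝ → ℝ} (hf : Measurable f)
    (h0 : ∀ x, 0 ≤ f x) (h1 : ∫ x, f x = 1) (j : ι) (c : ℝ) :
    ∫⁻ ω : ι → ℝ, edist (∏ i, f ((ω + (Pi.single j c : ι → ℝ)) i)) (∏ i, f (ω i))
      ≤ ENNReal.ofReal |c| * eVariationOn f Set.univ := by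
  obtain ⟨hi, hl⟩ := aux_int_one h0 h1
  let g : ι → ℝ → ℝ := fun i x => if i = j then |f (x + c) - f x| else f x
  have hg : ∀ ω : ι → ℝ, edist (∏ i, f ((ω + (Pi.single j c : ι → ℝ)) i)) (∏ i, f (ω i))
      = ENNReal.ofReal (∏ i, g i (ω i)) := by
    intro ω
    rw [edist_dist, Real.dist_eq]
    congr 1
    rw [← Finset.mul_prod_erase _ _ (Finset.mem_univ j), ← Finset.mul_prod_erase _ _ (Finset.mem_univ j),
      ← Finset.mul_prod_erase _ _ (Finset.mem_univ j)]
    have e1 : ∏ i ∈ Finset.univ.erase j, f ((ω + (Pi.single j c : ι → ℝ)) i)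
        = ∏ i ∈ Finset.univ.erase j, f (ω i) := by
      refine Finset.prod_congr rfl fun i hi => ?_
      have : i ≠ j := Finset.ne_of_mem_erase hi
      simp [this]
    have e2 : ∏ i ∈ Finset.univ.erase j, g i (ω i)
        = ∏ i ∈ Finset.univ.erase j, f (ω i) := by
      refine Finset.prod_congr rfl fun i hi => ?_
      have : i ≠ j := Finset.ne_of_mem_erase hi
      simp [g, this]
    rw [e1, e2, ← sub_mul, abs_mul, abs_of_nonneg (Finset.prod_nonneg fun i _ => h0 _)]
    simp [g]
  simp_rw [hg]
  rw [aux_int_prod]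
  · rw [← Finset.mul_prod_erase _ _ (Finset.mem_univ j), Finset.prod_eq_one, mul_one]
    · refine le_trans (le_of_eq ?_) (aux_l1 f hf c)
      refine lintegral_congr fun x => ?_
      rw [edist_dist, Real.dist_eq]; simp [g]
    · intro i hi
      have : i ≠ j := Finset.ne_of_mem_erase hi
      simp [g, this, hl]
  · intro i x
    simp only [g]; split_ifs
    · positivity
    · exact h0 x
  · intro i
    by_cases h : i = j
    · simp only [g, h, if_true]
      exact ((hi.comp_add_right c).sub hi).abs
    · simp only [g, h, if_false]; exact hi

theorem aux_shift {ι : Type*} [Fintype ι] [DecidableEq ι] {f : ℝ → ℝ} (hf : Measurable f)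
    (h0 : ∀ x, 0 ≤ f x) (h1 : ∫ x, f x = 1) (u : ι → ℝ) :
    ∫⁻ ω : ι → ℝ, edist (∏ i, f ((ω + u) i)) (∏ i, f (ω i))
      ≤ ENNReal.ofReal (∑ j, |u j|) * eVariationOn f Set.univ := by
  let D : (ι → ℝ) → ℝ≥0∞ := fun u => ∫⁻ ω : ι → ℝ, edist (∏ i, f ((ω + u) i)) (∏ i, f (ω i))
  have hm : Measurable fun ω : ι → ℝ => ∏ i, f (ω i) :=
    Finset.measurable_prod _ fun i _ => hf.comp (measurable_pi_apply i)
  have hsub : ∀ x y, D (x + y) ≤ D x + D y := by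
    intro x y
    calc D (x + y) ≤ ∫⁻ ω : ι → ℝ, (edist (∏ i, f (((ω + x) + y) i)) (∏ i, f ((ω + x) i))
          + edist (∏ i, f ((ω + x) i)) (∏ i, f (ω i))) := by
          refine lintegral_mono fun ω => ?_
          simp only
          rw [add_assoc ω x y]
          exact edist_triangle _ _ _
      _ = D y + D x := by
          rw [lintegral_add_right]
          · congr 1
            exact lintegral_add_right_eq_self
              (fun ω : ι → ℝ => edist (∏ i, f ((ω + y) i)) (∏ i, f (ω i))) x
          · exact (hm.comp (measurable_id.add_const x)).edist hm
      _ = _ := add_comm _ _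
  have := Finset.le_sum_of_subadditive D (by simp [D]) hsub Finset.univ (fun j => Pi.single j (u j))
  rw [Finset.univ_sum_single] at this
  refine this.trans ?_
  rw [ENNReal.ofReal_sum_of_nonneg (fun _ _ => abs_nonneg _), Finset.sum_mul]
  exact Finset.sum_le_sum fun j _ => aux_single hf h0 h1 j (u j)

theorem aux_arctan (x y ε t : ℝ) (hε : 0 < ε) (hy : ε ≤ y) :
    y / ((t - x) ^ 2 + y ^ 2) ≤
      3 / ε * (Real.arctan ((t + ε - x) / y) - Real.arctan ((t - x) / y)) := by
  have hy0 : 0 < y := hε.trans_le hy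
  have hd : ∀ s, HasDerivAt (fun s => Real.arctan ((s - x) / y)) (y / ((s - x) ^ 2 + y ^ 2)) s := by
    intro s
    have h := (((hasDerivAt_id s).sub_const x).div_const y).arctan
    refine h.congr_deriv ?_
    simp only [id]
    field_simp
    ring
  obtain ⟨c, hc, hc2⟩ := exists_hasDerivAt_eq_slope (fun s => Real.arctan ((s - x) / y))
    (fun s => y / ((s - x) ^ 2 + y ^ 2)) (show t < t + ε by linarith)
    (fun s _ => (hd s).continuousAt.continuousWithinAt) (fun s _ => hd s)
  simp only [add_sub_cancel_left] at hc2
  have h3 : Real.arctan ((t + ε - x) / y) - Real.arctan ((t - x) / y)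
      = ε * (y / ((c - x) ^ 2 + y ^ 2)) := by rw [hc2]; field_simp
  rw [h3]
  have h4 : 3 / ε * (ε * (y / ((c - x) ^ 2 + y ^ 2))) = 3 * y / ((c - x) ^ 2 + y ^ 2) := by
    field_simp
  rw [h4, div_le_div_iff₀ (by positivity) (by positivity)]
  have h5 : (c - x) ^ 2 ≤ 2 * (t - x) ^ 2 + 2 * ε ^ 2 := by
    have h6 : 0 ≤ c - t := by linarith [hc.1]
    have h7 : c - t ≤ ε := by linarith [hc.2]
    have h8 : (c - t) ^ 2 ≤ ε ^ 2 := by gcongr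
    nlinarith [sq_nonneg ((t - x) - (c - t))]
  have h9 : ε ^ 2 ≤ y ^ 2 := by gcongr
  have : (c - x) ^ 2 + y ^ 2 ≤ 3 * ((t - x) ^ 2 + y ^ 2) := by nlinarith [sq_nonneg (t - x)]
  nlinarith

theorem aux_poisson (ε : ℝ) (hε : 0 < ε) (g : ℂ) (hg : ε * Complex.normSq g ≤ g.im)
    (gt : ℕ → ℂ) (hgt : ∀ k : ℕ, (1 + (k * ε : ℝ) * g) * gt k = g) (N : ℕ) :
    ∑ k ∈ Finset.range N, (gt k).im ≤ 3 * Real.pi / ε := by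
  by_cases h0 : g = 0
  · have : ∀ k, gt k = 0 := fun k => by simpa [h0] using hgt k
    simp only [this, Complex.zero_im, Finset.sum_const_zero]
    positivity
  have hn : 0 < Complex.normSq g := Complex.normSq_pos.2 h0
  set y : ℝ := g.im / Complex.normSq g with hy
  set x : ℝ := -(g.re / Complex.normSq g) with hx
  have hyε : ε ≤ y := by rw [hy, le_div_iff₀ hn]; exact hg
  have hw : g⁻¹ = ⟨-x, -y⟩ := by
    apply Complex.ext <;> simp [hx, hy, Complex.inv_re, Complex.inv_im, neg_div]
  have him : ∀ k : ℕ, (gt k).im = y / ((k * ε - x) ^ 2 + y ^ 2) := by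
    intro k
    have h1 : (g⁻¹ + (k * ε : ℝ)) * gt k = 1 := by
      have := congrArg (fun z => g⁻¹ * z) (hgt k)
      simp only [inv_mul_cancel₀ h0, ← mul_assoc, mul_add, mul_one] at this
      rw [← this]
      field_simp
    have h2 : gt k = (g⁻¹ + (k * ε : ℝ))⁻¹ := eq_inv_of_mul_eq_one_right h1
    rw [h2, Complex.inv_im, hw, Complex.normSq_apply]
    simp only [Complex.add_im, Complex.add_re, Complex.ofReal_im, Complex.ofReal_re]
    ring_nf
  calc ∑ k ∈ Finset.range N, (gt k).im
      ≤ ∑ k ∈ Finset.range N, (3 / ε * Real.arctan ((((k + 1 : ℕ) : ℝ) * ε - x) / y)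
          - 3 / ε * Real.arctan (((k : ℝ) * ε - x) / y)) := by
        refine Finset.sum_le_sum fun k _ => ?_
        rw [him]
        refine (aux_arctan x y ε (k * ε) hε hyε).trans (le_of_eq ?_)
        push_cast; ring_nf
    _ = 3 / ε * (Real.arctan (((N : ℝ) * ε - x) / y) - Real.arctan (((0 : ℕ) * ε - x) / y)) := by
        rw [Finset.sum_range_sub (fun k : ℕ => 3 / ε * Real.arctan (((k : ℝ) * ε - x) / y))]; ring
    _ ≤ 3 / ε * Real.pi := by
        gcongr
        linarith [Real.arctan_lt_pi_div_two (((N : ℝ) * ε - x) / y),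
          Real.neg_pi_div_two_lt_arctan (((0 : ℕ) * ε - x) / y)]
    _ = _ := by ring

section Mat
variable {ι : Type*} [Fintype ι] [DecidableEq ι]

theorem aux_res (M : Matrix ι ι ℂ) (hM : M.IsHermitian) (z : ℂ) (hz : z.im ≠ 0) :
    (M - z • 1) * ((hM.eigenvectorUnitary : Matrix ι ι ℂ) *
      Matrix.diagonal (fun i => ((hM.eigenvalues i : ℂ) - z)⁻¹) *
      star (hM.eigenvectorUnitary : Matrix ι ι ℂ)) = 1 := by
  set U : Matrix ι ι ℂ := (hM.eigenvectorUnitary : Matrix ι ι ℂ) with hU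
  have hs : M = U * Matrix.diagonal (fun i => (hM.eigenvalues i : ℂ)) * star U := by
    conv_lhs => rw [hM.spectral_theorem, Unitary.conjStarAlgAut_apply]
    rfl
  have h1 : star U * U = 1 := Unitary.coe_star_mul_self _
  have h2 : U * star U = 1 := Unitary.coe_mul_star_self _
  have h3 : M - z • 1 = U * Matrix.diagonal (fun i => (hM.eigenvalues i : ℂ) - z) * star U := by
    have : Matrix.diagonal (fun i => (hM.eigenvalues i : ℂ) - z)
        = Matrix.diagonal (fun i => (hM.eigenvalues i : ℂ)) - z • (1 : Matrix ι ι ℂ) := by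
      rw [Matrix.smul_one_eq_diagonal, Matrix.diagonal_sub]
    rw [this, mul_sub, sub_mul, ← hs]
    simp [h2]
  have h4 : Matrix.diagonal (fun i => (hM.eigenvalues i : ℂ) - z) *
      Matrix.diagonal (fun i => ((hM.eigenvalues i : ℂ) - z)⁻¹) = 1 := by
    rw [Matrix.diagonal_mul_diagonal, ← Matrix.diagonal_one]
    congr 1
    ext i
    refine mul_inv_cancel₀ fun h => hz ?_
    have := congrArg Complex.im h
    simpa using this
  rw [h3]
  calc _ = U * (Matrix.diagonal (fun i => (hM.eigenvalues i : ℂ) - z) * (star U * U) *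
      Matrix.diagonal (fun i => ((hM.eigenvalues i : ℂ) - z)⁻¹)) * star U := by
        simp only [mul_assoc]
    _ = 1 := by rw [h1, mul_one, h4, mul_one, h2]

theorem aux_isUnit (M : Matrix ι ι ℂ) (hM : M.IsHermitian) (z : ℂ) (hz : z.im ≠ 0) :
    IsUnit (M - z • 1).det :=
  Matrix.isUnit_det_of_right_inverse (aux_res M hM z hz)

theorem aux_im (M : Matrix ι ι ℂ) (hM : M.IsHermitian) (z : ℂ) (hz : 0 < z.im) (n : ι) :
    z.im * Complex.normSq ((M - z • 1)⁻¹ n n) ≤ ((M - z • 1)⁻¹ n n).im := by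
  set G := (M - z • 1)⁻¹ with hG
  have hu := aux_isUnit M hM z hz.ne'
  have h1 : (M - z • 1) * G = 1 := Matrix.mul_nonsing_inv _ hu
  have h2 : G.conjTranspose * (M - (star z) • 1) = 1 := by
    have := congrArg Matrix.conjTranspose h1
    rw [Matrix.conjTranspose_mul, Matrix.conjTranspose_sub, hM.eq] at this
    simpa using this
  have h3 : G - G.conjTranspose = (z - star z) • (G.conjTranspose * G) := by
    have e1 : G.conjTranspose * (M - (star z) • 1) * G = G := by rw [h2, one_mul]
    have e2 : G.conjTranspose * ((M - z • 1) * G) = G.conjTranspose := by rw [h1, mul_one]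
    calc G - G.conjTranspose
        = G.conjTranspose * (M - (star z) • 1) * G - G.conjTranspose * ((M - z • 1) * G) := by
          rw [e1, e2]
      _ = _ := by
          simp only [mul_sub, sub_mul, sub_smul, mul_assoc, Matrix.smul_mul, Matrix.mul_smul,
            one_mul]
          abel
  have h4 := congrArg (fun A : Matrix ι ι ℂ => (A n n).im) h3
  simp only [Matrix.sub_apply, Matrix.conjTranspose_apply, Matrix.smul_apply, Matrix.mul_apply,
    smul_eq_mul] at h4
  have h5 : ∀ m, star (G m n) * G m n = ((Complex.normSq (G m n) : ℝ) : ℂ) := by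
    intro m; rw [mul_comm]; exact Complex.mul_conj _
  simp only [h5, ← Complex.ofReal_sum] at h4
  have h6 : (G n n).im = z.im * ∑ m, Complex.normSq (G m n) := by
    simp [Complex.mul_im] at h4
    linarith
  rw [h6]
  gcongr
  exact Finset.single_le_sum (f := fun m => Complex.normSq (G m n))
    (fun _ _ => Complex.normSq_nonneg _) (Finset.mem_univ n)

theorem aux_rank_one (M : Matrix ι ι ℂ) (hM : M.IsHermitian) (z : ℂ) (hz : 0 < z.im) (n : ι)
    (t : ℝ) (M' : Matrix ι ι ℂ) (hM' : M' = M + Matrix.diagonal (Pi.single n (t : ℂ))) :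
    (1 + (t : ℂ) * (M - z • 1)⁻¹ n n) * (M' - z • 1)⁻¹ n n = (M - z • 1)⁻¹ n n := by
  have hH : M'.IsHermitian := by
    rw [hM']
    refine hM.add (Matrix.isHermitian_diagonal_of_self_adjoint _ ?_)
    ext i
    by_cases h : i = n
    · subst h; simp
    · simp [h]
  have h1 : (M - z • 1)⁻¹ * (M - z • 1) = 1 := Matrix.nonsing_inv_mul _ (aux_isUnit M hM z hz.ne')
  have h2 : (M' - z • 1) * (M' - z • 1)⁻¹ = 1 :=
    Matrix.mul_nonsing_inv _ (aux_isUnit M' hH z hz.ne')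
  set G := (M - z • 1)⁻¹
  set G' := (M' - z • 1)⁻¹
  have h3 : G = G' + G * Matrix.diagonal (Pi.single n (t : ℂ)) * G' := by
    have e : M' - z • 1 = (M - z • 1) + Matrix.diagonal (Pi.single n (t : ℂ)) := by
      rw [hM']; abel
    calc G = G * ((M' - z • 1) * G') := by rw [h2, mul_one]
      _ = G * (M - z • 1) * G' + G * Matrix.diagonal (Pi.single n (t : ℂ)) * G' := by
        rw [e]; noncomm_ring
      _ = _ := by rw [h1, one_mul]
  have h4 := congrArg (fun A : Matrix ι ι ℂ => A n n) h3
  simp only [Matrix.add_apply, Matrix.mul_apply (M := G * _), Matrix.mul_diagonal] at h4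
  rw [Finset.sum_eq_single n] at h4
  · simp only [Pi.single_eq_same] at h4
    conv_rhs => rw [h4]
    ring
  · intro m _ hm; simp [hm]
  · simp

theorem aux_count (M : Matrix ι ι ℂ) (hM : M.IsHermitian) (E ε : ℝ) (hε : 0 < ε) :
    (eigCount (Matrix.toEuclideanLin M) (Set.Icc (E - ε) E) : ℝ) ≤
      2 * ε * ∑ n, ((M - (⟨E, ε⟩ : ℂ) • 1)⁻¹ n n).im := by
  classical
  have hinv := Matrix.inv_eq_right_inv (aux_res M hM ⟨E, ε⟩ hε.ne')
  have htr : ∑ n, ((M - (⟨E, ε⟩ : ℂ) • 1)⁻¹ n n).im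
      = ∑ i, ε / ((hM.eigenvalues i - E) ^ 2 + ε ^ 2) := by
    rw [← Complex.im_sum]
    change (Matrix.trace ((M - (⟨E, ε⟩ : ℂ) • 1)⁻¹ : Matrix ι ι ℂ)).im = _
    rw [hinv, Matrix.trace_mul_cycle, Unitary.coe_star_mul_self, one_mul, Matrix.trace_diagonal,
      Complex.im_sum]
    refine Finset.sum_congr rfl fun i _ => ?_
    rw [Complex.inv_im, Complex.normSq_apply]
    simp
    ring
  set s : Finset ι := Finset.univ.filter fun i => hM.eigenvalues i ∈ Set.Icc (E - ε) E with hs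
  have hcard : eigCount (Matrix.toEuclideanLin M) (Set.Icc (E - ε) E) ≤ s.card := by
    have hle : (⨆ μ ∈ Set.Icc (E - ε) E, Module.End.eigenspace (Matrix.toEuclideanLin M) (μ : ℂ))
        ≤ Submodule.span ℂ ((s.image hM.eigenvectorBasis : Finset _) : Set (EuclideanSpace ℂ ι)) := by
      refine iSup₂_le fun μ hμ v hv => ?_
      rw [Module.End.mem_eigenspace_iff] at hv
      rw [← hM.eigenvectorBasis.sum_repr v]
      refine Submodule.sum_mem _ fun i _ => ?_
      by_cases hi : hM.eigenvalues i = μ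
      · refine Submodule.smul_mem _ _ (Submodule.subset_span ?_)
        simp only [Finset.coe_image, Set.mem_image]
        exact ⟨i, by simpa [hs, hi] using hμ, rfl⟩
      · have hsymm := Matrix.isSymmetric_toEuclideanLin_iff.mpr hM
        have h1 := hsymm (hM.eigenvectorBasis i) v
        have h2 : Matrix.toEuclideanLin M (hM.eigenvectorBasis i)
            = (hM.eigenvalues i : ℂ) • hM.eigenvectorBasis i := by
          ext j
          have := congrFun (hM.mulVec_eigenvectorBasis i) j
          simpa [Matrix.toLpLin_apply] using this
        rw [h2, hv, inner_smul_left, inner_smul_right, Complex.conj_ofReal] at h1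
        have h3 : ((hM.eigenvalues i : ℂ) - μ) * inner ℂ (hM.eigenvectorBasis i) v = 0 := by
          rw [sub_mul, h1, sub_self]
        have h4 : inner ℂ (hM.eigenvectorBasis i) v = 0 := by
          rcases mul_eq_zero.1 h3 with h | h
          · exact absurd (by exact_mod_cast sub_eq_zero.1 h) hi
          · exact h
        rw [OrthonormalBasis.repr_apply_apply, h4, zero_smul]
        exact Submodule.zero_mem _
    calc eigCount (Matrix.toEuclideanLin M) (Set.Icc (E - ε) E)
        ≤ _ := Submodule.finrank_mono hle
      _ ≤ (s.image hM.eigenvectorBasis).card := finrank_span_finset_le_card _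
      _ ≤ s.card := Finset.card_image_le
  calc (eigCount (Matrix.toEuclideanLin M) (Set.Icc (E - ε) E) : ℝ) ≤ s.card := by
        exact_mod_cast hcard
    _ = ∑ i ∈ s, (1 : ℝ) := by simp
    _ ≤ ∑ i ∈ s, 2 * ε * (ε / ((hM.eigenvalues i - E) ^ 2 + ε ^ 2)) := by
        refine Finset.sum_le_sum fun i hi => ?_
        simp only [hs, Finset.mem_filter, Finset.mem_univ, true_and, Set.mem_Icc] at hi
        rw [← mul_div_assoc, le_div_iff₀ (by positivity)]
        nlinarith
    _ ≤ ∑ i, 2 * ε * (ε / ((hM.eigenvalues i - E) ^ 2 + ε ^ 2)) :=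
        Finset.sum_le_sum_of_subset_of_nonneg (Finset.subset_univ _) fun i _ _ => by positivity
    _ = _ := by rw [htr, Finset.mul_sum]

theorem aux_meas {Ω : Type*} [TopologicalSpace Ω] [MeasurableSpace Ω] [OpensMeasurableSpace Ω]
    (A : Ω → Matrix ι ι ℂ) (hA : Continuous A) (n : ι) :
    Measurable fun ω => ((A ω)⁻¹ n n).im := by
  have : ∀ ω, (A ω)⁻¹ n n = ((A ω).det)⁻¹ * (A ω).adjugate n n := by
    intro ω
    rw [Matrix.inv_def, Ring.inverse_eq_inv', Matrix.smul_apply, smul_eq_mul]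
  simp_rw [this]
  refine Complex.measurable_im.comp (Measurable.mul ?_ ?_)
  · exact hA.matrix_det.measurable.inv
  · exact (hA.matrix_adjugate.matrix_elem n n).measurable
end Mat

theorem aux_arch (I c b : ℝ≥0∞) (hc : c ≠ ⊤) (h : ∀ N : ℕ, (N : ℝ≥0∞) * I ≤ c + N * b) : I ≤ b := by
  refine ENNReal.le_of_forall_pos_le_add fun η hη _ => ?_
  have hη' : (η : ℝ≥0∞) ≠ 0 := by exact_mod_cast hη.ne'
  obtain ⟨N, hN⟩ := ENNReal.exists_nat_gt (r := c / η) (ENNReal.div_ne_top hc hη')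
  have hN0 : (N : ℝ≥0∞) ≠ 0 := (lt_of_le_of_lt bot_le hN).ne'
  have h1 : c ≤ N * η := by
    rw [ENNReal.div_lt_iff (Or.inl hη') (Or.inl ENNReal.coe_ne_top)] at hN
    exact hN.le
  have h2 : (N : ℝ≥0∞) * I ≤ N * (b + η) := by
    refine (h N).trans ?_
    rw [mul_add, add_comm]
    gcongr
  exact (ENNReal.mul_le_mul_iff_right hN0 (ENNReal.natCast_ne_top N)).1 h2

theorem aux_core {ι : Type*} [Fintype ι] [DecidableEq ι] {f : ℝ → ℝ} (hf : Measurable f)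
    (h0 : ∀ x, 0 ≤ f x) (h1 : ∫ x, f x = 1)
    (M : (ι → ℝ) → Matrix ι ι ℂ) (hMc : Continuous M) (hM : ∀ ω, (M ω).IsHermitian)
    (n : ι) (v : ι → ℝ)
    (hv : ∀ ω (t : ℝ), M (ω + t • v) = M ω + Matrix.diagonal (Pi.single n (t : ℂ)))
    (E ε : ℝ) (hε : 0 < ε) :
    ∫⁻ ω, ENNReal.ofReal (((M ω - (⟨E, ε⟩ : ℂ) • 1)⁻¹ n n).im) * ENNReal.ofReal (∏ i, f (ω i))
      ≤ ENNReal.ofReal (3 * Real.pi * ∑ j, |v j|) * eVariationOn f Set.univ := by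
  set z : ℂ := ⟨E, ε⟩ with hz
  have hzim : z.im = ε := rfl
  set Φ : (ι → ℝ) → ℝ := fun ω => ∏ i, f (ω i) with hΦ
  set g : (ι → ℝ) → ℝ := fun ω => ((M ω - z • 1)⁻¹ n n).im with hg
  have hΦm : Measurable Φ := Finset.measurable_prod _ fun i _ => hf.comp (measurable_pi_apply i)
  have hgm : Measurable g := aux_meas _ (hMc.sub continuous_const) n
  have hg0 : ∀ ω, 0 ≤ g ω := fun ω => by
    refine le_trans ?_ (aux_im (M ω) (hM ω) z hε n)
    exact mul_nonneg hε.le (Complex.normSq_nonneg _)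
  obtain ⟨hfi, hfl⟩ := aux_int_one h0 h1
  have hΦ1 : ∫⁻ ω, ENNReal.ofReal (Φ ω) = 1 := by
    rw [aux_int_prod (fun _ => f) (fun _ => h0) (fun _ => hfi)]; simp [hfl]
  set V := eVariationOn f Set.univ
  set K : ℝ := ∑ j, |v j| with hK
  have hK0 : 0 ≤ K := Finset.sum_nonneg fun _ _ => abs_nonneg _
  set p : ℕ → (ι → ℝ) := fun k => ((k : ℝ) * ε) • v with hp
  refine aux_arch _ (ENNReal.ofReal (3 * Real.pi / ε)) _ ENNReal.ofReal_ne_top fun N => ?_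
  set Ψ : (ι → ℝ) → ℝ≥0∞ := fun ω => ENNReal.ofReal (Φ ω)
    + ∑ i ∈ Finset.range N, edist (Φ (ω + p i)) (Φ (ω + p (i + 1))) with hΨ
  have hdm : ∀ i, Measurable fun ω => edist (Φ (ω + p i)) (Φ (ω + p (i + 1))) := fun i =>
    (hΦm.comp (measurable_id.add_const _)).edist (hΦm.comp (measurable_id.add_const _))
  have hΨm : Measurable Ψ := hΦm.ennreal_ofReal.add (Finset.measurable_sum _ fun i _ => hdm i)
  have hΨi : ∫⁻ ω, Ψ ω ≤ 1 + N * (ENNReal.ofReal (ε * K) * V) := by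
    rw [lintegral_add_left hΦm.ennreal_ofReal, hΦ1, lintegral_finsetSum _ (fun i _ => hdm i)]
    gcongr
    calc _ ≤ ∑ i ∈ Finset.range N, ENNReal.ofReal (ε * K) * V := by
          refine Finset.sum_le_sum fun i _ => ?_
          have h2 := aux_shift hf h0 h1 (ε • v)
          have h3 : ∑ j, |(ε • v) j| = ε * K := by
            simp [hK, abs_mul, abs_of_pos hε, Finset.mul_sum]
          rw [h3] at h2
          refine le_trans (le_of_eq ?_) h2
          rw [← lintegral_add_right_eq_self (fun ω => edist (∏ i, f ((ω + ε • v) i)) (∏ i, f (ω i))) (p i)]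
          refine lintegral_congr fun ω => ?_
          rw [edist_comm]
          have : ω + p (i + 1) = ω + p i + ε • v := by
            simp only [hp]; push_cast; rw [add_mul, add_smul, one_mul, add_assoc]
          rw [this]
      _ = _ := by simp
  have hstep : ∀ k ∈ Finset.range N, ∫⁻ ω, ENNReal.ofReal (g ω) * ENNReal.ofReal (Φ ω)
      ≤ ∫⁻ ω, ENNReal.ofReal (g (ω + p k)) * Ψ ω := by
    intro k hk
    rw [← lintegral_add_right_eq_self _ (p k)]
    refine lintegral_mono fun ω => ?_
    simp only
    gcongr
    have h2 : ENNReal.ofReal (Φ (ω + p k)) ≤ ENNReal.ofReal (Φ ω) + edist (Φ ω) (Φ (ω + p k)) := by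
      rw [edist_dist, Real.dist_eq, ← ENNReal.ofReal_add (Finset.prod_nonneg fun i _ => h0 _)
        (abs_nonneg _)]
      apply ENNReal.ofReal_le_ofReal
      linarith [neg_abs_le (Φ ω - Φ (ω + p k))]
    refine h2.trans ?_
    simp only [hΨ]
    gcongr
    have h3 := edist_le_range_sum_edist (fun i => Φ (ω + p i)) k
    have h4 : p 0 = 0 := by simp [hp]
    simp only [h4, add_zero] at h3
    refine h3.trans (Finset.sum_le_sum_of_subset ?_)
    intro i hi; simp at hi hk ⊢; omega
  have hsum : ∀ ω, ∑ k ∈ Finset.range N, ENNReal.ofReal (g (ω + p k))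
      ≤ ENNReal.ofReal (3 * Real.pi / ε) := by
    intro ω
    rw [← ENNReal.ofReal_sum_of_nonneg (fun _ _ => hg0 _)]
    apply ENNReal.ofReal_le_ofReal
    refine aux_poisson ε hε ((M ω - z • 1)⁻¹ n n) (aux_im (M ω) (hM ω) z hε n)
      (fun k => (M (ω + p k) - z • 1)⁻¹ n n) (fun k => ?_) N
    exact aux_rank_one (M ω) (hM ω) z hε n (k * ε) _ (hv ω _)
  calc (N : ℝ≥0∞) * ∫⁻ ω, ENNReal.ofReal (g ω) * ENNReal.ofReal (Φ ω)
      = ∑ k ∈ Finset.range N, ∫⁻ ω, ENNReal.ofReal (g ω) * ENNReal.ofReal (Φ ω) := by simp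
    _ ≤ ∑ k ∈ Finset.range N, ∫⁻ ω, ENNReal.ofReal (g (ω + p k)) * Ψ ω := Finset.sum_le_sum hstep
    _ = ∫⁻ ω, (∑ k ∈ Finset.range N, ENNReal.ofReal (g (ω + p k))) * Ψ ω := by
        rw [← lintegral_finsetSum]
        · simp_rw [Finset.sum_mul]
        · intro k _
          exact ((hgm.comp (measurable_id.add_const _)).ennreal_ofReal).mul hΨm
    _ ≤ ∫⁻ ω, ENNReal.ofReal (3 * Real.pi / ε) * Ψ ω := by
        refine lintegral_mono fun ω => ?_
        simp only
        gcongr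
        exact hsum ω
    _ = ENNReal.ofReal (3 * Real.pi / ε) * ∫⁻ ω, Ψ ω := lintegral_const_mul _ hΨm
    _ ≤ ENNReal.ofReal (3 * Real.pi / ε) * (1 + N * (ENNReal.ofReal (ε * K) * V)) := by gcongr
    _ = _ := by
        have : ENNReal.ofReal (3 * Real.pi * K)
            = ENNReal.ofReal (3 * Real.pi / ε) * ENNReal.ofReal (ε * K) := by
          rw [← ENNReal.ofReal_mul (by positivity)]
          congr 1; field_simp
        rw [this]; ring

theorem aux_periodization (d : ℕ) (a : (Fin d → ℤ) → ℝ) (ha : (Function.support a).Finite)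
    (l : ℕ) [NeZero l] (w : (Fin d → ZMod l) → ℝ) (j : Fin d → ZMod l) :
    ∑ n, periodization d a l (n - j) * w n
      = ∑ k ∈ ha.toFinset, a k * w (j + fun i => (k i : ZMod l)) := by
  have h : ∀ m, periodization d a l m
      = ∑ k ∈ ha.toFinset, if (fun i => ((k i : ZMod l))) = m then a k else 0 := by
    intro m
    rw [periodization, finsum_eq_sum_of_support_subset (s := ha.toFinset)]
    · refine Finset.sum_congr rfl fun k _ => ?_
      split_ifs with h <;> simp [h]
    · intro k hk
      simp only [Set.Finite.coe_toFinset, Function.mem_support] at hk ⊢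
      intro h; simp [h] at hk
  simp_rw [h, Finset.sum_mul]
  rw [Finset.sum_comm]
  refine Finset.sum_congr rfl fun k _ => ?_
  rw [Finset.sum_eq_single (j + fun i => (k i : ZMod l))]
  · simp
  · intro n _ hn
    rw [if_neg, zero_mul]
    intro h; apply hn; rw [h]; abel
  · simp

theorem aux_direction (d : ℕ) (a : (Fin d → ℤ) → ℝ) (ha : (Function.support a).Finite) (C : ℝ)
    (l : ℕ) [NeZero l]
    (hC : ∀ (u : (Fin d → ZMod l) → ℝ), (∀ n, |u n| ≤ 1) →
      ∃ w : (Fin d → ZMod l) → ℝ, (∀ n, |w n| ≤ C) ∧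
        ∀ n, ∑ k ∈ ha.toFinset, a k * w (n + fun i => (k i : ZMod l)) = u n)
    (n : Fin d → ZMod l) :
    ∃ v : (Fin d → ZMod l) → ℝ, andersonPotential d a l v = Pi.single n 1 ∧ ∑ j, |v j| ≤ C := by
  have key : ∀ v : (Fin d → ZMod l) → ℝ, ∃ w : (Fin d → ZMod l) → ℝ, (∀ n, |w n| ≤ C) ∧
      ∑ j, |v j| = ∑ n, andersonPotential d a l v n * w n := by
    intro v
    obtain ⟨w, hw, hw2⟩ := hC (fun j => SignType.sign (v j)) (fun j => by
      rcases lt_trichotomy (v j) 0 with h | h | h <;> simp [h])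
    refine ⟨w, hw, ?_⟩
    simp only [andersonPotential, Finset.sum_mul]
    rw [Finset.sum_comm]
    refine Finset.sum_congr rfl fun j _ => ?_
    simp only [mul_assoc]
    rw [← Finset.mul_sum, aux_periodization d a ha l w j, hw2 j]
    exact (self_mul_sign (v j)).symm
  let L : ((Fin d → ZMod l) → ℝ) →ₗ[ℝ] ((Fin d → ZMod l) → ℝ) :=
    { toFun := andersonPotential d a l
      map_add' := by
        intro x y; ext n; simp [andersonPotential, add_mul, Finset.sum_add_distrib]
      map_smul' := by
        intro c x; ext n; simp [andersonPotential, mul_assoc, Finset.mul_sum] }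
  have hinj : Function.Injective L := by
    rw [← LinearMap.ker_eq_bot, LinearMap.ker_eq_bot']
    intro v hv
    obtain ⟨w, -, hw⟩ := key v
    have hv' : andersonPotential d a l v = 0 := hv
    rw [hv'] at hw
    simp only [Pi.zero_apply, zero_mul, Finset.sum_const_zero] at hw
    ext j
    have := (Finset.sum_eq_zero_iff_of_nonneg (fun j _ => abs_nonneg (v j))).1 hw j
      (Finset.mem_univ j)
    simpa using this
  obtain ⟨v, hv⟩ := LinearMap.injective_iff_surjective.1 hinj (Pi.single n 1)
  have hv' : andersonPotential d a l v = Pi.single n 1 := hv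
  refine ⟨v, hv', ?_⟩
  obtain ⟨w, hw1, hw⟩ := key v
  rw [hw, hv', Finset.sum_eq_single n]
  · simpa using (le_abs_self _).trans (hw1 n)
  · intro m _ hm; simp [hm]
  · simp

theorem aux_herm (d : ℕ) (a : (Fin d → ℤ) → ℝ) (l : ℕ) [NeZero l] (ω : (Fin d → ZMod l) → ℝ) :
    (andersonMatrix d a l ω).IsHermitian := by
  ext n m
  simp only [Matrix.conjTranspose_apply, andersonMatrix, star_add, star_sum]
  congr 1
  · refine Finset.sum_congr rfl fun i _ => ?_
    rw [add_comm]
    have e1 : (n = m - Pi.single i (1 : ZMod l)) ↔ (m = n + Pi.single i (1 : ZMod l)) := by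
      rw [eq_sub_iff_add_eq, eq_comm]
    have e2 : (n = m + Pi.single i (1 : ZMod l)) ↔ (m = n - Pi.single i (1 : ZMod l)) := by
      rw [eq_sub_iff_add_eq, eq_comm]
    simp only [e1, e2]
    congr 1 <;> split_ifs <;> simp
  · by_cases h : m = n
    · subst h; simp
    · simp [h, Ne.symm h]

theorem aux_shift_matrix (d : ℕ) (a : (Fin d → ℤ) → ℝ) (l : ℕ) [NeZero l]
    (n : Fin d → ZMod l) (v : (Fin d → ZMod l) → ℝ)
    (hv : andersonPotential d a l v = Pi.single n 1) (ω : (Fin d → ZMod l) → ℝ) (t : ℝ) :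
    andersonMatrix d a l (ω + t • v)
      = andersonMatrix d a l ω + Matrix.diagonal (Pi.single n (t : ℂ)) := by
  have h : ∀ m, andersonPotential d a l (ω + t • v) m
      = andersonPotential d a l ω m + t * (Pi.single n 1 : (Fin d → ZMod l) → ℝ) m := by
    intro m
    rw [← hv]
    simp [andersonPotential, add_mul, Finset.sum_add_distrib, Finset.mul_sum, mul_assoc]
  ext p q
  simp only [andersonMatrix, Matrix.add_apply, h, add_assoc]
  congr 1
  by_cases hpq : q = p
  · subst hpq
    by_cases hqn : q = n
    · subst hqn; simp
    · simp [hqn]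
  · simp [hpq, Matrix.diagonal_apply_ne _ (Ne.symm hpq)]

theorem aux_cont (d : ℕ) (a : (Fin d → ℤ) → ℝ) (l : ℕ) [NeZero l] :
    Continuous (andersonMatrix d a l) := by
  refine continuous_matrix fun p q => ?_
  simp only [andersonMatrix]
  refine continuous_const.add ?_
  split_ifs
  · refine Complex.continuous_ofReal.comp ?_
    simp only [andersonPotential]
    fun_prop
  · exact continuous_const

theorem aux_eigCount_mono {E : Type*} [NormedAddCommGroup E] [InnerProductSpace ℂ E]
    [FiniteDimensional ℂ E] (H : E →ₗ[ℂ] E) {J J' : Set ℝ} (h : J ⊆ J') :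
    eigCount H J ≤ eigCount H J' :=
  Submodule.finrank_mono (biSup_mono fun _ hμ => h hμ)

theorem aux_main (d : ℕ) (a : (Fin d → ℤ) → ℝ) (ha : (Function.support a).Finite) (C : ℝ)
    (f : ℝ → ℝ) (hf : Measurable f) (h0 : ∀ x, 0 ≤ f x) (h1 : ∫ x, f x = 1)
    (hV : BoundedVariationOn f Set.univ)
    (l : ℕ) [NeZero l]
    (hC : ∀ (u : (Fin d → ZMod l) → ℝ), (∀ n, |u n| ≤ 1) →
      ∃ w : (Fin d → ZMod l) → ℝ, (∀ n, |w n| ≤ C) ∧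
        ∀ n, ∑ k ∈ ha.toFinset, a k * w (n + fun i => (k i : ZMod l)) = u n)
    (E ε : ℝ) (hε : 0 < ε) :
    (∫⁻ ω, (eigCount (andersonHamiltonian d a l ω) (Set.Icc (E - ε) E) : ℝ≥0∞)
            ∂(couplingMeasure f (Fin d → ZMod l)))
          ≤ ENNReal.ofReal
              (6 * Real.pi * C * (eVariationOn f Set.univ).toReal * ε * (l : ℝ) ^ d) := by
  have hΦm : Measurable fun ω : (Fin d → ZMod l) → ℝ => ∏ i, ENNReal.ofReal (f (ω i)) :=
    Finset.measurable_prod _ fun i _ => (hf.comp (measurable_pi_apply i)).ennreal_ofReal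
  refine (lintegral_withDensity_le_lintegral_mul _ hΦm _).trans ?_
  set g : (Fin d → ZMod l) → ((Fin d → ZMod l) → ℝ) → ℝ := fun n ω =>
    ((andersonMatrix d a l ω - (⟨E, ε⟩ : ℂ) • 1)⁻¹ n n).im with hg
  have hgm : ∀ n, Measurable (g n) := fun n =>
    aux_meas _ ((aux_cont d a l).sub continuous_const) n
  have hg0 : ∀ n ω, 0 ≤ g n ω := fun n ω => by
    refine le_trans ?_ (aux_im _ (aux_herm d a l ω) ⟨E, ε⟩ hε n)
    exact mul_nonneg hε.le (Complex.normSq_nonneg _)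
  set V := eVariationOn f Set.univ with hVdef
  have hV' : V ≠ ⊤ := hV
  calc _ ≤ ∫⁻ ω, ENNReal.ofReal (2 * ε) *
        ∑ n, ENNReal.ofReal (g n ω) * ENNReal.ofReal (∏ i, f (ω i)) := by
        refine lintegral_mono fun ω => ?_
        have hc := aux_count _ (aux_herm d a l ω) E ε hε
        have hc2 : (eigCount (andersonHamiltonian d a l ω) (Set.Icc (E - ε) E) : ℝ≥0∞)
            ≤ ENNReal.ofReal (2 * ε) * ∑ n, ENNReal.ofReal (g n ω) := by
          rw [← ENNReal.ofReal_sum_of_nonneg (fun n _ => hg0 n ω),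
            ← ENNReal.ofReal_mul (by positivity), ← ENNReal.ofReal_natCast]
          exact ENNReal.ofReal_le_ofReal hc
        simp only [Pi.mul_apply]
        rw [ENNReal.ofReal_prod_of_nonneg (fun i _ => h0 _), ← Finset.sum_mul, ← mul_assoc, mul_comm]
        gcongr
    _ = ENNReal.ofReal (2 * ε) *
        ∑ n, ∫⁻ ω, ENNReal.ofReal (g n ω) * ENNReal.ofReal (∏ i, f (ω i)) := by
        have hm : ∀ n, Measurable fun ω : (Fin d → ZMod l) → ℝ =>
            ENNReal.ofReal (g n ω) * ENNReal.ofReal (∏ i, f (ω i)) := fun n =>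
          (hgm n).ennreal_ofReal.mul (Finset.measurable_prod _ fun i _ =>
            hf.comp (measurable_pi_apply i)).ennreal_ofReal
        rw [lintegral_const_mul _ (Finset.measurable_sum _ fun n _ => hm n),
          lintegral_finsetSum _ fun n _ => hm n]
    _ ≤ ENNReal.ofReal (2 * ε) * ∑ n : Fin d → ZMod l, ENNReal.ofReal (3 * Real.pi * C) * V := by
        gcongr with n _
        obtain ⟨v, hv, hvC⟩ := aux_direction d a ha C l hC n
        refine (aux_core hf h0 h1 (andersonMatrix d a l) (aux_cont d a l) (aux_herm d a l) n v
          (aux_shift_matrix d a l n v hv) E ε hε).trans ?_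
        gcongr
    _ = _ := by
        rw [Finset.sum_const, Finset.card_univ, Fintype.card_fun, ZMod.card, Fintype.card_fin,
          nsmul_eq_mul]
        have hC0 : 0 ≤ C := by
          obtain ⟨w, hw, -⟩ := hC 0 (by simp)
          exact (abs_nonneg _).trans (hw 0)
        rw [← ENNReal.ofReal_toReal hV', ← ENNReal.ofReal_natCast, ← ENNReal.ofReal_mul (by positivity),
          ← ENNReal.ofReal_mul (by positivity), ← ENNReal.ofReal_mul (by positivity),
          ENNReal.toReal_ofReal ENNReal.toReal_nonneg]
        congr 1
        push_cast; ring

theorem lipschitz_IDS_discrete_low_dim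
    (d : ℕ) (hd1 : 1 ≤ d) (hd2 : d ≤ 2)
    (a : (Fin d → ℤ) → ℝ) (ha : (Function.support a).Finite)
    (hsym : ∀ θ : Fin d → ℝ, (∀ i, θ i ∈ Set.Ioc (-Real.pi) Real.pi) →
      andersonSymbol d a θ ≠ 0) :
    ∃ C : ℝ, 0 < C ∧ ∃ l₀ : ℕ, 1 ≤ l₀ ∧
      ∀ f : ℝ → ℝ, Measurable f → (∀ x, 0 ≤ f x) → HasCompactSupport f →
        (∫ x, f x = 1) → BoundedVariationOn f Set.univ →
      ∀ (l : ℕ) [NeZero l], l₀ ≤ l →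
      ∀ (E ε : ℝ), 0 ≤ ε →
        (∫⁻ ω, (eigCount (andersonHamiltonian d a l ω) (Set.Icc (E - ε) E) : ℝ≥0∞)
            ∂(couplingMeasure f (Fin d → ZMod l)))
          ≤ ENNReal.ofReal
              (C * (eVariationOn f Set.univ).toReal * ε * (l : ℝ) ^ d) := by
  obtain ⟨C, hC, hw⟩ := aux_wiener d a ha hsym
  refine ⟨6 * Real.pi * C, by positivity, 1, le_rfl, ?_⟩
  intro f hf h0 _ h1 hV l _ _ E ε hε
  rcases hε.eq_or_lt with h | h
  · subst h
    have hle : ∀ η : ℝ, 0 < η →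
        (∫⁻ ω, (eigCount (andersonHamiltonian d a l ω) (Set.Icc (E - 0) E) : ℝ≥0∞)
            ∂(couplingMeasure f (Fin d → ZMod l)))
          ≤ ENNReal.ofReal
              (6 * Real.pi * C * (eVariationOn f Set.univ).toReal * η * (l : ℝ) ^ d) := by
      intro η hη
      refine le_trans (lintegral_mono fun ω => ?_) (aux_main d a ha C f hf h0 h1 hV l (hw l) E η hη)
      have hm : eigCount (andersonHamiltonian d a l ω) (Set.Icc (E - 0) E)
          ≤ eigCount (andersonHamiltonian d a l ω) (Set.Icc (E - η) E) :=
        aux_eigCount_mono _ (Set.Icc_subset_Icc (by linarith) le_rfl)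
      exact Nat.cast_le.2 hm
    have ht : Filter.Tendsto (fun η : ℝ => ENNReal.ofReal
        (6 * Real.pi * C * (eVariationOn f Set.univ).toReal * η * (l : ℝ) ^ d))
        (nhdsWithin 0 (Set.Ioi 0)) (nhds (ENNReal.ofReal
        (6 * Real.pi * C * (eVariationOn f Set.univ).toReal * 0 * (l : ℝ) ^ d))) := by
      refine Filter.Tendsto.mono_left (Continuous.tendsto ?_ 0) nhdsWithin_le_nhds
      exact ENNReal.continuous_ofReal.comp (by fun_prop)
    refine ge_of_tendsto ht ?_
    filter_upwards [self_mem_nhdsWithin] with η hη using hle η hη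
  · exact aux_main d a ha C f hf h0 h1 hV l (hw l) E ε h

end
end

section
/- Suppose there is an index k ∈ Γ such that |a_k| > Σ_{j∈Γ, j≠k} |a_j| (the convolution vector has a dominant component). Then for every dimension d ≥ 1 there exists a constant C, depending only on d and a, such that for all sufficiently large l ∈ ℕ, every E ∈ ℝ and every ε ≥ 0, 𝔼{ tr E_ω^l([E − ε, E]) } ≤ C · Var(f) · ε · l^d. -/
/-!
Statement 2 (Lipschitz continuity of the IDS, dominant component, any dimension):
If the convolution vector `a` has a dominant component, `|a_k| > Σ_{j ≠ k} |a_j|`,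
then for every `d ≥ 1` there is a constant `C` (depending only on `d` and `a`) such that
for all sufficiently large `l`, all energies `E` and all `ε ≥ 0`,
`𝔼 { tr E_ω^l([E-ε, E]) } ≤ C · Var(f) · ε · l^d`.
-/

open MeasureTheory
open scoped ENNReal BigOperators

noncomputable section

section LA
variable {E : Type*} [NormedAddCommGroup E] [InnerProductSpace ℂ E]

/-- the spectral subspace -/
def specSub (H : E →ₗ[ℂ] E) (J : Set ℝ) : Submodule ℂ E :=
  ⨆ μ ∈ J, Module.End.eigenspace H (μ : ℂ)

lemma specSub_eq (H : E →ₗ[ℂ] E) (J : Set ℝ) : specSub H J =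
    ⨆ μ ∈ ((fun x : ℝ => (x : ℂ)) '' J), Module.End.eigenspace H μ := by
  rw [specSub, iSup_image]

lemma specSub_disjoint (H : E →ₗ[ℂ] E) {J K : Set ℝ} (h : Disjoint J K) :
    Disjoint (specSub H J) (specSub H K) := by
  rw [specSub_eq, specSub_eq]
  apply (Module.End.eigenspaces_iSupIndep H).disjoint_biSup_biSup
  exact (Set.disjoint_image_iff Complex.ofReal_injective).2 h

lemma specSub_mono (H : E →ₗ[ℂ] E) {J K : Set ℝ} (h : J ⊆ K) :
    specSub H J ≤ specSub H K := biSup_mono h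

variable [FiniteDimensional ℂ E]

lemma specSub_sup {H : E →ₗ[ℂ] E} (hH : H.IsSymmetric) (J : Set ℝ) :
    specSub H J ⊔ specSub H Jᶜ = ⊤ := by
  have h1 : (⨆ μ : ℂ, Module.End.eigenspace H μ) = ⊤ :=
    (Submodule.orthogonal_eq_bot_iff).1 hH.orthogonalComplement_iSup_eigenspaces_eq_bot
  rw [eq_top_iff, ← h1]
  apply iSup_le
  intro μ
  by_cases hμ : Module.End.HasEigenvalue H μ
  · have h2 := hH.conj_eigenvalue_eq_self hμ
    obtain ⟨r, rfl⟩ := Complex.conj_eq_iff_real.1 h2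
    by_cases hr : r ∈ J
    · exact le_sup_of_le_left (le_biSup (fun μ : ℝ => Module.End.eigenspace H (μ : ℂ)) hr)
    · exact le_sup_of_le_right
        (le_biSup (fun μ : ℝ => Module.End.eigenspace H (μ : ℂ)) (show r ∈ Jᶜ from hr))
  · rw [Module.End.hasEigenvalue_iff, not_not] at hμ
    rw [hμ]; exact bot_le

lemma specSub_inner {H : E →ₗ[ℂ] E} (hH : H.IsSymmetric) {J : Set ℝ} {x : E}
    (hx : x ∈ specSub H J) (i : Fin (Module.finrank ℂ E)) (hi : hH.eigenvalues rfl i ∉ J) :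
    inner ℂ (hH.eigenvectorBasis rfl i) x = 0 := by
  have : specSub H J ≤ LinearMap.ker (innerₛₗ ℂ (hH.eigenvectorBasis rfl i)) := by
    apply iSup₂_le
    intro μ hμ y hy
    rw [LinearMap.mem_ker, innerₛₗ_apply_apply]
    have h1 := hH.apply_eigenvectorBasis rfl i
    have h2 := hH (hH.eigenvectorBasis rfl i) y
    rw [h1, Module.End.mem_eigenspace_iff.1 hy, inner_smul_left, inner_smul_right] at h2
    have h3 : (hH.eigenvalues rfl i : ℂ) ≠ μ := by
      intro h; apply hi; rw [Complex.ofReal_injective h]; exact hμ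
    simp only [Complex.coe_algebraMap, Complex.conj_ofReal] at h2
    by_contra h4
    exact h3 (mul_right_cancel₀ h4 h2)
  exact this hx

lemma quad_eq {H : E →ₗ[ℂ] E} (hH : H.IsSymmetric) (x : E) :
    (inner ℂ x (H x)).re = ∑ i, hH.eigenvalues rfl i *
      ‖inner ℂ (hH.eigenvectorBasis rfl i) x‖ ^ 2 := by
  rw [← (hH.eigenvectorBasis rfl).sum_inner_mul_inner, Complex.re_sum]
  refine Finset.sum_congr rfl fun i _ => ?_
  rw [← hH, hH.apply_eigenvectorBasis, inner_smul_left, ← inner_conj_symm x]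
  simp only [Complex.coe_algebraMap, Complex.conj_ofReal]
  rw [mul_left_comm, Complex.conj_mul', Complex.re_ofReal_mul]
  congr 1
  norm_cast

lemma norm_eq' {H : E →ₗ[ℂ] E} (hH : H.IsSymmetric) (x : E) :
    ‖x‖ ^ 2 = ∑ i, ‖inner ℂ (hH.eigenvectorBasis rfl i) x‖ ^ 2 :=
  ((hH.eigenvectorBasis rfl).sum_sq_norm_inner_right x).symm

/-- uniform gap below `e` -/
lemma quad_gap {H : E →ₗ[ℂ] E} (hH : H.IsSymmetric) (e : ℝ) : ∃ δ > 0,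
    ∀ x ∈ specSub H (Set.Iio e), (inner ℂ x (H x)).re ≤ (e - δ) * ‖x‖ ^ 2 := by
  obtain ⟨δ, hδ, h⟩ : ∃ δ > 0, ∀ i, hH.eigenvalues rfl i < e →
      hH.eigenvalues rfl i ≤ e - δ := by
    have : ∀ᶠ δ in nhdsWithin (0:ℝ) (Set.Ioi 0), ∀ i, hH.eigenvalues rfl i < e →
      hH.eigenvalues rfl i ≤ e - δ := by
      rw [Filter.eventually_all]
      intro i
      by_cases hi : hH.eigenvalues rfl i < e
      · have : ∀ᶠ δ in nhds (0:ℝ), δ < e - hH.eigenvalues rfl i :=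
          eventually_lt_nhds (by linarith)
        filter_upwards [this.filter_mono nhdsWithin_le_nhds] with δ h _
        linarith
      · exact Filter.Eventually.of_forall fun _ h => absurd h hi
    obtain ⟨δ, h1, h2⟩ := (this.and self_mem_nhdsWithin).exists
    exact ⟨δ, h2, h1⟩
  refine ⟨δ, hδ, fun x hx => ?_⟩
  rw [quad_eq hH, norm_eq' hH, Finset.mul_sum]
  refine Finset.sum_le_sum fun i _ => ?_
  by_cases hi : hH.eigenvalues rfl i < e
  · exact mul_le_mul_of_nonneg_right (h i hi) (by positivity)
  · rw [specSub_inner hH hx i hi]; simp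

lemma quad_lt {H : E →ₗ[ℂ] E} (hH : H.IsSymmetric) {e : ℝ} {x : E}
    (hx : x ∈ specSub H (Set.Iio e)) (h0 : x ≠ 0) :
    (inner ℂ x (H x)).re < e * ‖x‖ ^ 2 := by
  obtain ⟨δ, hδ, h⟩ := quad_gap hH e
  have := h x hx
  have : 0 < ‖x‖ := norm_pos_iff.2 h0
  have : 0 < δ * ‖x‖ ^ 2 := by positivity
  nlinarith

lemma quad_ge {H : E →ₗ[ℂ] E} (hH : H.IsSymmetric) {e : ℝ} {x : E}
    (hx : x ∈ specSub H (Set.Iio e)ᶜ) :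
    e * ‖x‖ ^ 2 ≤ (inner ℂ x (H x)).re := by
  rw [quad_eq hH, norm_eq' hH, Finset.mul_sum]
  refine Finset.sum_le_sum fun i _ => ?_
  by_cases hi : hH.eigenvalues rfl i < e
  · rw [specSub_inner hH hx i (by simpa using hi)]; simp
  · exact mul_le_mul_of_nonneg_right (not_lt.1 hi) (by positivity)

lemma le_eigCount {H : E →ₗ[ℂ] E} (hH : H.IsSymmetric) {e : ℝ} (W : Submodule ℂ E)
    (hW : ∀ x ∈ W, x ≠ 0 → (inner ℂ x (H x)).re < e * ‖x‖ ^ 2) :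
    Module.finrank ℂ W ≤ eigCount H (Set.Iio e) := by
  have h1 : Disjoint W (specSub H (Set.Iio e)ᶜ) := by
    rw [Submodule.disjoint_def]
    intro x h1 h2
    by_contra h0
    exact absurd (hW x h1 h0) (not_lt.2 (quad_ge hH h2))
  have h2 := Submodule.finrank_add_finrank_le_of_disjoint h1
  have h3 := Submodule.finrank_sup_add_finrank_inf_eq
    (specSub H (Set.Iio e)) (specSub H (Set.Iio e)ᶜ)
  rw [specSub_sup hH, (specSub_disjoint H disjoint_compl_right).eq_bot, finrank_top,
    finrank_bot] at h3
  change _ ≤ Module.finrank ℂ (specSub H (Set.Iio e))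
  omega

lemma eigCount_mono {H H' : E →ₗ[ℂ] E} (hH : H.IsSymmetric) (hH' : H'.IsSymmetric) {e : ℝ}
    (h : ∀ x, (inner ℂ x (H x)).re ≤ (inner ℂ x (H' x)).re) :
    eigCount H' (Set.Iio e) ≤ eigCount H (Set.Iio e) :=
  le_eigCount hH (specSub H' (Set.Iio e)) fun x hx h0 => (h x).trans_lt (quad_lt hH' hx h0)

lemma eigCount_shift {H H' : E →ₗ[ℂ] E} (hH : H.IsSymmetric) (hH' : H'.IsSymmetric) {e t : ℝ}
    (h : ∀ x, (inner ℂ x (H x)).re + t * ‖x‖ ^ 2 ≤ (inner ℂ x (H' x)).re) :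
    eigCount H' (Set.Iio e) ≤ eigCount H (Set.Iio (e - t)) :=
  le_eigCount hH (specSub H' (Set.Iio e)) fun x hx h0 => by
    have := h x
    have := quad_lt hH' hx h0
    linarith

lemma eigCount_rank_one {H H' : E →ₗ[ℂ] E} (hH : H.IsSymmetric) (hH' : H'.IsSymmetric) {e : ℝ}
    (φ : E →ₗ[ℂ] ℂ)
    (h : ∀ x, φ x = 0 → (inner ℂ x (H x)).re ≤ (inner ℂ x (H' x)).re) :
    eigCount H' (Set.Iio e) ≤ eigCount H (Set.Iio e) + 1 := by
  have h1 := le_eigCount hH (e := e) (specSub H' (Set.Iio e) ⊓ LinearMap.ker φ)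
    fun x hx h0 => (h x hx.2).trans_lt (quad_lt hH' hx.1 h0)
  have h2 := Submodule.finrank_sup_add_finrank_inf_eq (specSub H' (Set.Iio e)) (LinearMap.ker φ)
  have h3 := LinearMap.finrank_range_add_finrank_ker φ
  have h4 := Submodule.finrank_le (LinearMap.range φ)
  have h5 := Submodule.finrank_le (specSub H' (Set.Iio e) ⊔ LinearMap.ker φ)
  rw [Module.finrank_self] at h4
  change Module.finrank ℂ (specSub H' (Set.Iio e)) ≤ _
  omega

lemma eigCount_Icc {H : E →ₗ[ℂ] E} {e e' ε : ℝ} (he : e < e') (hε : 0 ≤ ε) :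
    eigCount H (Set.Icc (e - ε) e) ≤ eigCount H (Set.Iio e') - eigCount H (Set.Iio (e - ε)) := by
  have h1 : Disjoint (specSub H (Set.Icc (e - ε) e)) (specSub H (Set.Iio (e - ε))) := by
    apply specSub_disjoint
    rw [Set.disjoint_left]
    intro x hx hx'
    exact absurd hx.1 (not_le.2 hx')
  have h2 := Submodule.finrank_sup_add_finrank_inf_eq
    (specSub H (Set.Icc (e - ε) e)) (specSub H (Set.Iio (e - ε)))
  rw [h1.eq_bot, finrank_bot] at h2
  have h3 : specSub H (Set.Icc (e - ε) e) ⊔ specSub H (Set.Iio (e - ε)) ≤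
      specSub H (Set.Iio e') := by
    apply sup_le <;> apply specSub_mono
    · exact fun x hx => lt_of_le_of_lt hx.2 he
    · exact fun x hx => lt_trans hx (show e - ε < e' by linarith)
  have h4 := Submodule.finrank_mono h3
  change Module.finrank ℂ (specSub H _) ≤ Module.finrank ℂ (specSub H _) -
    Module.finrank ℂ (specSub H _)
  omega

end LA

section MT

lemma lint_fin_prod {n : ℕ} (f : Fin n → ℝ → ℝ≥0∞) (hf : ∀ i, Measurable (f i)) :
    ∫⁻ x : Fin n → ℝ, ∏ i, f i (x i) = ∏ i, ∫⁻ x, f i x := by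
  induction n with
  | zero => simp [volume_pi]
  | succ n ih =>
    have h := (volume_preserving_piFinSuccAbove (fun _ : Fin (n+1) => ℝ) 0).symm
    calc _ = ∫⁻ x : ℝ × (Fin n → ℝ), f 0 x.1 * ∏ i : Fin n, f (Fin.succ i) (x.2 i) := by
          rw [← h.lintegral_comp_emb (MeasurableEquiv.measurableEmbedding _)]
          simp [MeasurableEquiv.piFinSuccAbove_symm_apply, Fin.insertNthEquiv,
            Fin.prod_univ_succ]
      _ = _ := by
          rw [Fin.prod_univ_succ, ← ih _ (fun i => hf i.succ), Measure.volume_eq_prod,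
            ← lintegral_prod_mul]
          · exact (hf 0).aemeasurable
          · exact (Finset.measurable_prod _ fun i _ =>
              (hf i.succ).comp (measurable_pi_apply i)).aemeasurable

lemma lint_prod {ι : Type*} [Fintype ι] (f : ι → ℝ → ℝ≥0∞) (hf : ∀ i, Measurable (f i)) :
    ∫⁻ x : ι → ℝ, ∏ i, f i (x i) = ∏ i, ∫⁻ x, f i x := by
  let e := (Fintype.equivFin ι).symm
  have h := volume_measurePreserving_piCongrLeft (fun _ : ι => ℝ) e
  rw [← h.lintegral_comp_emb (MeasurableEquiv.measurableEmbedding _)]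
  simp_rw [← e.prod_comp, MeasurableEquiv.coe_piCongrLeft,
    Equiv.piCongrLeft_apply_apply]
  exact lint_fin_prod _ (fun i => hf _)

lemma tile (Q : ℝ → ℝ≥0∞) {h : ℝ} (hh : 0 < h) :
    ∑' n : ℤ, ∫⁻ x in Set.Ioc 0 h, Q (x + n * h) = ∫⁻ x, Q x := by
  rw [← setLIntegral_univ Q, ← iUnion_Ioc_add_zsmul hh 0,
    lintegral_iUnion (fun _ => measurableSet_Ioc) (Set.pairwise_disjoint_Ioc_add_zsmul 0 h)]
  refine tsum_congr fun n => ?_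
  have h1 := (measurePreserving_add_right (volume : Measure ℝ) ((n : ℝ) * h)).setLIntegral_comp_emb
    (measurableEmbedding_addRight _) Q (Set.Ioc 0 h)
  rw [h1, Set.image_add_const_Ioc]
  congr 3
  · simp
  · simp; ring

lemma oneD {f : ℝ → ℝ} (hf : Measurable f) (t : ℝ) :
    ∫⁻ x, (ENNReal.ofReal (f x) - ENNReal.ofReal (f (x + t))) ≤
      ENNReal.ofReal |t| * eVariationOn f Set.univ := by
  have key : ∀ t : ℝ, 0 < t → ∫⁻ x, edist (f (x + t)) (f x) ≤
      ENNReal.ofReal t * eVariationOn f Set.univ := by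
    intro t ht
    rw [← tile _ ht, ← lintegral_tsum]
    · calc ∫⁻ x in Set.Ioc 0 t, ∑' n : ℤ, edist (f (x + n * t + t)) (f (x + n * t))
          ≤ ∫⁻ x in Set.Ioc 0 t, eVariationOn f Set.univ := by
            refine lintegral_mono fun x => ?_
            rw [ENNReal.tsum_eq_iSup_sum]
            refine iSup_le fun s => ?_
            obtain ⟨M, hM⟩ : ∃ M : ℕ, ∀ n ∈ s, -(M:ℤ) ≤ n ∧ n < M := by
              refine ⟨∑ n ∈ s, n.natAbs + 1, fun n hn => ?_⟩
              have := Finset.single_le_sum (f := fun n : ℤ => n.natAbs)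
                (fun _ _ => Nat.zero_le _) hn
              omega
            let u : ℕ → ℝ := fun m => x + ((m : ℝ) - M) * t
            have hu : Monotone u := by
              intro p q hpq
              have : (p : ℝ) ≤ q := by exact_mod_cast hpq
              simp only [u]
              nlinarith
            refine le_trans ?_ (eVariationOn.sum_le (f := f) (n := 2 * M) hu (fun _ => Set.mem_univ _))
            have hinj : Function.Injective (fun m : ℕ => (m : ℤ) - M) := by
              intro p q h; simpa using h
            calc _ ≤ ∑ n ∈ (Finset.range (2*M)).image (fun m : ℕ => (m : ℤ) - M),
                  edist (f (x + n * t + t)) (f (x + n * t)) := by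
                  refine Finset.sum_le_sum_of_subset fun n hn => ?_
                  have := hM n hn
                  rw [Finset.mem_image]
                  exact ⟨(n + M).toNat, by rw [Finset.mem_range]; omega, by omega⟩
              _ = _ := by
                  rw [Finset.sum_image hinj.injOn]
                  refine Finset.sum_congr rfl fun m _ => ?_
                  simp only [u]
                  push_cast
                  congr 2
                  ring
        _ = _ := by simp [mul_comm]
    · intro n
      exact ((hf.comp (by fun_prop)).edist (hf.comp (by fun_prop))).aemeasurable
  have le : ∀ x y : ℝ, ENNReal.ofReal x - ENNReal.ofReal y ≤ edist x y := by
    intro x y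
    rw [edist_dist, Real.dist_eq, tsub_le_iff_right]
    refine le_trans (ENNReal.ofReal_le_ofReal ?_) ENNReal.ofReal_add_le
    linarith [le_abs_self (x - y)]
  rcases lt_trichotomy t 0 with ht | rfl | ht
  · calc _ ≤ ∫⁻ x, edist (f x) (f (x + t)) := lintegral_mono fun x => le _ _
      _ = ∫⁻ x, edist (f (x + -t)) (f x) := by
          rw [← lintegral_add_right_eq_self _ (-t)]
          simp
      _ ≤ _ := by rw [abs_of_neg ht]; exact key (-t) (by linarith)
  · simp
  · calc _ ≤ ∫⁻ x, edist (f (x + t)) (f x) := lintegral_mono fun x => by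
            rw [edist_comm]; exact le _ _
      _ ≤ _ := by rw [abs_of_pos ht]; exact key t ht


/-- the joint density -/
def jd (f : ℝ → ℝ) {ι : Type*} [Fintype ι] (ω : ι → ℝ) : ℝ≥0∞ := ∏ i, ENNReal.ofReal (f (ω i))

lemma jd_meas {f : ℝ → ℝ} (hf : Measurable f) {ι : Type*} [Fintype ι] :
    Measurable (jd f : (ι → ℝ) → ℝ≥0∞) :=
  Finset.measurable_prod _ fun i _ => (hf.comp (measurable_pi_apply i)).ennreal_ofReal

lemma jd_ne_top {f : ℝ → ℝ} {ι : Type*} [Fintype ι] (ω : ι → ℝ) : jd f ω ≠ ⊤ :=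
  ENNReal.prod_ne_top fun _ _ => ENNReal.ofReal_ne_top

lemma transl {f : ℝ → ℝ} (hf : Measurable f) (h1 : ∫⁻ x, ENNReal.ofReal (f x) = 1)
    {ι : Type*} [Fintype ι] (v : ι → ℝ) :
    ∫⁻ ω : ι → ℝ, (jd f ω - jd f (ω + v)) ≤
      ENNReal.ofReal (∑ i, |v i|) * eVariationOn f Set.univ := by
  classical
  have key : ∀ S : Finset ι, ∫⁻ ω : ι → ℝ, (jd f ω - jd f (ω + fun i => if i ∈ S then v i else 0)) ≤
      (∑ i ∈ S, ENNReal.ofReal |v i|) * eVariationOn f Set.univ := by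
    intro S
    induction S using Finset.induction_on with
    | empty =>
      have : ∀ ω : ι → ℝ, (ω + fun i => 0) = ω := fun ω => by ext; simp
      simp [this]
    | insert a S ha ih =>
      set vS : ι → ℝ := fun i => if i ∈ S then v i else 0 with hvS
      set vT : ι → ℝ := fun i => if i ∈ insert a S then v i else 0 with hvT
      let g : ι → ℝ → ℝ≥0∞ := fun m x => if m = a then
        ENNReal.ofReal (f x) - ENNReal.ofReal (f (x + v a)) else ENNReal.ofReal (f (x + vS m))
      have hg : ∀ m, Measurable (g m) := by
        intro m
        by_cases hm : m = a
        · simp only [g, hm, if_true]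
          exact hf.ennreal_ofReal.sub (hf.comp (by fun_prop)).ennreal_ofReal
        · simp only [g, hm, if_false]
          exact (hf.comp (by fun_prop)).ennreal_ofReal
      have h2 : ∀ ω : ι → ℝ, jd f (ω + vS) - jd f (ω + vT) = ∏ i, g i (ω i) := by
        intro ω
        simp only [jd]
        rw [← Finset.mul_prod_erase _ _ (Finset.mem_univ a),
          ← Finset.mul_prod_erase _ (fun i => ENNReal.ofReal (f ((ω + vT) i))) (Finset.mem_univ a),
          ← Finset.mul_prod_erase _ (fun i => g i (ω i)) (Finset.mem_univ a)]
        have e1 : ∏ i ∈ Finset.univ.erase a, ENNReal.ofReal (f ((ω + vT) i)) =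
            ∏ i ∈ Finset.univ.erase a, ENNReal.ofReal (f ((ω + vS) i)) := by
          refine Finset.prod_congr rfl fun i hi => ?_
          simp [hvT, hvS, Finset.ne_of_mem_erase hi]
        have e2 : ∏ i ∈ Finset.univ.erase a, g i (ω i) =
            ∏ i ∈ Finset.univ.erase a, ENNReal.ofReal (f ((ω + vS) i)) := by
          refine Finset.prod_congr rfl fun i hi => ?_
          simp [g, Finset.ne_of_mem_erase hi]
        rw [e1, e2, ← ENNReal.sub_mul]
        · simp [g, hvS, hvT, ha]
        · intro _ _
          exact ENNReal.prod_ne_top fun _ _ => ENNReal.ofReal_ne_top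
      have h3 : ∫⁻ ω : ι → ℝ, (jd f (ω + vS) - jd f (ω + vT)) ≤
          ENNReal.ofReal |v a| * eVariationOn f Set.univ := by
        simp_rw [h2]
        rw [lint_prod g hg, ← Finset.mul_prod_erase _ _ (Finset.mem_univ a), Finset.prod_eq_one]
        · simp only [g, if_true, mul_one]
          exact oneD hf _
        · intro i hi
          simp only [g, Finset.ne_of_mem_erase hi, if_false]
          rw [lintegral_add_right_eq_self (fun x => ENNReal.ofReal (f x)), h1]
      calc _ ≤ ∫⁻ ω : ι → ℝ, ((jd f ω - jd f (ω + vS)) + (jd f (ω + vS) - jd f (ω + vT))) :=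
            lintegral_mono fun ω => tsub_le_tsub_add_tsub
        _ = _ := lintegral_add_left ((jd_meas hf).sub ((jd_meas hf).comp (by fun_prop))) _
        _ ≤ _ := add_le_add ih h3
        _ = _ := by rw [Finset.sum_insert ha, add_mul, add_comm]
  have := key Finset.univ
  simp only [Finset.mem_univ, if_true] at this
  rwa [ENNReal.ofReal_sum_of_nonneg (fun _ _ => abs_nonneg _)]

lemma telescope {ι : Type*} [Fintype ι] {f : ℝ → ℝ} (hc : HasCompactSupport f)
    (u : ι → ℝ) (hu : ∃ i, u i ≠ 0) (ω : ι → ℝ) :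
    jd f ω ≤ ∑' m : ℤ, (jd f (ω + (m : ℝ) • u) - jd f (ω + (m : ℝ) • u + u)) := by
  have h1 : ∀ M : ℕ, jd f ω ≤ ∑ m ∈ Finset.range M,
      (jd f (ω + (m : ℝ) • u) - jd f (ω + (m : ℝ) • u + u)) + jd f (ω + (M : ℝ) • u) := by
    intro M
    induction M with
    | zero => simp
    | succ M ih =>
      rw [Finset.sum_range_succ, add_assoc]
      refine ih.trans (add_le_add le_rfl ?_)
      have : ω + ((M + 1 : ℕ) : ℝ) • u = ω + (M : ℝ) • u + u := by
        push_cast; module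
      rw [this]
      exact le_tsub_add
  obtain ⟨M, hM⟩ : ∃ M : ℕ, jd f (ω + (M : ℝ) • u) = 0 := by
    obtain ⟨i, hi⟩ := hu
    obtain ⟨R, hR⟩ := hc.isCompact.isBounded.subset_closedBall 0
    obtain ⟨M, hM⟩ := exists_nat_gt ((R + |ω i|) / |u i|)
    refine ⟨M, Finset.prod_eq_zero (Finset.mem_univ i) ?_⟩
    have : f ((ω + (M : ℝ) • u) i) = 0 := by
      by_contra h
      have h2 := hR (subset_tsupport f h)
      rw [mem_closedBall_zero_iff, Real.norm_eq_abs] at h2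
      rw [div_lt_iff₀ (abs_pos.2 hi)] at hM
      simp only [Pi.add_apply, Pi.smul_apply, smul_eq_mul] at h2
      have h3 : |(M : ℝ) * u i| = M * |u i| := by rw [abs_mul, Nat.abs_cast]
      have h4 := abs_add_le (ω i + M * u i) (-ω i)
      rw [abs_neg, add_neg_cancel_comm] at h4
      linarith
    rw [this, ENNReal.ofReal_zero]
  refine (h1 M).trans ?_
  rw [hM, add_zero]
  have hinj : Function.Injective (fun m : ℕ => (m : ℤ)) := Nat.cast_injective
  calc _ = ∑ m ∈ (Finset.range M).image (fun m : ℕ => (m : ℤ)),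
        (jd f (ω + (m : ℝ) • u) - jd f (ω + (m : ℝ) • u + u)) := by
        rw [Finset.sum_image hinj.injOn]; simp
    _ ≤ _ := ENNReal.sum_le_tsum _

lemma main_avg {ι : Type*} [Fintype ι] {f : ℝ → ℝ} (hf : Measurable f)
    (h1 : ∫⁻ x, ENNReal.ofReal (f x) = 1) (hc : HasCompactSupport f)
    (hv : eVariationOn f Set.univ ≠ ⊤)
    (u : ι → ℝ) (hu : ∃ i, u i ≠ 0) (P : (ι → ℝ) → ℝ≥0∞) (hP : Measurable P)
    (hP1 : ∀ ω, P ω ≤ 1) (ε : ℝ≥0∞) (hPε : ∀ ω, ∫⁻ r : ℝ, P (ω + r • u) ≤ ε) :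
    ∫⁻ ω, P ω * jd f ω ≤ ε * (ENNReal.ofReal (∑ i, |u i|) * eVariationOn f Set.univ) := by
  set c := ENNReal.ofReal (∑ i, |u i|) * eVariationOn f Set.univ with hc'
  have hctop : c ≠ ⊤ := ENNReal.mul_ne_top ENNReal.ofReal_ne_top hv
  have hF := jd_meas (ι := ι) hf
  have tr : ∀ t : ℝ, ∫⁻ ω : ι → ℝ, (jd f ω - jd f (ω + t • u)) ≤ ENNReal.ofReal |t| * c := by
    intro t
    refine (transl hf h1 (t • u)).trans (le_of_eq ?_)
    rw [hc', ← mul_assoc, ← ENNReal.ofReal_mul (abs_nonneg t), Finset.mul_sum]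
    simp [abs_mul]
  have tr' : ∀ t : ℝ, ∫⁻ ω : ι → ℝ, (jd f (ω + t • u) - jd f ω) ≤ ENNReal.ofReal |t| * c := by
    intro t
    have := tr (-t)
    rw [← lintegral_add_right_eq_self _ (t • u)] at this
    simpa using this
  have step : ∀ h : ℝ, 0 < h → ∫⁻ ω, P ω * jd f ω ≤ ε * c + ENNReal.ofReal h * c := by
    intro h hh
    have hne : ENNReal.ofReal h ≠ 0 := by simpa using hh
    rw [← ENNReal.mul_le_mul_iff_right hne ENNReal.ofReal_ne_top]
    have hu' : ∃ i, (h • u) i ≠ 0 := by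
      obtain ⟨i, hi⟩ := hu
      exact ⟨i, by simp [hi, hh.ne']⟩
    set D : (ι → ℝ) → ℝ≥0∞ := fun ω => jd f ω - jd f (ω + h • u) with hD
    have hDm : Measurable D := hF.sub (hF.comp (by fun_prop))
    have tel : ∀ ω, jd f ω ≤ ∑' m : ℤ, D (ω + (m : ℝ) • h • u) := fun ω =>
      telescope hc (h • u) hu' ω
    have inner : ∀ r ∈ Set.Ioc 0 h, ∫⁻ ω, P ω * jd f ω ≤
        (∫⁻ ω, D ω * ∑' m : ℤ, P (ω + (r + (m : ℝ) * h) • u)) + ENNReal.ofReal h * c := by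
      intro r hr
      calc ∫⁻ ω, P ω * jd f ω = ∫⁻ ω, P (ω + r • u) * jd f (ω + r • u) :=
            (lintegral_add_right_eq_self (fun ω => P ω * jd f ω) (r • u)).symm
        _ ≤ ∫⁻ ω, ((∑' m : ℤ, P (ω + r • u) * D (ω + (m : ℝ) • h • u)) +
              (jd f (ω + r • u) - jd f ω)) := by
            refine lintegral_mono fun ω => ?_
            calc P (ω + r • u) * jd f (ω + r • u)
                ≤ P (ω + r • u) * (jd f ω + (jd f (ω + r • u) - jd f ω)) :=
                  mul_le_mul_right le_add_tsub _
              _ = P (ω + r • u) * jd f ω + P (ω + r • u) * (jd f (ω + r • u) - jd f ω) :=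
                  mul_add _ _ _
              _ ≤ _ := by
                  rw [ENNReal.tsum_mul_left]
                  exact add_le_add (mul_le_mul_right (tel ω) _) (mul_le_of_le_one_left' (hP1 _))
        _ = (∫⁻ ω, (∑' m : ℤ, P (ω + r • u) * D (ω + (m : ℝ) • h • u))) +
              ∫⁻ ω, (jd f (ω + r • u) - jd f ω) :=
            lintegral_add_right _ ((hF.comp (by fun_prop)).sub hF)
        _ ≤ _ := by
            refine add_le_add (le_of_eq ?_) ((tr' r).trans ?_)
            · rw [lintegral_tsum]
              · simp_rw [← ENNReal.tsum_mul_left]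
                rw [lintegral_tsum]
                · rw [← (Equiv.neg ℤ).tsum_eq]
                  refine tsum_congr fun m => ?_
                  rw [← lintegral_add_right_eq_self _ (((m : ℤ) : ℝ) • h • u)]
                  refine lintegral_congr fun ω => ?_
                  rw [mul_comm]
                  congr 2
                  · simp
                  · module
                · intro m
                  exact (hDm.mul (hP.comp (by fun_prop))).aemeasurable
              · intro m
                exact ((hP.comp (by fun_prop)).mul (hDm.comp (by fun_prop))).aemeasurable
            · gcongr
              rw [abs_of_pos hr.1]; exact hr.2
    calc ENNReal.ofReal h * ∫⁻ ω, P ω * jd f ω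
        = ∫⁻ r in Set.Ioc 0 h, (∫⁻ ω, P ω * jd f ω) := by simp [mul_comm]
      _ ≤ ∫⁻ r in Set.Ioc 0 h, ((∫⁻ ω, D ω * ∑' m : ℤ, P (ω + (r + (m : ℝ) * h) • u)) +
            ENNReal.ofReal h * c) := setLIntegral_mono' measurableSet_Ioc inner
      _ = (∫⁻ r in Set.Ioc 0 h, ∫⁻ ω, D ω * ∑' m : ℤ, P (ω + (r + (m : ℝ) * h) • u)) +
            ENNReal.ofReal h * (ENNReal.ofReal h * c) := by
          rw [lintegral_add_right _ measurable_const]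
          simp [mul_comm]
      _ = (∫⁻ ω, D ω * ∫⁻ r : ℝ, P (ω + r • u)) +
            ENNReal.ofReal h * (ENNReal.ofReal h * c) := by
          congr 1
          rw [lintegral_lintegral_swap]
          · refine lintegral_congr fun ω => ?_
            rw [lintegral_const_mul]
            · rw [lintegral_tsum]
              · rw [tile (fun r => P (ω + r • u)) hh]
              · intro m
                exact (hP.comp (by fun_prop)).aemeasurable
            · exact Measurable.tsum fun m => hP.comp (by fun_prop)
          · refine Measurable.aemeasurable ?_
            refine (hDm.comp measurable_snd).mul (Measurable.tsum fun m => hP.comp ?_)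
            fun_prop
      _ ≤ (∫⁻ ω, D ω * ε) + ENNReal.ofReal h * (ENNReal.ofReal h * c) := by
          refine add_le_add (lintegral_mono fun ω => mul_le_mul_right (hPε ω) _) le_rfl
      _ ≤ ENNReal.ofReal h * c * ε + ENNReal.ofReal h * (ENNReal.ofReal h * c) := by
          rw [lintegral_mul_const _ hDm]
          refine add_le_add (mul_le_mul_left ?_ _) le_rfl
          have := tr h
          rwa [abs_of_pos hh] at this
      _ = _ := by ring
  by_cases hε : ε * c = ⊤
  · rw [hε]; exact le_top
  have lim : Filter.Tendsto (fun h : ℝ => ε * c + ENNReal.ofReal h * c)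
      (nhdsWithin 0 (Set.Ioi 0)) (nhds (ε * c + ENNReal.ofReal 0 * c)) := by
    refine Filter.Tendsto.mono_left ?_ nhdsWithin_le_nhds
    refine tendsto_const_nhds.add (ENNReal.Tendsto.mul_const ?_ (Or.inr hctop))
    exact ENNReal.tendsto_ofReal Filter.tendsto_id
  have := ge_of_tendsto lim (eventually_nhdsWithin_of_forall fun h hh => step h hh)
  simpa using this

lemma meas_sub' {X : Type*} [MeasurableSpace X] {p q : X → ℕ} (hp : Measurable p)
    (hq : Measurable q) : Measurable fun x => p x - q x := hp.sub hq

lemma meas_sub {X : Type*} [MeasurableSpace X] {p q : X → ℕ} (hp : Measurable p)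
    (hq : Measurable q) : Measurable fun x => ((p x - q x : ℕ) : ℝ≥0∞) :=
  measurable_from_top.comp (meas_sub' hp hq)

/-- abstract counting function bound -/
lemma count_step {ι : Type*} [Fintype ι] {f : ℝ → ℝ} (hf : Measurable f)
    (h1 : ∫⁻ x, ENNReal.ofReal (f x) = 1) (hc : HasCompactSupport f)
    (hv : eVariationOn f Set.univ ≠ ⊤)
    (u : ι → ℝ) (hu : ∃ i, u i ≠ 0) (n : (ι → ℝ) → ℕ) (hn : Measurable n)
    (hmono : ∀ ω (t : ℝ), 0 ≤ t → n (ω + t • u) ≤ n ω)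
    (hone : ∀ ω (t : ℝ), 0 ≤ t → n ω ≤ n (ω + t • u) + 1) (ε : ℝ) (hε : 0 ≤ ε) (w : ι → ℝ) :
    ∫⁻ ω, ((n (ω + w) - n (ω + w + ε • u) : ℕ) : ℝ≥0∞) * jd f ω ≤
      ENNReal.ofReal ε * (ENNReal.ofReal (∑ i, |u i|) * eVariationOn f Set.univ) := by
  refine main_avg hf h1 hc hv u hu _ ?_ ?_ _ ?_
  · exact meas_sub (hn.comp (by fun_prop)) (hn.comp (by fun_prop))
  · intro ω
    have := hone (ω + w) ε hε
    exact_mod_cast (by omega : n (ω + w) - n (ω + w + ε • u) ≤ 1)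
  · intro ω
    set S : Set ℝ := {r | n (ω + r • u + w) - n (ω + r • u + w + ε • u) = 1} with hS
    have hSm : MeasurableSet S := by
      exact meas_sub' (p := fun r : ℝ => n (ω + r • u + w))
        (q := fun r : ℝ => n (ω + r • u + w + ε • u)) (hn.comp (by fun_prop))
        (hn.comp (by fun_prop)) (measurableSet_singleton 1)
    calc _ = ∫⁻ r : ℝ, S.indicator 1 r := by
          refine lintegral_congr fun r => ?_
          by_cases hr : r ∈ S
          · rw [Set.indicator_of_mem hr]
            rw [hS, Set.mem_ofPred_eq] at hr
            simp [hr]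
          · rw [Set.indicator_of_notMem hr]
            rw [hS, Set.mem_ofPred_eq] at hr
            have := hone (ω + r • u + w) ε hε
            have : n (ω + r • u + w) - n (ω + r • u + w + ε • u) = 0 := by omega
            simp [this]
      _ = volume S := lintegral_indicator_one hSm
      _ ≤ _ := Real.volume_le_diam S
      _ ≤ ENNReal.ofReal ε := by
          have main : ∀ r ∈ S, ∀ s ∈ S, r ≤ s → s - r ≤ ε := by
            intro r hr s hs hrs
            by_contra hlt
            push Not at hlt
            rw [hS, Set.mem_ofPred_eq] at hr hs
            have e1 := hmono (ω + r • u + w + ε • u) (s - r - ε) (by linarith)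
            have e2 := hone (ω + r • u + w) (s + ε - r) (by linarith)
            have e3 : ω + r • u + w + ε • u + (s - r - ε) • u = ω + s • u + w := by module
            have e4 : ω + r • u + w + (s + ε - r) • u = ω + s • u + w + ε • u := by module
            rw [e3] at e1
            rw [e4] at e2
            omega
          refine Metric.ediam_le fun r hr s hs => ?_
          rw [edist_dist, Real.dist_eq]
          apply ENNReal.ofReal_le_ofReal
          rcases le_total r s with h | h
          · rw [abs_sub_comm, abs_of_nonneg (by linarith)]; exact main r hr s hs h
          · rw [abs_of_nonneg (by linarith)]; exact main s hs r hr h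

lemma count_sum {ι : Type*} [Fintype ι] {f : ℝ → ℝ} (hf : Measurable f)
    (h1 : ∫⁻ x, ENNReal.ofReal (f x) = 1) (hc : HasCompactSupport f)
    (hv : eVariationOn f Set.univ ≠ ⊤)
    (u : ι → ι → ℝ) (hu : ∀ j, ∃ i, u j i ≠ 0) (K : ℝ) (hK : ∀ j, ∑ i, |u j i| ≤ K)
    (n : (ι → ℝ) → ℕ) (hn : Measurable n)
    (hmono : ∀ j ω (t : ℝ), 0 ≤ t → n (ω + t • u j) ≤ n ω)
    (hone : ∀ j ω (t : ℝ), 0 ≤ t → n ω ≤ n (ω + t • u j) + 1) (ε : ℝ) (hε : 0 ≤ ε)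
    (S : Finset ι) :
    ∫⁻ ω, ((n ω - n (ω + ε • ∑ j ∈ S, u j) : ℕ) : ℝ≥0∞) * jd f ω ≤
      S.card * (ENNReal.ofReal ε * (ENNReal.ofReal K * eVariationOn f Set.univ)) := by
  classical
  induction S using Finset.induction_on with
  | empty => simp
  | insert a S ha ih =>
    set w := ε • ∑ j ∈ S, u j with hw
    have e : ∀ ω, ω + ε • ∑ j ∈ insert a S, u j = ω + w + ε • u a := by
      intro ω; rw [Finset.sum_insert ha, hw]; module
    simp_rw [e]
    calc _ ≤ ∫⁻ ω, (((n ω - n (ω + w) : ℕ) : ℝ≥0∞) * jd f ω +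
            ((n (ω + w) - n (ω + w + ε • u a) : ℕ) : ℝ≥0∞) * jd f ω) := by
          refine lintegral_mono fun ω => ?_
          rw [← add_mul]
          refine mul_le_mul_left ?_ _
          rw [← Nat.cast_add]
          exact Nat.cast_le.2 (by omega)
      _ = _ := by
          refine lintegral_add_left (Measurable.mul ?_ (jd_meas hf)) _
          exact meas_sub hn (hn.comp (by fun_prop))
      _ ≤ _ := add_le_add ih
            (count_step hf h1 hc hv (u a) (hu a) n hn (hmono a) (hone a) ε hε w)
      _ ≤ _ := by
          rw [Finset.card_insert_of_notMem ha]
          push_cast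
          rw [add_mul, one_mul]
          gcongr
          exact hK a

end MT

section Anderson

variable {d : ℕ} {a : (Fin d → ℤ) → ℝ} (ha : (Function.support a).Finite)
  {l : ℕ} [NeZero l]

include ha in
lemma potential_eq (ω : (Fin d → ZMod l) → ℝ) (n : Fin d → ZMod l) :
    andersonPotential d a l ω n =
      ∑ k ∈ ha.toFinset, a k * ω (n - fun i => (k i : ZMod l)) := by
  classical
  have hp : ∀ m, periodization d a l m =
      ∑ k ∈ ha.toFinset, if (fun i => ((k i : ZMod l))) = m then a k else 0 := by
    intro m
    rw [periodization, finsum_eq_sum_of_support_subset]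
    · exact Finset.sum_congr rfl fun k _ => finsum_eq_if
    · intro k hk
      rw [Function.mem_support, finsum_eq_if] at hk
      simp only [Set.Finite.coe_toFinset, Function.mem_support]
      intro h0; apply hk; simp [h0]
  simp only [andersonPotential, hp, Finset.mul_sum]
  rw [Finset.sum_comm]
  refine Finset.sum_congr rfl fun k _ => ?_
  rw [Finset.sum_eq_single (n - fun i => (k i : ZMod l))]
  · simp [mul_comm]
  · intro j _ hj
    rw [if_neg, mul_zero]
    intro h; apply hj; rw [h]; abel
  · simp

/-- The map from couplings to potentials. -/
def potLin (d : ℕ) (a : (Fin d → ℤ) → ℝ) (l : ℕ) [NeZero l] :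
    ((Fin d → ZMod l) → ℝ) →ₗ[ℝ] ((Fin d → ZMod l) → ℝ) where
  toFun := andersonPotential d a l
  map_add' x y := by
    ext n; simp [andersonPotential, add_mul, Finset.sum_add_distrib]
  map_smul' c x := by
    ext n; simp [andersonPotential, Finset.mul_sum, mul_assoc]

lemma pot_add (ω v : (Fin d → ZMod l) → ℝ) : andersonPotential d a l (ω + v) =
    andersonPotential d a l ω + andersonPotential d a l v := (potLin d a l).map_add ω v

lemma pot_smul (t : ℝ) (v : (Fin d → ZMod l) → ℝ) : andersonPotential d a l (t • v) =
    t • andersonPotential d a l v := (potLin d a l).map_smul t v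

include ha in
lemma pot_lower (k : Fin d → ℤ) (hk : k ∈ ha.toFinset) (ω : (Fin d → ZMod l) → ℝ) :
    (|a k| - ∑ j ∈ ha.toFinset.erase k, |a j|) * ∑ n, |ω n| ≤
      ∑ n, |andersonPotential d a l ω n| := by
  classical
  have sh : ∀ k : Fin d → ℤ, ∑ n, |ω (n - fun i => (k i : ZMod l))| = ∑ n, |ω n| := fun k =>
    (Equiv.subRight (fun i => (k i : ZMod l))).sum_comp (fun n => |ω n|)
  calc _ = ∑ n, (|a k| * |ω (n - fun i => (k i : ZMod l))| -
        ∑ j ∈ ha.toFinset.erase k, |a j| * |ω (n - fun i => (j i : ZMod l))|) := by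
        rw [Finset.sum_sub_distrib, ← Finset.mul_sum, sh, Finset.sum_comm, sub_mul, Finset.sum_mul]
        simp_rw [← Finset.mul_sum, sh]
    _ ≤ _ := by
        refine Finset.sum_le_sum fun n _ => ?_
        rw [potential_eq ha, ← Finset.add_sum_erase _ _ hk, ← abs_mul]
        set r := ∑ j ∈ ha.toFinset.erase k, a j * ω (n - fun i => (j i : ZMod l)) with hr
        have h1 : |r| ≤ ∑ j ∈ ha.toFinset.erase k, |a j| * |ω (n - fun i => (j i : ZMod l))| := by
          refine (Finset.abs_sum_le_sum_abs _ _).trans (le_of_eq ?_)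
          exact Finset.sum_congr rfl fun j _ => abs_mul _ _
        have h2 := abs_add_le (a k * ω (n - fun i => (k i : ZMod l)) + r) (-r)
        rw [abs_neg, add_neg_cancel_right] at h2
        linarith

include ha in
lemma exists_dual (k : Fin d → ℤ) (hk : (∑ j ∈ ha.toFinset.erase k, |a j|) < |a k|)
    (j : Fin d → ZMod l) :
    ∃ u : (Fin d → ZMod l) → ℝ, andersonPotential d a l u = Pi.single j 1 ∧
      ∑ i, |u i| ≤ (|a k| - ∑ j ∈ ha.toFinset.erase k, |a j|)⁻¹ := by
  have hkm : k ∈ ha.toFinset := by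
    rw [Set.Finite.mem_toFinset, Function.mem_support]
    intro h
    rw [h, abs_zero] at hk
    exact absurd hk (not_lt.2 (Finset.sum_nonneg fun _ _ => abs_nonneg _))
  set δ := |a k| - ∑ j ∈ ha.toFinset.erase k, |a j| with hδ
  have hδ0 : 0 < δ := by linarith
  have hinj : Function.Injective (potLin d a l) := by
    rw [← LinearMap.ker_eq_bot, LinearMap.ker_eq_bot']
    intro ω hω
    have h1 := pot_lower ha k hkm ω
    have h2 : andersonPotential d a l ω = 0 := hω
    rw [h2] at h1
    simp only [Pi.zero_apply, abs_zero, Finset.sum_const_zero] at h1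
    have h3 : ∑ n, |ω n| ≤ 0 := by
      by_contra h
      push Not at h
      have := mul_pos hδ0 h
      linarith
    ext n
    have h4 := Finset.single_le_sum (f := fun n => |ω n|) (fun _ _ => abs_nonneg _)
      (Finset.mem_univ n)
    exact abs_nonpos_iff.1 (h4.trans h3)
  obtain ⟨u, hu⟩ := LinearMap.injective_iff_surjective.1 hinj (Pi.single j 1)
  refine ⟨u, hu, ?_⟩
  have h1 := pot_lower ha k hkm u
  have h2 : andersonPotential d a l u = Pi.single j 1 := hu
  have h3 : ∑ n, |(Pi.single j 1 : (Fin d → ZMod l) → ℝ) n| = 1 := by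
    rw [Finset.sum_eq_single j]
    · rw [Pi.single_eq_same, abs_one]
    · intro i _ hi; simp [Pi.single_eq_of_ne hi]
    · simp
  rw [h2, h3, ← hδ] at h1
  rwa [inv_eq_one_div, le_div_iff₀ hδ0, mul_comm]

lemma ham_symm (ω : (Fin d → ZMod l) → ℝ) : (andersonHamiltonian d a l ω).IsSymmetric := by
  rw [andersonHamiltonian, Matrix.isSymmetric_toEuclideanLin_iff]
  ext n m
  simp only [Matrix.conjTranspose_apply, andersonMatrix, star_add, star_sum]
  congr 1
  · refine Finset.sum_congr rfl fun i _ => ?_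
    rw [add_comm]
    congr 1
    · rw [apply_ite star, star_one, star_zero]
      exact if_congr ⟨fun h => by rw [h]; abel, fun h => by rw [h]; abel⟩ rfl rfl
    · rw [apply_ite star, star_one, star_zero]
      exact if_congr ⟨fun h => by rw [h]; abel, fun h => by rw [h]; abel⟩ rfl rfl
  · by_cases h : n = m
    · subst h; simp
    · rw [if_neg h, if_neg (Ne.symm h), star_zero]

lemma ham_quad (ω ω' : (Fin d → ZMod l) → ℝ) (x : EuclideanSpace ℂ (Fin d → ZMod l)) :
    (inner ℂ x (andersonHamiltonian d a l ω' x)).re =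
      (inner ℂ x (andersonHamiltonian d a l ω x)).re +
      ∑ n, (andersonPotential d a l ω' n - andersonPotential d a l ω n) * ‖x n‖ ^ 2 := by
  have h1 : ∀ n, (andersonHamiltonian d a l ω' x) n = (andersonHamiltonian d a l ω x) n +
      ((andersonPotential d a l ω' n - andersonPotential d a l ω n : ℝ) : ℂ) * x n := by
    intro n
    simp only [andersonHamiltonian, Matrix.ofLp_toEuclideanLin_apply, Matrix.mulVec, dotProduct,
      andersonMatrix, add_mul, Finset.sum_add_distrib]
    simp
    ring
  simp only [PiLp.inner_apply, h1, inner_add_right, Finset.sum_add_distrib, Complex.add_re,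
    Complex.re_sum]
  congr 1
  refine Finset.sum_congr rfl fun n _ => ?_
  rw [← smul_eq_mul (a := ((_ : ℝ) : ℂ)), inner_smul_right, inner_self_eq_norm_sq_to_K]
  rw [Complex.re_ofReal_mul]
  congr 1
  norm_cast

lemma count_meas (e : ℝ) : Measurable fun ω : (Fin d → ZMod l) → ℝ =>
    eigCount (andersonHamiltonian d a l ω) (Set.Iio e) := by
  refine measurable_of_Ioi fun m => IsOpen.measurableSet ?_
  rw [isOpen_iff_mem_nhds]
  intro ω hω
  obtain ⟨δ, hδ, h⟩ := quad_gap (ham_symm (a := a) ω) e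
  have hcont : Continuous (potLin d a l) := LinearMap.continuous_of_finiteDimensional _
  have h1 : ∀ᶠ ω' in nhds ω, ∀ n, andersonPotential d a l ω' n <
      andersonPotential d a l ω n + δ := by
    rw [Filter.eventually_all]
    intro n
    have : Continuous fun ω' => andersonPotential d a l ω' n := (continuous_apply n).comp hcont
    exact this.continuousAt.eventually_lt continuousAt_const (by linarith)
  filter_upwards [h1] with ω' h'
  have hω' : m < eigCount (andersonHamiltonian d a l ω) (Set.Iio e) := hω
  refine lt_of_lt_of_le hω' ?_
  refine le_eigCount (ham_symm ω') (specSub (andersonHamiltonian d a l ω) (Set.Iio e)) ?_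
  intro x hx h0
  rw [ham_quad ω ω']
  have h2 := h x hx
  have h3 : ∑ n, (andersonPotential d a l ω' n - andersonPotential d a l ω n) * ‖x n‖ ^ 2 <
      δ * ‖x‖ ^ 2 := by
    rw [EuclideanSpace.norm_sq_eq, Finset.mul_sum]
    obtain ⟨n, hn⟩ : ∃ n, x n ≠ 0 := by
      by_contra hcon
      push Not at hcon
      exact h0 (by ext n; simpa using hcon n)
    refine Finset.sum_lt_sum (fun n _ => ?_) ⟨n, Finset.mem_univ n, ?_⟩
    · exact mul_le_mul_of_nonneg_right (by linarith [h' n]) (by positivity)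
    · have : 0 < ‖x n‖ := norm_pos_iff.2 hn
      exact mul_lt_mul_of_pos_right (by linarith [h' n]) (by positivity)
  linarith

end Anderson

theorem lipschitz_IDS_discrete_dominant_component
    (d : ℕ) (hd1 : 1 ≤ d)
    (a : (Fin d → ℤ) → ℝ) (ha : (Function.support a).Finite)
    (hdom : ∃ k : Fin d → ℤ, (∑ j ∈ ha.toFinset.erase k, |a j|) < |a k|) :
    ∃ C : ℝ, 0 < C ∧ ∃ l₀ : ℕ, 1 ≤ l₀ ∧
      ∀ f : ℝ → ℝ, Measurable f → (∀ x, 0 ≤ f x) → HasCompactSupport f →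
        (∫ x, f x = 1) → BoundedVariationOn f Set.univ →
      ∀ (l : ℕ) [NeZero l], l₀ ≤ l →
      ∀ (E ε : ℝ), 0 ≤ ε →
        (∫⁻ ω, (eigCount (andersonHamiltonian d a l ω) (Set.Icc (E - ε) E) : ℝ≥0∞)
            ∂(couplingMeasure f (Fin d → ZMod l)))
          ≤ ENNReal.ofReal
              (C * (eVariationOn f Set.univ).toReal * ε * (l : ℝ) ^ d) := by
  classical
  obtain ⟨k, hk⟩ := hdom
  set δ := |a k| - ∑ j ∈ ha.toFinset.erase k, |a j| with hδ
  have hδ0 : 0 < δ := by linarith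
  refine ⟨δ⁻¹, by positivity, 1, le_rfl, ?_⟩
  intro f hf hf0 hc hint hbv l _ _ E ε hε
  have hv : eVariationOn f Set.univ ≠ ⊤ := hbv
  have h1 : ∫⁻ x, ENNReal.ofReal (f x) = 1 := by
    have hi : Integrable f := by
      by_contra h
      rw [integral_undef h] at hint
      exact zero_ne_one hint
    rw [← ofReal_integral_eq_lintegral_ofReal hi (Filter.Eventually.of_forall hf0), hint,
      ENNReal.ofReal_one]
  choose u hu1 hu2 using fun j : Fin d → ZMod l => exists_dual ha k hk j
  have step : ∀ η : ℝ, 0 < η →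
      (∫⁻ ω, (eigCount (andersonHamiltonian d a l ω) (Set.Icc (E - ε) E) : ℝ≥0∞)
            ∂(couplingMeasure f (Fin d → ZMod l)))
      ≤ ENNReal.ofReal (δ⁻¹ * (eVariationOn f Set.univ).toReal * (ε + η) * (l : ℝ) ^ d) := by
    intro η hη
    set n : ((Fin d → ZMod l) → ℝ) → ℕ :=
      fun ω => eigCount (andersonHamiltonian d a l ω) (Set.Iio (E + η)) with hn
    have hnm : Measurable n := count_meas (E + η)
    have hsum : andersonPotential d a l (∑ j, u j) = fun _ => 1 := by
      have : andersonPotential d a l (∑ j, u j) = ∑ j, andersonPotential d a l (u j) :=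
        map_sum (potLin d a l) u Finset.univ
      rw [this]
      simp_rw [hu1]
      ext m
      simp [Finset.sum_apply, Pi.single_apply]
    have hdiff : ∀ j ω (t : ℝ) m, andersonPotential d a l (ω + t • u j) m -
        andersonPotential d a l ω m = if m = j then t else 0 := by
      intro j ω t m
      rw [pot_add, pot_smul, hu1]
      simp [Pi.single_apply]
    have hpt : ∀ ω, eigCount (andersonHamiltonian d a l ω) (Set.Icc (E - ε) E) ≤
        n ω - n (ω + (ε + η) • ∑ j, u j) := by
      intro ω
      refine (eigCount_Icc (e' := E + η) (by linarith) hε).trans ?_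
      apply Nat.sub_le_sub_left
      have := eigCount_shift (e := E + η) (t := ε + η) (ham_symm (a := a) ω)
        (ham_symm (a := a) (ω + (ε + η) • ∑ j, u j)) (fun x => by
          rw [ham_quad ω (ω + (ε + η) • ∑ j, u j), pot_add, pot_smul, hsum]
          simp only [Pi.add_apply, Pi.smul_apply, smul_eq_mul, mul_one, add_sub_cancel_left]
          rw [← Finset.mul_sum, EuclideanSpace.norm_sq_eq])
      rwa [show E + η - (ε + η) = E - ε by ring] at this
    have hcs := count_sum hf h1 hc hv u (fun j => by
        by_contra hcon
        push Not at hcon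
        have h0 : u j = 0 := funext hcon
        have h2 := hu1 j
        rw [h0] at h2
        have h3 : andersonPotential d a l 0 = 0 := (potLin d a l).map_zero
        rw [h3] at h2
        have := congrFun h2 j
        simp at this) δ⁻¹ hu2 n hnm (fun j ω t ht => by
          refine eigCount_mono (ham_symm ω) (ham_symm _) fun x => ?_
          rw [ham_quad ω (ω + t • u j)]
          simp only [hdiff]
          refine le_add_of_nonneg_right (Finset.sum_nonneg fun m _ => ?_)
          split_ifs <;> positivity) (fun j ω t ht => by
          refine eigCount_rank_one (ham_symm _) (ham_symm ω)
            (EuclideanSpace.proj j : EuclideanSpace ℂ (Fin d → ZMod l) →L[ℂ] ℂ).toLinearMap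
            fun x hx => ?_
          have hx' : x j = 0 := hx
          rw [ham_quad ω (ω + t • u j)]
          simp only [hdiff]
          simp [hx']) (ε + η) (by linarith) Finset.univ
    calc _ ≤ ∫⁻ ω, ((n ω - n (ω + (ε + η) • ∑ j, u j) : ℕ) : ℝ≥0∞)
            ∂(couplingMeasure f (Fin d → ZMod l)) :=
          lintegral_mono fun ω => Nat.cast_le.2 (hpt ω)
      _ = ∫⁻ ω, ((n ω - n (ω + (ε + η) • ∑ j, u j) : ℕ) : ℝ≥0∞) * jd f ω := by
          rw [couplingMeasure]
          change lintegral (volume.withDensity (jd f)) _ = _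
          have hm : Measurable fun ω => ((n ω - n (ω + (ε + η) • ∑ j, u j) : ℕ) : ℝ≥0∞) :=
            meas_sub hnm (hnm.comp (by fun_prop))
          rw [lintegral_withDensity_eq_lintegral_mul _ (jd_meas hf) hm]
          simp [mul_comm]
      _ ≤ _ := hcs
      _ = _ := by
          rw [Finset.card_univ, Fintype.card_fun, ZMod.card, Fintype.card_fin]
          conv_lhs => rw [← ENNReal.ofReal_toReal hv]
          rw [← ENNReal.ofReal_mul (by positivity), ← ENNReal.ofReal_mul (by positivity),
            ← ENNReal.ofReal_natCast, ← ENNReal.ofReal_mul (by positivity)]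
          congr 1
          push_cast
          ring
  have lim : Filter.Tendsto (fun η : ℝ => ENNReal.ofReal
      (δ⁻¹ * (eVariationOn f Set.univ).toReal * (ε + η) * (l : ℝ) ^ d))
      (nhdsWithin 0 (Set.Ioi 0)) (nhds (ENNReal.ofReal
      (δ⁻¹ * (eVariationOn f Set.univ).toReal * (ε + 0) * (l : ℝ) ^ d))) := by
    refine Filter.Tendsto.mono_left ?_ nhdsWithin_le_nhds
    refine ENNReal.tendsto_ofReal ?_
    exact Continuous.tendsto (by fun_prop) 0
  have := ge_of_tendsto lim (eventually_nhdsWithin_of_forall fun h hh => step h hh)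
  simpa using this

end
end

section
/- (Abstract finite-volume Wegner estimate.) Let 𝓗 be a finite-dimensional complex inner product space, H₀ a Hermitian operator on 𝓗, Σ and Λ finite index sets, (V_k)_{k∈Σ} Hermitian operators on 𝓗, and (P_j)_{j∈Λ} orthogonal projections on 𝓗 with Σ_{j∈Λ} P_j = Id. Let (ω_k)_{k∈Σ} be independent, identically distributed real random variables whose common distribution has a compactly supported density f : ℝ → [0,∞) of finite total variation Var(f), and set H_ω = H₀ + Σ_{k∈Σ} ω_k V_k. Assume that for every j ∈ Λ there is a vector t(j) ∈ ℝ^Σ with Σ_{k∈Σ} t_k(j) V_k ≥ P_j. Then for every interval J ⊆ ℝ, 𝔼{ tr E_{H_ω}(J) } ≤ Var(f) · |J| · Σ_{j∈Λ} (tr P_j) · ‖t(j)‖_{ℓ¹}. -/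
/-!
Statement 5 (Abstract finite-volume Wegner estimate, finite-dimensional analogue):
Let `H₀` be Hermitian on a finite-dimensional complex inner product space, `(V_k)_{k∈Σ}`
Hermitian, `(P_j)_{j∈Λ}` orthogonal projections with `Σ_j P_j = Id`, and let `(ω_k)` be
i.i.d. with compactly supported density `f` of finite total variation; set
`H_ω = H₀ + Σ_k ω_k V_k`. If for every `j` there is `t(j)` with `Σ_k t_k(j) V_k ≥ P_j`,
then for every interval `J`:
`𝔼 { tr E_{H_ω}(J) } ≤ Var(f) · |J| · Σ_j (tr P_j) ‖t(j)‖_{ℓ¹}`.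
-/

open MeasureTheory
open scoped ENNReal InnerProductSpace BigOperators

noncomputable section

lemma wg_f_le (f : ℝ → ℝ) (hfBV : BoundedVariationOn f Set.univ) (hfsupp : HasCompactSupport f)
    (x : ℝ) : |f x| ≤ (eVariationOn f Set.univ).toReal := by
  obtain ⟨R, hR⟩ := hfsupp.isCompact.isBounded.subset_closedBall 0
  have h0 : f (|R| + 1) = 0 := by
    by_contra h
    have := hR (subset_tsupport f h)
    simp only [Metric.mem_closedBall, dist_zero_right, Real.norm_eq_abs] at this
    have h1 := le_abs_self (|R| + 1)
    have h2 := le_abs_self R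
    linarith
  have := hfBV.dist_le (Set.mem_univ x) (Set.mem_univ (|R| + 1))
  rwa [h0, Real.dist_eq, sub_zero] at this

lemma wg_f_integrable (f : ℝ → ℝ) (hfint : ∫ x, f x = 1) : Integrable f := by
  by_contra h
  rw [integral_undef h] at hfint
  norm_num at hfint

lemma wg_shift_nonneg (f : ℝ → ℝ) (hfi : Integrable f)
    (hfBV : BoundedVariationOn f Set.univ) (hfsupp : HasCompactSupport f) (h : ℝ) (hh : 0 ≤ h) :
    ∫ x, |f x - f (x - h)| ≤ h * (eVariationOn f Set.univ).toReal := by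
  obtain ⟨R, hR⟩ := hfsupp.isCompact.isBounded.subset_closedBall 0
  have hz : ∀ x, R < |x| → f x = 0 := by
    intro x hx
    by_contra h
    have := hR (subset_tsupport f h)
    simp only [Metric.mem_closedBall, dist_zero_right, Real.norm_eq_abs] at this
    linarith
  have hl := hfBV.locallyBoundedVariationOn
  set v : ℝ → ℝ := fun x => variationOnFromTo f Set.univ 0 x with hv
  have hmono : Monotone v := by
    rw [← monotoneOn_univ]
    exact variationOnFromTo.monotoneOn hl (Set.mem_univ 0)
  have hdiff : ∀ x, |f x - f (x - h)| ≤ v x - v (x - h) := fun x =>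
    variationOnFromTo.abs_sub_le_sub_of_le hl (Set.mem_univ _) (Set.mem_univ _) (Set.mem_univ _)
      (by linarith)
  set a : ℝ := -|R| - 1
  set b : ℝ := |R| + h + 1
  have hRa := le_abs_self R
  have hR0 := abs_nonneg R
  have hab : a ≤ b := by simp only [a, b]; linarith
  have hvi : ∀ c d : ℝ, IntervalIntegrable v volume c d := fun c d => hmono.intervalIntegrable
  have hvi' : ∀ c d : ℝ, IntervalIntegrable (fun x => v (x - h)) volume c d := fun c d => 
    (hmono.comp (fun x y hxy => by simpa using hxy : Monotone (fun x : ℝ => x - h))).intervalIntegrable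
  have hi : Integrable (fun x => |f x - f (x - h)|) := (hfi.sub (hfi.comp_sub_right h)).abs
  have e1 : ∫ x, |f x - f (x - h)| = ∫ x in a..b, |f x - f (x - h)| := by
    rw [intervalIntegral.integral_of_le hab, setIntegral_eq_integral_of_forall_compl_eq_zero]
    intro x hx
    rw [Set.mem_Ioc, not_and_or, not_lt, not_le] at hx
    have : R < |x| ∧ R < |x - h| := by
      simp only [a, b] at hx
      rcases hx with hx | hx
      · have := neg_le_abs x; have := neg_le_abs (x - h); constructor <;> linarith
      · have := le_abs_self x; have := le_abs_self (x - h); constructor <;> linarith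
    rw [hz x this.1, hz _ this.2]; simp
  rw [e1]
  have e2 : ∫ x in a..b, |f x - f (x - h)| ≤ ∫ x in a..b, (v x - v (x - h)) :=
    intervalIntegral.integral_mono_on hab hi.intervalIntegrable ((hvi a b).sub (hvi' a b))
      (fun x _ => hdiff x)
  refine e2.trans ?_
  rw [intervalIntegral.integral_sub (hvi a b) (hvi' a b),
    intervalIntegral.integral_comp_sub_right]
  have e3 : (∫ x in (b-h)..b, v x) ≤ ∫ x in (b-h)..b, v b :=
    intervalIntegral.integral_mono_on (by linarith) (hvi _ _) (by simp) (fun x hx => hmono hx.2)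
  have e4 : (∫ x in (a-h)..a, v (a - h)) ≤ ∫ x in (a-h)..a, v x :=
    intervalIntegral.integral_mono_on (by linarith) (by simp) (hvi _ _) (fun x hx => hmono hx.1)
  have e5 := intervalIntegral.integral_interval_sub_interval_comm (hvi a b) (hvi (a-h) (b-h)) (hvi a (a-h))
  have e6 : v b - v (a - h) ≤ (eVariationOn f Set.univ).toReal := by
    rw [variationOnFromTo.sub_right hl (Set.mem_univ _) (Set.mem_univ _) (Set.mem_univ _)]
    exact (le_abs_self _).trans (variationOnFromTo.abs_le_eVariationOn hfBV)
  simp only [intervalIntegral.integral_const, smul_eq_mul, sub_sub_cancel] at e3 e4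
  rw [e5, intervalIntegral.integral_symm (a-h) a, intervalIntegral.integral_symm (b-h) b]
  have := mul_le_mul_of_nonneg_left e6 hh
  linarith

lemma wg_shift (f : ℝ → ℝ) (hfi : Integrable f)
    (hfBV : BoundedVariationOn f Set.univ) (hfsupp : HasCompactSupport f) (h : ℝ) :
    ∫ x, |f x - f (x - h)| ≤ |h| * (eVariationOn f Set.univ).toReal := by
  rcases le_total 0 h with hh | hh
  · rw [abs_of_nonneg hh]; exact wg_shift_nonneg f hfi hfBV hfsupp h hh
  · have := wg_shift_nonneg f hfi hfBV hfsupp (-h) (by linarith)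
    rw [abs_of_nonpos hh]
    refine le_trans (le_of_eq ?_) this
    rw [← integral_add_right_eq_self _ h]
    congr 1; ext x
    rw [abs_sub_comm]; simp

/-- product density -/
def wgF (f : ℝ → ℝ) (K : Type*) [Fintype K] (ω : K → ℝ) : ℝ := ∏ k, f (ω k)

lemma wgF_integrable (f : ℝ → ℝ) (K : Type*) [Fintype K] (hfi : Integrable f) :
    Integrable (wgF f K) := by
  exact Integrable.fintype_prod (fun _ => hfi)

lemma wgF_shift (f : ℝ → ℝ) {K : Type*} [Fintype K] (hfi : Integrable f)
    (hfpos : ∀ x, 0 ≤ f x) (hfint : ∫ x, f x = 1)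
    (hfBV : BoundedVariationOn f Set.univ) (hfsupp : HasCompactSupport f) (τ : K → ℝ) :
    ∫ ω, |wgF f K ω - wgF f K (ω - τ)| ≤ (∑ k, |τ k|) * (eVariationOn f Set.univ).toReal := by
  classical
  have hF := wgF_integrable f K hfi
  set D : (K → ℝ) → ℝ := fun τ => ∫ ω, |wgF f K ω - wgF f K (ω - τ)| with hD
  have hint : ∀ τ, Integrable (fun ω => |wgF f K ω - wgF f K (ω - τ)|) := fun τ =>
    (hF.sub (hF.comp_sub_right τ)).abs
  have hsub : ∀ x y, D (x + y) ≤ D x + D y := by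
    intro x y
    have e : D y = ∫ ω, |wgF f K (ω - x) - wgF f K (ω - x - y)| := 
      (integral_sub_right_eq_self (fun ω => |wgF f K ω - wgF f K (ω - y)|) x).symm
    rw [e, ← integral_add (hint x) ((hint y).comp_sub_right x)]
    refine integral_mono (hint _) ((hint x).add ((hint y).comp_sub_right x)) fun ω => ?_
    simp only [← sub_sub]
    exact abs_sub_le _ _ _
  have h0 : D 0 = 0 := by simp [hD]
  have hsingle : ∀ k (c : ℝ), D (Pi.single k c) ≤ |c| * (eVariationOn f Set.univ).toReal := by
    intro k c
    have e : ∀ ω : K → ℝ, |wgF f K ω - wgF f K (ω - Pi.single k c)| =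
        ∏ i, (if i = k then (fun x => |f x - f (x - c)|) else f) (ω i) := by
      intro ω
      simp only [wgF]
      rw [← Finset.mul_prod_erase _ _ (Finset.mem_univ k), ← Finset.mul_prod_erase _ _ (Finset.mem_univ k),
        ← Finset.mul_prod_erase _ (fun i => (if i = k then (fun x => |f x - f (x - c)|) else f) (ω i)) (Finset.mem_univ k)]
      have e1 : ∏ x ∈ Finset.univ.erase k, f ((ω - (Pi.single k c : K → ℝ)) x) = ∏ x ∈ Finset.univ.erase k, f (ω x) := by
        refine Finset.prod_congr rfl fun i hi => ?_
        simp [Finset.ne_of_mem_erase hi]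
      have e2 : ∏ i ∈ Finset.univ.erase k, (if i = k then (fun x => |f x - f (x - c)|) else f) (ω i) = ∏ x ∈ Finset.univ.erase k, f (ω x) := by
        refine Finset.prod_congr rfl fun i hi => ?_
        simp [Finset.ne_of_mem_erase hi]
      rw [e1, e2, ← sub_mul, abs_mul, abs_of_nonneg (Finset.prod_nonneg fun i _ => hfpos _)]
      simp
    simp only [hD, e]
    rw [integral_fintype_prod_volume_eq_prod]
    rw [← Finset.mul_prod_erase _ _ (Finset.mem_univ k)]
    have e3 : ∏ i ∈ Finset.univ.erase k, ∫ x, (if i = k then (fun x => |f x - f (x - c)|) else f) x = 1 := by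
      refine Finset.prod_eq_one fun i hi => ?_
      simp [Finset.ne_of_mem_erase hi, hfint]
    rw [e3, mul_one]
    simpa using wg_shift f hfi hfBV hfsupp c
  have : D τ = D (∑ k, Pi.single k (τ k)) := by rw [Finset.univ_sum_single]
  change D τ ≤ _
  rw [this, Finset.sum_mul]
  exact (Finset.le_sum_of_subadditive D h0.le hsub _ _).trans (Finset.sum_le_sum fun k _ => hsingle k _)

lemma wg_line1 (G : ℝ → ℝ) (hG : Integrable G) (h : ℝ) (hh : 0 < h) :
    2 * ∫ s in Set.Ioc 0 h, G s ≤ ∫ s, |G s - G (s + h)| := by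
  classical
  set σ : ℝ → ℝ := fun s => if 0 < s then 1 else -1 with hσ
  have hσm : Measurable σ := Measurable.ite measurableSet_Ioi measurable_const measurable_const
  have hσb : ∀ s, ‖σ s‖ ≤ 1 := by intro s; simp only [hσ]; split_ifs <;> simp
  have hGh := hG.comp_add_right h
  have i1 : Integrable (fun s => σ s * G s) := hG.bdd_mul hσm.aestronglyMeasurable (Filter.Eventually.of_forall hσb)
  have i2 : Integrable (fun s => σ s * G (s + h)) := hGh.bdd_mul hσm.aestronglyMeasurable (Filter.Eventually.of_forall hσb)
  have i3 : Integrable (fun s => σ (s - h) * G s) := by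
    have := i2.comp_sub_right h
    simpa using this
  have e1 : ∫ s, σ s * G (s + h) = ∫ s, σ (s - h) * G s := by
    rw [← integral_add_right_eq_self (fun s => σ (s - h) * G s) h]
    simp
  have e2 : ∫ s, (σ s * G s - σ s * G (s + h)) ≤ ∫ s, |G s - G (s + h)| := by
    refine integral_mono (i1.sub i2) (hG.sub hGh).abs fun s => ?_
    simp only [hσ]
    split_ifs
    · have := le_abs_self (G s - G (s + h)); linarith
    · have := neg_le_abs (G s - G (s + h)); linarith
  refine le_trans (le_of_eq ?_) e2
  rw [integral_sub i1 i2, e1, ← integral_sub i1 i3, ← integral_const_mul,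
    ← integral_indicator measurableSet_Ioc]
  congr 1; ext s
  simp only [Set.indicator, hσ, Set.mem_Ioc]
  split_ifs <;> grind

lemma wgF_line_integrable (f : ℝ → ℝ) {K : Type*} [Fintype K] (hfmeas : Measurable f) (hfi : Integrable f)
    (hfBV : BoundedVariationOn f Set.univ) (hfsupp : HasCompactSupport f) (t : K → ℝ) (ht : t ≠ 0)
    (ω : K → ℝ) : Integrable (fun s : ℝ => wgF f K (ω - s • t)) := by
  classical
  obtain ⟨k, hk⟩ := Function.ne_iff.mp ht
  have h1 : Integrable (fun s : ℝ => f (ω k - s * t k)) := by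
    have h := (hfi.comp_sub_left (ω k)).comp_mul_right' hk
    simpa using h
  have h2 := h1.bdd_mul (f := fun s : ℝ => ∏ i ∈ Finset.univ.erase k, f (ω i - s * t i))
    (c := ∏ i ∈ Finset.univ.erase k, (eVariationOn f Set.univ).toReal)
    (by apply Measurable.aestronglyMeasurable; fun_prop)
    (Filter.Eventually.of_forall fun s => by
      rw [norm_prod]
      exact Finset.prod_le_prod (fun _ _ => norm_nonneg _) fun i _ => wg_f_le f hfBV hfsupp _)
  convert h2 using 2 with s
  simp only [wgF]
  rw [mul_comm, Finset.mul_prod_erase _ (fun i => f (ω i - s * t i)) (Finset.mem_univ k)]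
  simp

lemma wg_dir (f : ℝ → ℝ) {K : Type*} [Fintype K] (hfmeas : Measurable f)
    (hfpos : ∀ x, 0 ≤ f x) (hfint : ∫ x, f x = 1)
    (hfBV : BoundedVariationOn f Set.univ) (hfsupp : HasCompactSupport f) (t : K → ℝ) (ht : t ≠ 0)
    (g : (K → ℝ) → ℝ≥0∞) (hg : Measurable g) (M : ℝ≥0∞) (hM : M ≠ ⊤) (hgM : ∀ ω, g ω ≤ M)
    (C : ℝ≥0∞) (hC : ∀ ω, ∫⁻ s : ℝ, g (ω + s • t) ≤ C) :
    2 * ∫⁻ ω, g ω * ENNReal.ofReal (wgF f K ω) ≤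
      C * ENNReal.ofReal ((∑ k, |t k|) * (eVariationOn f Set.univ).toReal) := by
  have hfi := wg_f_integrable f hfint
  have hF := wgF_integrable f K hfi
  have hFm : Measurable (wgF f K) := by unfold wgF; fun_prop
  have hFpos : ∀ ω, 0 ≤ wgF f K ω := fun ω => Finset.prod_nonneg fun _ _ => hfpos _
  set D : ℝ := (∑ k, |t k|) * (eVariationOn f Set.univ).toReal with hD
  have hD0 : 0 ≤ D := by positivity
  set F := wgF f K
  have hshift : ∀ s : ℝ, 0 ≤ s → ∫⁻ ω, ENNReal.ofReal |F ω - F (ω - s • t)| ≤ ENNReal.ofReal s * ENNReal.ofReal D := by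
    intro s hs
    have hi : Integrable (fun ω => |F ω - F (ω - s • t)|) := (hF.sub (hF.comp_sub_right _)).abs
    rw [← ofReal_integral_eq_lintegral_ofReal hi
      (Filter.Eventually.of_forall fun _ => abs_nonneg _), ← ENNReal.ofReal_mul hs]
    refine ENNReal.ofReal_le_ofReal ((wgF_shift f hfi hfpos hfint hfBV hfsupp (s • t)).trans (le_of_eq ?_))
    simp only [Pi.smul_apply, smul_eq_mul, abs_mul, abs_of_nonneg hs, ← Finset.mul_sum, hD]
    ring
  set I := ∫⁻ ω, g ω * ENNReal.ofReal (F ω)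
  have key : ∀ h : ℝ, 0 < h → 2 * I ≤ C * ENNReal.ofReal D + 2 * M * ENNReal.ofReal D * ENNReal.ofReal h := by
    intro h hh
    have a1 : ∀ s ∈ Set.Ioc 0 h, I ≤ (∫⁻ ω, g ω * ENNReal.ofReal (F (ω - s • t))) +
        M * (ENNReal.ofReal h * ENNReal.ofReal D) := by
      intro s hs
      calc I ≤ ∫⁻ ω, (g ω * ENNReal.ofReal (F (ω - s • t)) + M * ENNReal.ofReal |F ω - F (ω - s • t)|) := by
            refine lintegral_mono fun ω => ?_
            calc g ω * ENNReal.ofReal (F ω) ≤ g ω * (ENNReal.ofReal (F (ω - s • t)) + ENNReal.ofReal |F ω - F (ω - s • t)|) := by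
                  gcongr
                  rw [← ENNReal.ofReal_add (hFpos _) (abs_nonneg _)]
                  refine ENNReal.ofReal_le_ofReal ?_
                  have := le_abs_self (F ω - F (ω - s • t))
                  linarith
              _ ≤ _ := by rw [mul_add]; gcongr; exact hgM ω
        _ = (∫⁻ ω, g ω * ENNReal.ofReal (F (ω - s • t))) + M * ∫⁻ ω, ENNReal.ofReal |F ω - F (ω - s • t)| := by
            rw [lintegral_add_right _ (by fun_prop), lintegral_const_mul _ (by fun_prop)]
        _ ≤ _ := by
            gcongr
            refine (hshift s hs.1.le).trans ?_
            gcongr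
            exact hs.2
    have a2 : ENNReal.ofReal h * I ≤ (∫⁻ s in Set.Ioc 0 h, ∫⁻ ω, g ω * ENNReal.ofReal (F (ω - s • t))) +
        ENNReal.ofReal h * (M * (ENNReal.ofReal h * ENNReal.ofReal D)) := by
      have := setLIntegral_mono' (μ := volume) measurableSet_Ioc a1
      rw [lintegral_add_right _ (by fun_prop)] at this
      simpa [mul_comm] using this
    have a3 : 2 * (∫⁻ s in Set.Ioc 0 h, ∫⁻ ω, g ω * ENNReal.ofReal (F (ω - s • t))) ≤ C * (ENNReal.ofReal h * ENNReal.ofReal D) := by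
      rw [lintegral_lintegral_swap (by apply Measurable.aemeasurable; fun_prop)]
      calc 2 * ∫⁻ ω, ∫⁻ s in Set.Ioc 0 h, g ω * ENNReal.ofReal (F (ω - s • t))
          = ∫⁻ ω, g ω * (2 * ∫⁻ s in Set.Ioc 0 h, ENNReal.ofReal (F (ω - s • t))) := by
            rw [← lintegral_const_mul' _ _ (by simp)]
            refine lintegral_congr fun ω => ?_
            rw [lintegral_const_mul _ (by fun_prop)]
            ring
        _ ≤ ∫⁻ ω, g ω * ∫⁻ s : ℝ, ENNReal.ofReal |F (ω - s • t) - F (ω - s • t - h • t)| := by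
            refine lintegral_mono fun ω => ?_
            gcongr
            have hl := wgF_line_integrable f hfmeas hfi hfBV hfsupp t ht ω
            have := wg_line1 _ hl h hh
            have e : ∀ s : ℝ, ω - (s + h) • t = ω - s • t - h • t := by intro s; rw [add_smul]; abel
            simp only [e] at this
            rw [← ofReal_integral_eq_lintegral_ofReal hl.integrableOn (Filter.Eventually.of_forall fun _ => hFpos _),
              ← ofReal_integral_eq_lintegral_ofReal, ← ENNReal.ofReal_ofNat 2, ← ENNReal.ofReal_mul (by norm_num)]
            · exact ENNReal.ofReal_le_ofReal this
            · refine Integrable.abs (hl.sub ?_)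
              have := hl.comp_add_right h
              simpa only [e] using this
            · exact Filter.Eventually.of_forall fun _ => abs_nonneg _
        _ = ∫⁻ ω, ∫⁻ s : ℝ, g ω * ENNReal.ofReal |F (ω - s • t) - F (ω - s • t - h • t)| := by
            refine lintegral_congr fun ω => ?_
            rw [lintegral_const_mul _ (by fun_prop)]
        _ = ∫⁻ s : ℝ, ∫⁻ ω, g ω * ENNReal.ofReal |F (ω - s • t) - F (ω - s • t - h • t)| := by
            rw [lintegral_lintegral_swap (by apply Measurable.aemeasurable; fun_prop)]
        _ = ∫⁻ s : ℝ, ∫⁻ ω, g (ω + s • t) * ENNReal.ofReal |F ω - F (ω - h • t)| := by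
            refine lintegral_congr fun s => ?_
            rw [← lintegral_add_right_eq_self _ (s • t)]
            simp
        _ = ∫⁻ ω, (∫⁻ s : ℝ, g (ω + s • t)) * ENNReal.ofReal |F ω - F (ω - h • t)| := by
            rw [lintegral_lintegral_swap (by apply Measurable.aemeasurable; fun_prop)]
            refine lintegral_congr fun ω => ?_
            rw [lintegral_mul_const _ (by fun_prop)]
        _ ≤ ∫⁻ ω, C * ENNReal.ofReal |F ω - F (ω - h • t)| := by
            refine lintegral_mono fun ω => ?_
            gcongr
            exact hC ω
        _ ≤ _ := by
            rw [lintegral_const_mul _ (by fun_prop)]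
            gcongr
            exact hshift h hh.le
    have hne : ENNReal.ofReal h ≠ 0 := by simpa using hh
    rw [← ENNReal.mul_le_mul_iff_right hne ENNReal.ofReal_ne_top]
    calc ENNReal.ofReal h * (2 * I) = 2 * (ENNReal.ofReal h * I) := by ring
      _ ≤ 2 * ((∫⁻ s in Set.Ioc 0 h, ∫⁻ ω, g ω * ENNReal.ofReal (F (ω - s • t))) +
        ENNReal.ofReal h * (M * (ENNReal.ofReal h * ENNReal.ofReal D))) := by gcongr
      _ ≤ C * (ENNReal.ofReal h * ENNReal.ofReal D) + 2 * (ENNReal.ofReal h * (M * (ENNReal.ofReal h * ENNReal.ofReal D))) := by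
          rw [mul_add]; gcongr
      _ = _ := by ring
  have hlim : Filter.Tendsto (fun h : ℝ => C * ENNReal.ofReal D + 2 * M * ENNReal.ofReal D * ENNReal.ofReal h)
      (nhdsWithin 0 (Set.Ioi 0)) (nhds (C * ENNReal.ofReal D + 2 * M * ENNReal.ofReal D * ENNReal.ofReal 0)) := by
    refine tendsto_const_nhds.add (ENNReal.Tendsto.const_mul ?_ (Or.inr ?_))
    · exact (ENNReal.continuous_ofReal.tendsto 0).mono_left nhdsWithin_le_nhds
    · exact ENNReal.mul_ne_top (ENNReal.mul_ne_top (by simp) hM) ENNReal.ofReal_ne_top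
  have := ge_of_tendsto hlim (by filter_upwards [self_mem_nhdsWithin] with h hh using key h hh)
  simpa using this

section resolvent

variable {E : Type*} [NormedAddCommGroup E] [InnerProductSpace ℂ E] [FiniteDimensional ℂ E]

lemma wg_unit (T : E →L[ℂ] E) (ε : ℝ) (hε : 0 < ε)
    (h : ∀ u, (⟪u, T u⟫_ℂ).im ≤ -(ε * ‖u‖ ^ 2)) : IsUnit T := by
  have : CompleteSpace E := FiniteDimensional.complete ℂ E
  rw [ContinuousLinearMap.isUnit_iff_bijective]
  have hinj : Function.Injective (T : E →ₗ[ℂ] E) := by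
    rw [← LinearMap.ker_eq_bot, LinearMap.ker_eq_bot']
    intro u hu
    have h1 := h u
    have hu' : T u = 0 := hu
    rw [hu', inner_zero_right, Complex.zero_im] at h1
    by_contra hne
    have : 0 < ε * ‖u‖ ^ 2 := by positivity
    linarith
  exact ⟨hinj, LinearMap.injective_iff_surjective.mp hinj⟩

/-- matrix element of the resolvent -/
def wgR (T : E →L[ℂ] E) (φ : E) : ℂ := ⟪φ, Ring.inverse T φ⟫_ℂ

lemma wg_inv_apply {E : Type*} [NormedAddCommGroup E] [InnerProductSpace ℂ E] (T : E →L[ℂ] E) (hT : IsUnit T) (φ : E) : T (Ring.inverse T φ) = φ := by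
  have := Ring.mul_inverse_cancel T hT
  calc T (Ring.inverse T φ) = (T * Ring.inverse T) φ := rfl
    _ = φ := by rw [this]; rfl

lemma wg_R_im (T : E →L[ℂ] E) (hT : IsUnit T) (φ : E) :
    (wgR T φ).im = -(⟪Ring.inverse T φ, T (Ring.inverse T φ)⟫_ℂ).im := by
  rw [wg_inv_apply T hT, ← inner_conj_symm, Complex.conj_im, neg_neg]; rfl

lemma wg_R_diff (T : E →L[ℂ] E) (hT : IsUnit T) (φ : E) :
    DifferentiableAt ℂ (fun T => wgR T φ) T := by
  have : CompleteSpace E := FiniteDimensional.complete ℂ E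
  have h1 : DifferentiableAt ℂ (Ring.inverse : (E →L[ℂ] E) → (E →L[ℂ] E)) T := differentiableAt_inverse hT
  have h2 := h1.clm_apply (differentiableAt_const φ)
  exact ((innerSL ℂ φ).differentiableAt (x := Ring.inverse T φ)).comp T h2

lemma wg_R_bound (T : E →L[ℂ] E) (ε : ℝ) (hε : 0 < ε)
    (h : ∀ u, (⟪u, T u⟫_ℂ).im ≤ -(ε * ‖u‖ ^ 2)) (φ : E) (hφ : ‖φ‖ = 1) :
    0 ≤ (wgR T φ).im ∧ (wgR T φ).im ≤ 1 / ε := by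
  have hT := wg_unit T ε hε h
  set u := Ring.inverse T φ with hu
  have h1 := h u
  have h2 := wg_R_im T hT φ
  have h3 : (wgR T φ).im ≤ ‖u‖ := by
    refine (Complex.im_le_norm _).trans ((norm_inner_le_norm _ _).trans ?_)
    rw [hφ, one_mul]
  rw [← hu] at h2
  have h0 : 0 ≤ ε * ‖u‖ ^ 2 := by positivity
  refine ⟨by linarith, h3.trans ?_⟩
  rw [le_div_iff₀ hε]
  have h4 : ε * ‖u‖ ^ 2 ≤ ‖u‖ := by linarith
  by_contra hlt
  push Not at hlt
  have : 0 < ‖u‖ := by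
    rcases (norm_nonneg u).eq_or_lt with h | h
    · rw [← h] at hlt; norm_num at hlt
    · exact h
  nlinarith

lemma wg_line (B Q : E →L[ℂ] E) (φ : E) (ε : ℝ) (hε : 0 < ε)
    (hB : ∀ u, (⟪u, B u⟫_ℂ).im ≤ -(ε * ‖u‖ ^ 2)) (hQ : ∀ u, (⟪u, Q u⟫_ℂ).im = 0)
    (hQφ : ∀ u, ‖⟪φ, u⟫_ℂ‖ ^ 2 ≤ (⟪u, Q u⟫_ℂ).re) :
    ∫⁻ x : ℝ, ENNReal.ofReal (wgR (B + (x : ℂ) • Q) φ).im ≤ ENNReal.ofReal (2 * Real.pi) := by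
  have him : ∀ (s : ℂ) u, (⟪u, (B + s • Q) u⟫_ℂ).im = (⟪u, B u⟫_ℂ).im + s.im * (⟪u, Q u⟫_ℂ).re := by
    intro s u
    simp only [add_apply, smul_apply, inner_add_right,
      inner_smul_right, Complex.add_im, Complex.mul_im, hQ u]
    ring
  have hQ0 : ∀ u, 0 ≤ (⟪u, Q u⟫_ℂ).re := fun u => (sq_nonneg _).trans (hQφ u)
  have hdis : ∀ s : ℂ, s.im ≤ 0 → ∀ u, (⟪u, (B + s • Q) u⟫_ℂ).im ≤ -(ε * ‖u‖ ^ 2) := by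
    intro s hs u
    rw [him]
    have := hB u
    have := mul_nonneg (neg_nonneg.mpr hs) (hQ0 u)
    linarith
  have hun : ∀ s : ℂ, s.im ≤ 0 → IsUnit (B + s • Q) := fun s hs => wg_unit _ ε hε (hdis s hs)
  set F : ℂ → ℂ := fun s => wgR (B + s • Q) φ with hF
  have hFd : ∀ s : ℂ, s.im ≤ 0 → DifferentiableAt ℂ F s := by
    intro s hs
    have h1 : DifferentiableAt ℂ (fun s : ℂ => B + s • Q) s := by fun_prop
    exact DifferentiableAt.comp (g := fun T => wgR T φ) s (wg_R_diff _ (hun s hs) φ) h1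
  have hFlow : ∀ s : ℂ, s.im ≤ 0 → (-s.im) * ‖F s‖ ^ 2 ≤ (F s).im := by
    intro s hs
    have h1 := wg_R_im _ (hun s hs) φ
    set u := Ring.inverse (B + s • Q) φ with hu
    have h2 : F s = ⟪φ, u⟫_ℂ := rfl
    have h3 : (F s).im = _ := h1
    rw [h3, him, h2]
    have h4 := hB u
    have h5 := mul_le_mul_of_nonneg_left (hQφ u) (neg_nonneg.mpr hs)
    have : 0 ≤ ε * ‖u‖ ^ 2 := by positivity
    linarith
  have hF0 : ∀ s : ℂ, s.im ≤ 0 → 0 ≤ (F s).im := fun s hs =>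
    le_trans (mul_nonneg (neg_nonneg.mpr hs) (sq_nonneg _)) (hFlow s hs)
  -- points on the circles
  set p : ℝ → ℝ → ℂ := fun η x => circleMap (-(η : ℂ) * Complex.I) η (Real.pi / 2 - x / η) with hp
  have hcm : ∀ η : ℝ, 0 < η → ∀ θ, (circleMap (-(η : ℂ) * Complex.I) η θ).im ≤ 0 := by
    intro η hη θ
    simp only [circleMap, Complex.add_im, Complex.mul_im, Complex.exp_ofReal_mul_I_im,
      Complex.exp_ofReal_mul_I_re]
    simp
    nlinarith [Real.sin_le_one θ]
  have hcont : ∀ η : ℝ, 0 < η → Continuous (fun θ : ℝ => (F (circleMap (-(η : ℂ) * Complex.I) η θ)).im) := by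
    intro η hη
    refine Complex.continuous_im.comp (continuous_iff_continuousAt.mpr fun θ => ?_)
    exact ContinuousAt.comp (g := F) (hFd _ (hcm η hη θ)).continuousAt (continuous_circleMap _ _).continuousAt
  have hcirc : ∀ η : ℝ, 0 < η → ∫ x in (-(3 * Real.pi / 2 * η))..(Real.pi / 2 * η), (F (p η x)).im ≤ 2 * Real.pi := by
    intro η hη
    simp only [hp]
    rw [intervalIntegral.integral_comp_sub_div (fun θ => (F (circleMap (-(η : ℂ) * Complex.I) η θ)).im) hη.ne']
    have e1 : Real.pi / 2 - Real.pi / 2 * η / η = 0 := by field_simp; ring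
    have e2 : Real.pi / 2 - -(3 * Real.pi / 2 * η) / η = 2 * Real.pi := by field_simp; ring
    rw [e1, e2]
    have hball : ∀ z ∈ Metric.closedBall (-(η : ℂ) * Complex.I) |η|, z.im ≤ 0 := by
      intro z hz
      rw [Metric.mem_closedBall, Complex.dist_eq, abs_of_pos hη] at hz
      have := (Complex.im_le_norm _).trans hz
      simp at this
      linarith
    have hdc : DiffContOnCl ℂ F (Metric.ball (-(η : ℂ) * Complex.I) |η|) := by
      apply DifferentiableOn.diffContOnCl
      intro z hz
      exact (hFd z (hball z (Metric.closure_ball_subset_closedBall hz))).differentiableWithinAt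
    have hm := DiffContOnCl.circleAverage hdc
    rw [Real.circleAverage_def] at hm
    have hm2 := congrArg Complex.im hm
    rw [Complex.smul_im] at hm2
    have hint : IntervalIntegrable (fun θ : ℝ => F (circleMap (-(η : ℂ) * Complex.I) η θ)) volume 0 (2 * Real.pi) := by
      refine Continuous.intervalIntegrable (continuous_iff_continuousAt.mpr fun θ => ?_) _ _
      exact ContinuousAt.comp (g := F) (hFd _ (hcm η hη θ)).continuousAt (continuous_circleMap _ _).continuousAt
    have hm3 : (∫ θ in (0:ℝ)..(2 * Real.pi), F (circleMap (-(η : ℂ) * Complex.I) η θ)).im =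
        ∫ θ in (0:ℝ)..(2 * Real.pi), (F (circleMap (-(η : ℂ) * Complex.I) η θ)).im :=
      (Complex.imCLM.intervalIntegral_comp_comm hint).symm
    rw [hm3] at hm2
    set X := ∫ θ in (0:ℝ)..(2 * Real.pi), (F (circleMap (-(η : ℂ) * Complex.I) η θ)).im
    have hlow := hFlow (-(η : ℂ) * Complex.I) (by simp; exact hη.le)
    set y := F (-(η : ℂ) * Complex.I)
    have hy : η * y.im ≤ 1 := by
      have h1 : (-(-(η : ℂ) * Complex.I).im) = η := by simp
      rw [h1] at hlow
      have h2 : y.im ^ 2 ≤ ‖y‖ ^ 2 := by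
        rw [← sq_abs]; exact pow_le_pow_left₀ (abs_nonneg _) (Complex.abs_im_le_norm y) 2
      have h3 : η * y.im ^ 2 ≤ y.im := (mul_le_mul_of_nonneg_left h2 hη.le).trans hlow
      by_contra hlt
      push Not at hlt
      have : 0 < y.im := by
        by_contra h; push Not at h
        have := mul_nonneg hη.le (neg_nonneg.mpr h); linarith
      nlinarith
    have hX : X = 2 * Real.pi * y.im := by
      rw [← hm2, smul_eq_mul]; field_simp
    rw [smul_eq_mul, hX]
    have := Real.pi_pos
    nlinarith
  -- pointwise convergence
  have hlimp : ∀ x : ℝ, Filter.Tendsto (fun n : ℕ => p ((n : ℝ) + 1) x) Filter.atTop (nhds (x : ℂ)) := by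
    intro x
    have hd : HasDerivAt (fun y : ℝ => Complex.I * Complex.exp (-((x : ℂ) * Complex.I) * (y : ℂ))) (x : ℂ) 0 := by
      have h0 : HasDerivAt (fun y : ℝ => (y : ℂ)) 1 0 := Complex.ofRealCLM.hasDerivAt
      have h1 := ((h0.const_mul (-((x : ℂ) * Complex.I))).cexp).const_mul Complex.I
      refine h1.congr_deriv ?_
      simp
      linear_combination (-(x : ℂ)) * Complex.I_mul_I
    have hs := hasDerivAt_iff_tendsto_slope_zero.mp hd
    have ht : Filter.Tendsto (fun n : ℕ => 1 / ((n : ℝ) + 1)) Filter.atTop (nhdsWithin 0 {0}ᶜ) := by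
      refine tendsto_nhdsWithin_iff.mpr ⟨tendsto_one_div_add_atTop_nhds_zero_nat, ?_⟩
      refine Filter.Eventually.of_forall fun n => ?_
      have : (0:ℝ) < 1 / ((n : ℝ) + 1) := by positivity
      exact this.ne'
    refine (hs.comp ht).congr fun n => ?_
    simp only [Function.comp, hp, circleMap, zero_add]
    have hn : ((n : ℂ) + 1) ≠ 0 := by exact_mod_cast (Nat.succ_ne_zero n)
    have : Complex.exp (((Real.pi / 2 - x / ((n : ℝ) + 1) : ℝ) : ℂ) * Complex.I) =
        Complex.I * Complex.exp (-((x : ℂ) * Complex.I) * ((1 / ((n : ℝ) + 1) : ℝ) : ℂ)) := by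
      have e : ((Real.pi / 2 - x / ((n : ℝ) + 1) : ℝ) : ℂ) * Complex.I =
          (Real.pi : ℂ) / 2 * Complex.I + -((x : ℂ) * Complex.I) * ((1 / ((n : ℝ) + 1) : ℝ) : ℂ) := by
        push_cast
        ring
      rw [e, Complex.exp_add, Complex.exp_pi_div_two_mul_I]
    rw [this]
    simp
    ring
  set G : ℕ → ℝ → ℝ≥0∞ := fun n => (Set.Ioc (-(3 * Real.pi / 2 * ((n : ℝ) + 1))) (Real.pi / 2 * ((n : ℝ) + 1))).indicator
    (fun x => ENNReal.ofReal (F (p ((n : ℝ) + 1) x)).im) with hG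
  have hpc : ∀ n : ℕ, Continuous fun x => (F (p ((n : ℝ) + 1) x)).im := fun n =>
    (hcont ((n : ℝ) + 1) (by positivity)).comp (by fun_prop : Continuous fun x : ℝ => Real.pi / 2 - x / ((n : ℝ) + 1))
  have hGm : ∀ n, Measurable (G n) := fun n =>
    ((hpc n).measurable.ennreal_ofReal).indicator measurableSet_Ioc
  have hGi : ∀ n, ∫⁻ x, G n x ≤ ENNReal.ofReal (2 * Real.pi) := by
    intro n
    have hn : (0:ℝ) < (n : ℝ) + 1 := by positivity
    rw [lintegral_indicator measurableSet_Ioc, ← ofReal_integral_eq_lintegral_ofReal]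
    · refine ENNReal.ofReal_le_ofReal ?_
      rw [← intervalIntegral.integral_of_le]
      · exact hcirc _ hn
      · have := Real.pi_pos
        have : 0 < Real.pi * ((n : ℝ) + 1) := by positivity
        linarith
    · exact ((hpc n).intervalIntegrable _ _).1
    · exact Filter.Eventually.of_forall fun x => hF0 _ (hcm _ hn _)
  have hGl : ∀ x : ℝ, Filter.liminf (fun n => G n x) Filter.atTop = ENNReal.ofReal (F x).im := by
    intro x
    apply Filter.Tendsto.liminf_eq
    have h1 : Filter.Tendsto (fun n : ℕ => ENNReal.ofReal (F (p ((n : ℝ) + 1) x)).im) Filter.atTop (nhds (ENNReal.ofReal (F x).im)) := by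
      have hc : ContinuousAt (fun s : ℂ => ENNReal.ofReal (F s).im) (x : ℂ) :=
        ENNReal.continuous_ofReal.continuousAt.comp (Complex.continuous_im.continuousAt.comp (hFd x (by simp)).continuousAt)
      exact hc.tendsto.comp (hlimp x)
    refine h1.congr' ?_
    obtain ⟨N, hN⟩ := exists_nat_gt |x|
    filter_upwards [Filter.eventually_ge_atTop N] with n hn
    simp only [hG]
    rw [Set.indicator_of_mem]
    have h3 : (N : ℝ) ≤ n := by exact_mod_cast hn
    have h4 := Real.pi_gt_three
    have h5 := le_abs_self x
    have h6 := neg_le_abs x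
    have h7 : (0:ℝ) ≤ n := by positivity
    constructor <;> nlinarith
  calc ∫⁻ x : ℝ, ENNReal.ofReal (F x).im = ∫⁻ x : ℝ, Filter.liminf (fun n => G n x) Filter.atTop := by
        simp only [hGl]
    _ ≤ Filter.liminf (fun n => ∫⁻ x, G n x) Filter.atTop := lintegral_liminf_le hGm
    _ ≤ _ := by
        refine Filter.liminf_le_of_frequently_le' (Filter.Frequently.of_forall hGi)

end resolvent

section spectral

variable {E : Type*} [NormedAddCommGroup E] [InnerProductSpace ℂ E] [FiniteDimensional ℂ E]

/-- `H - x - iε` -/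
def wgT (H : E →ₗ[ℂ] E) (ε x : ℝ) : E →L[ℂ] E :=
  LinearMap.toContinuousLinearMap H - ((x : ℂ) + ε * Complex.I) • (1 : E →L[ℂ] E)

lemma wg_symm_im {E : Type*} [NormedAddCommGroup E] [InnerProductSpace ℂ E]
    (H : E →ₗ[ℂ] E) (hH : H.IsSymmetric) (u : E) : (⟪u, H u⟫_ℂ).im = 0 := by
  have h := hH u u
  have h2 := inner_conj_symm (𝕜 := ℂ) u (H u)
  rw [h] at h2
  exact Complex.conj_eq_iff_im.mp h2

lemma wgT_im (H : E →ₗ[ℂ] E) (hH : H.IsSymmetric) (ε x : ℝ) (u : E) :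
    (⟪u, wgT H ε x u⟫_ℂ).im ≤ -(ε * ‖u‖ ^ 2) := by
  have h1 : wgT H ε x u = H u - ((x : ℂ) + ε * Complex.I) • u := rfl
  rw [h1, inner_sub_right, inner_smul_right, inner_self_eq_norm_sq_to_K, Complex.sub_im, wg_symm_im H hH,
    Complex.mul_im]
  have h2 : ((‖u‖ : ℂ) ^ 2).re = ‖u‖ ^ 2 := by rw [← Complex.ofReal_pow, Complex.ofReal_re]
  have h3 : ((‖u‖ : ℂ) ^ 2).im = 0 := by rw [← Complex.ofReal_pow, Complex.ofReal_im]
  simp [h2, h3]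

lemma wg_trace {Λ : Type*} [Fintype Λ] (P : Λ → E →ₗ[ℂ] E)
    (hPsymm : ∀ j, (P j).IsSymmetric)
    (hPidem : ∀ j, P j ∘ₗ P j = P j)
    (hPsum : ∑ j, P j = LinearMap.id) (X : E →ₗ[ℂ] E) :
    X.trace ℂ E = ∑ j, ∑ i, ⟪(stdOrthonormalBasis ℂ ↥(LinearMap.range (P j)) i : E),
      X (stdOrthonormalBasis ℂ ↥(LinearMap.range (P j)) i)⟫_ℂ := by
  have h1 : X = ∑ j, P j ∘ₗ X := by
    ext u
    have := congrArg (fun L : E →ₗ[ℂ] E => L (X u)) hPsum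
    simpa using this.symm
  conv_lhs => rw [h1, map_sum]
  refine Finset.sum_congr rfl fun j _ => ?_
  rw [← LinearMap.trace_restrict_eq_of_forall_mem (LinearMap.range (P j)) (P j ∘ₗ X)
    (fun x => ⟨X x, rfl⟩), LinearMap.trace_eq_sum_inner _ (stdOrthonormalBasis ℂ ↥(LinearMap.range (P j)))]
  refine Finset.sum_congr rfl fun i _ => ?_
  set φ := stdOrthonormalBasis ℂ ↥(LinearMap.range (P j)) i
  have hφ : P j φ = φ := by
    obtain ⟨y, hy⟩ := φ.2
    rw [← hy]
    exact congrArg (fun L : E →ₗ[ℂ] E => L y) (hPidem j)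
  rw [Submodule.coe_inner]
  change ⟪(φ : E), P j (X φ)⟫_ℂ = _
  rw [← hPsymm j, hφ]

lemma wg_arctan (a b δ ε : ℝ) (hδ : 0 < δ) (hε : 0 < ε) (l : ℝ) (hl : l ∈ Set.Icc a b) :
    ENNReal.ofReal (2 * Real.arctan (δ / ε)) ≤
      ∫⁻ x in Set.Icc (a - δ) (b + δ), ENNReal.ofReal (ε / ((l - x) ^ 2 + ε ^ 2)) := by
  have hd : ∀ x : ℝ, HasDerivAt (fun x => Real.arctan ((x - l) / ε)) (ε / ((l - x) ^ 2 + ε ^ 2)) x := by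
    intro x
    have h1 := (((hasDerivAt_id x).sub_const l).div_const ε).arctan
    refine h1.congr_deriv ?_
    simp only [id]
    field_simp
    ring
  have hc : Continuous fun x => ε / ((l - x) ^ 2 + ε ^ 2) := by
    refine continuous_const.div (by fun_prop) fun x => ?_
    positivity
  have hI := intervalIntegral.integral_eq_sub_of_hasDerivAt (a := l - δ) (b := l + δ) (fun x _ => hd x) (hc.intervalIntegrable _ _)
  have e : Real.arctan ((l + δ - l) / ε) - Real.arctan ((l - δ - l) / ε) = 2 * Real.arctan (δ / ε) := by
    have h1 : (l + δ - l) / ε = δ / ε := by ring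
    have h2 : (l - δ - l) / ε = -(δ / ε) := by ring
    rw [h1, h2, Real.arctan_neg]; ring
  rw [← e, ← hI, intervalIntegral.integral_of_le (by linarith), ofReal_integral_eq_lintegral_ofReal]
  · refine lintegral_mono_set fun x hx => ?_
    exact ⟨by linarith [hx.1, hl.1], by linarith [hx.2, hl.2]⟩
  · exact (hc.intervalIntegrable _ _).1
  · exact Filter.Eventually.of_forall fun x => by positivity

lemma wg_eigCount_le (H : E →ₗ[ℂ] E) (hH : H.IsSymmetric) (J : Set ℝ) :
    eigCount H J ≤ Nat.card {i // hH.eigenvalues rfl i ∈ J} := by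
  classical
  set e := hH.eigenvectorBasis rfl
  set l := hH.eigenvalues rfl
  have hsub : (⨆ μ ∈ J, Module.End.eigenspace H (μ : ℂ)) ≤
      Submodule.span ℂ (Set.range fun i : {i // l i ∈ J} => e i) := by
    refine iSup₂_le fun μ hμ v hv => ?_
    rw [Module.End.mem_eigenspace_iff] at hv
    rw [← e.sum_repr' v]
    refine Submodule.sum_mem _ fun i _ => ?_
    by_cases hi : l i = μ
    · exact Submodule.smul_mem _ _ (Submodule.subset_span ⟨⟨i, hi ▸ hμ⟩, rfl⟩)
    · have h1 := hH (e i) v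
      have h2 : H (e i) = (l i : ℂ) • e i := hH.apply_eigenvectorBasis rfl i
      rw [hv, h2, inner_smul_left, inner_smul_right, Complex.conj_ofReal] at h1
      have h3 : ((l i : ℂ) - μ) * ⟪e i, v⟫_ℂ = 0 := by rw [sub_mul, h1, sub_self]
      rcases mul_eq_zero.mp h3 with h | h
      · exact absurd (by exact_mod_cast sub_eq_zero.mp h) hi
      · rw [h, zero_smul]; exact Submodule.zero_mem _
  refine (Submodule.finrank_mono hsub).trans ?_
  rw [Nat.card_eq_fintype_card]
  exact finrank_range_le_card _

lemma wg_eig {Λ : Type*} [Fintype Λ] (P : Λ → E →ₗ[ℂ] E)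
    (hPsymm : ∀ j, (P j).IsSymmetric)
    (hPidem : ∀ j, P j ∘ₗ P j = P j)
    (hPsum : ∑ j, P j = LinearMap.id)
    (H : E →ₗ[ℂ] E) (hH : H.IsSymmetric) (J : Set ℝ) (a b δ ε : ℝ) (hJ : J ⊆ Set.Icc a b)
    (hδ : 0 < δ) (hε : 0 < ε) :
    ENNReal.ofReal (2 * Real.arctan (δ / ε)) * (eigCount H J : ℝ≥0∞) ≤
      ∫⁻ x in Set.Icc (a - δ) (b + δ), ∑ j, ∑ i,
        ENNReal.ofReal (wgR (wgT H ε x) (stdOrthonormalBasis ℂ ↥(LinearMap.range (P j)) i : E)).im := by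
  classical
  set e := hH.eigenvectorBasis rfl with he
  set l := hH.eigenvalues rfl with hl
  have hu : ∀ x, IsUnit (wgT H ε x) := fun x => wg_unit _ ε hε (wgT_im H hH ε x)
  have h1 : ∀ x : ℝ, ∑ j, ∑ i,
        ENNReal.ofReal (wgR (wgT H ε x) (stdOrthonormalBasis ℂ ↥(LinearMap.range (P j)) i : E)).im
      = ∑ m, ENNReal.ofReal (ε / ((l m - x) ^ 2 + ε ^ 2)) := by
    intro x
    have hnn : ∀ j i, 0 ≤ (wgR (wgT H ε x) (stdOrthonormalBasis ℂ ↥(LinearMap.range (P j)) i : E)).im := by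
      intro j i
      refine (wg_R_bound _ ε hε (wgT_im H hH ε x) _ ?_).1
      exact (stdOrthonormalBasis ℂ ↥(LinearMap.range (P j))).orthonormal.1 i
    have hX := (wg_trace P hPsymm hPidem hPsum (Ring.inverse (wgT H ε x) : E →L[ℂ] E)).symm.trans
      (LinearMap.trace_eq_sum_inner _ e)
    have hX' : ∑ j, ∑ i, wgR (wgT H ε x) (stdOrthonormalBasis ℂ ↥(LinearMap.range (P j)) i : E)
      = ∑ m, wgR (wgT H ε x) (e m) := hX
    have hm : ∀ m, (wgR (wgT H ε x) (e m)).im = ε / ((l m - x) ^ 2 + ε ^ 2) := by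
      intro m
      have h2 : H (e m) = (l m : ℂ) • e m := hH.apply_eigenvectorBasis rfl m
      set c : ℂ := (l m : ℂ) - ((x : ℂ) + ε * Complex.I) with hc
      have h3 : wgT H ε x (e m) = c • e m := by
        change H (e m) - ((x : ℂ) + ε * Complex.I) • e m = _
        rw [h2, ← sub_smul]
      have hc0 : c ≠ 0 := by
        intro h
        have := congrArg Complex.im h
        simp [hc] at this
        exact hε.ne' this
      have h4 : Ring.inverse (wgT H ε x) (e m) = c⁻¹ • e m := by
        have h5 : Ring.inverse (wgT H ε x) (wgT H ε x (e m)) = e m := by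
          have := Ring.inverse_mul_cancel _ (hu x)
          calc _ = (Ring.inverse (wgT H ε x) * wgT H ε x) (e m) := rfl
            _ = _ := by rw [this]; rfl
        rw [h3, map_smul] at h5
        rw [← h5, smul_smul, inv_mul_cancel₀ hc0, one_smul, h5]
      rw [wgR, h4, inner_smul_right, inner_self_eq_norm_sq_to_K, e.orthonormal.1 m]
      simp only [Complex.coe_algebraMap, Complex.ofReal_one, one_pow, mul_one, Complex.inv_im]
      have h6 : c.im = -ε := by simp [hc]
      have h7 : Complex.normSq c = (l m - x) ^ 2 + ε ^ 2 := by
        rw [Complex.normSq_apply, h6]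
        have : c.re = l m - x := by simp [hc]
        rw [this]; ring
      rw [h6, h7, neg_neg]
    have hL : ∑ j, ∑ i,
        ENNReal.ofReal (wgR (wgT H ε x) (stdOrthonormalBasis ℂ ↥(LinearMap.range (P j)) i : E)).im
        = ENNReal.ofReal (∑ j, ∑ i, wgR (wgT H ε x) (stdOrthonormalBasis ℂ ↥(LinearMap.range (P j)) i : E)).im := by
      simp only [Complex.im_sum]
      rw [ENNReal.ofReal_sum_of_nonneg fun j _ => Finset.sum_nonneg fun i _ => hnn j i]
      refine Finset.sum_congr rfl fun j _ => ?_
      rw [ENNReal.ofReal_sum_of_nonneg fun i _ => hnn j i]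
    rw [hL, hX', Complex.im_sum, ENNReal.ofReal_sum_of_nonneg]
    · simp only [hm]
    · intro m _; rw [hm]; positivity
  simp only [h1]
  rw [lintegral_finsetSum _ (fun m _ => by fun_prop)]
  calc ENNReal.ofReal (2 * Real.arctan (δ / ε)) * (eigCount H J : ℝ≥0∞)
      ≤ ENNReal.ofReal (2 * Real.arctan (δ / ε)) * ((Finset.univ.filter fun m => l m ∈ J).card : ℝ≥0∞) := by
        gcongr
        refine (wg_eigCount_le H hH J).trans (le_of_eq ?_)
        rw [Nat.card_eq_fintype_card, Fintype.card_subtype]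
    _ = ∑ m ∈ Finset.univ.filter (fun m => l m ∈ J), ENNReal.ofReal (2 * Real.arctan (δ / ε)) := by
        rw [Finset.sum_const, nsmul_eq_mul, mul_comm]
    _ ≤ ∑ m ∈ Finset.univ.filter (fun m => l m ∈ J), ∫⁻ x in Set.Icc (a - δ) (b + δ), ENNReal.ofReal (ε / ((l m - x) ^ 2 + ε ^ 2)) := by
        refine Finset.sum_le_sum fun m hm => wg_arctan a b δ ε hδ hε _ (hJ (Finset.mem_filter.mp hm).2)
    _ ≤ _ := Finset.sum_le_sum_of_subset (Finset.filter_subset _ _)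

end spectral

section final

variable {E : Type*} [NormedAddCommGroup E] [InnerProductSpace ℂ E] [FiniteDimensional ℂ E]

lemma wg_one {K : Type*} [Fintype K]
    (H₀ : E →ₗ[ℂ] E) (hH₀ : H₀.IsSymmetric)
    (V : K → E →ₗ[ℂ] E) (hV : ∀ k, (V k).IsSymmetric)
    (P : E →ₗ[ℂ] E) (hPsymm : P.IsSymmetric) (hPidem : P ∘ₗ P = P)
    (f : ℝ → ℝ) (hfmeas : Measurable f) (hfpos : ∀ x, 0 ≤ f x)
    (hfBV : BoundedVariationOn f Set.univ) (hfsupp : HasCompactSupport f)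
    (hfint : ∫ x, f x = 1)
    (t : K → ℝ)
    (ht : ∀ x : E, (⟪x, P x⟫_ℂ).re ≤ (⟪x, (∑ k, (t k : ℂ) • V k) x⟫_ℂ).re)
    (φ : E) (hφ : ‖φ‖ = 1) (hPφ : P φ = φ) (ε x : ℝ) (hε : 0 < ε)
    (hsym : ∀ ω : K → ℝ, (H₀ + ∑ k, ((ω k : ℂ) • V k)).IsSymmetric)
    (hmeas : Measurable fun ω : K → ℝ =>
      ENNReal.ofReal (wgR (wgT (H₀ + ∑ k, ((ω k : ℂ) • V k)) ε x) φ).im) :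
    ∫⁻ ω, ENNReal.ofReal (wgR (wgT (H₀ + ∑ k, ((ω k : ℂ) • V k)) ε x) φ).im ∂(couplingMeasure f K)
      ≤ ENNReal.ofReal (Real.pi * ((∑ k, |t k|) * (eVariationOn f Set.univ).toReal)) := by
  have hFm : Measurable (fun ω : K → ℝ => ∏ i, ENNReal.ofReal (f (ω i))) := by fun_prop
  have hprod : ∀ ω : K → ℝ, ∏ i, ENNReal.ofReal (f (ω i)) = ENNReal.ofReal (wgF f K ω) := fun ω =>
    (ENNReal.ofReal_prod_of_nonneg fun i _ => hfpos _).symm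
  rw [couplingMeasure, lintegral_withDensity_eq_lintegral_mul _ hFm hmeas]
  simp only [Pi.mul_apply, hprod]
  have hφP : ∀ u, ‖⟪φ, u⟫_ℂ‖ ^ 2 ≤ (⟪u, P u⟫_ℂ).re := by
    intro u
    have h1 : ⟪φ, u⟫_ℂ = ⟪φ, P u⟫_ℂ := by rw [← hPsymm, hPφ]
    have h2 : ⟪u, P u⟫_ℂ = ⟪P u, P u⟫_ℂ := by
      rw [hPsymm u (P u)]
      exact congrArg (fun L : E →ₗ[ℂ] E => ⟪u, L u⟫_ℂ) hPidem.symm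
    have h3 : (⟪P u, P u⟫_ℂ).re = ‖P u‖ ^ 2 := inner_self_eq_norm_sq (𝕜 := ℂ) (P u)
    rw [h1, h2, h3]
    have := norm_inner_le_norm (𝕜 := ℂ) φ (P u)
    rw [hφ, one_mul] at this
    exact pow_le_pow_left₀ (norm_nonneg _) this 2
  have ht0 : t ≠ 0 := by
    rintro rfl
    have h1 := ht φ
    have h2 := hφP φ
    have h3 : ‖⟪φ, φ⟫_ℂ‖ = 1 := by rw [inner_self_eq_norm_sq_to_K, hφ]; simp
    rw [h3] at h2
    simp at h1
    linarith
  have hQsym : (∑ k, (t k : ℂ) • V k).IsSymmetric := by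
    have h1 := (hsym t).sub hH₀
    simpa using h1
  have key := wg_dir f hfmeas hfpos hfint hfBV hfsupp t ht0
    (fun ω => ENNReal.ofReal (wgR (wgT (H₀ + ∑ k, ((ω k : ℂ) • V k)) ε x) φ).im) hmeas
    (ENNReal.ofReal (1 / ε)) ENNReal.ofReal_ne_top
    (fun ω => ENNReal.ofReal_le_ofReal (wg_R_bound _ ε hε (wgT_im _ (hsym ω) ε x) φ hφ).2)
    (ENNReal.ofReal (2 * Real.pi))
    (by
      intro ω
      have h1 := wg_line (wgT (H₀ + ∑ k, ((ω k : ℂ) • V k)) ε x)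
        (LinearMap.toContinuousLinearMap (∑ k, (t k : ℂ) • V k)) φ ε hε (wgT_im _ (hsym ω) ε x)
        (fun u => wg_symm_im _ hQsym u) (fun u => (hφP u).trans (ht u))
      refine le_trans (le_of_eq (lintegral_congr fun s => ?_)) h1
      congr 3
      ext u
      change (H₀ + ∑ k, (((ω + s • t) k : ℝ) : ℂ) • V k) u - _ =
        ((H₀ + ∑ k, ((ω k : ℂ) • V k)) u - _) + (s : ℂ) • (∑ k, (t k : ℂ) • V k) u
      simp only [LinearMap.add_apply, LinearMap.sum_apply, LinearMap.smul_apply, Pi.add_apply, Pi.smul_apply,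
        smul_eq_mul, Complex.ofReal_add, Complex.ofReal_mul, add_smul, Finset.sum_add_distrib, mul_smul,
        Finset.smul_sum]
      abel)
  have h2 : (2 : ℝ≥0∞) ≠ 0 := by norm_num
  rw [← ENNReal.mul_le_mul_iff_right h2 (by simp : (2 : ℝ≥0∞) ≠ ⊤)]
  simp only [mul_comm (ENNReal.ofReal (wgF f K _))]
  refine key.trans (le_of_eq ?_)
  rw [← ENNReal.ofReal_mul (by positivity), ← ENNReal.ofReal_ofNat 2, ← ENNReal.ofReal_mul (by norm_num)]
  congr 1
  ring

set_option maxHeartbeats 1000000 in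
lemma wg_bdd
    {K Λ : Type*} [Fintype K] [Fintype Λ]
    (H₀ : E →ₗ[ℂ] E) (hH₀ : H₀.IsSymmetric)
    (V : K → E →ₗ[ℂ] E) (hV : ∀ k, (V k).IsSymmetric)
    (P : Λ → E →ₗ[ℂ] E)
    (hPsymm : ∀ j, (P j).IsSymmetric)
    (hPidem : ∀ j, P j ∘ₗ P j = P j)
    (hPsum : ∑ j, P j = LinearMap.id)
    (f : ℝ → ℝ) (hfmeas : Measurable f) (hfpos : ∀ x, 0 ≤ f x)
    (hfBV : BoundedVariationOn f Set.univ) (hfsupp : HasCompactSupport f)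
    (hfint : ∫ x, f x = 1)
    (t : Λ → K → ℝ)
    (ht : ∀ j, ∀ x : E,
      (⟪x, P j x⟫_ℂ).re ≤ (⟪x, (∑ k, (t j k : ℂ) • V k) x⟫_ℂ).re)
    (J : Set ℝ) (a b : ℝ) (hab : a ≤ b) (hJ : J ⊆ Set.Icc a b) :
    (∫⁻ ω, (eigCount (H₀ + ∑ k, ((ω k : ℂ) • V k)) J : ℝ≥0∞)
        ∂(couplingMeasure f K))
      ≤ ENNReal.ofReal
          ((eVariationOn f Set.univ).toReal *
            ∑ j, (Module.finrank ℂ ↥(LinearMap.range (P j)) : ℝ) * ∑ k, |t j k|)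
        * ENNReal.ofReal (b - a) := by
  set C : ℝ := (eVariationOn f Set.univ).toReal *
            ∑ j, (Module.finrank ℂ ↥(LinearMap.range (P j)) : ℝ) * ∑ k, |t j k| with hC
  have hC0 : 0 ≤ C := by positivity
  set L := ∫⁻ ω, (eigCount (H₀ + ∑ k, ((ω k : ℂ) • V k)) J : ℝ≥0∞) ∂(couplingMeasure f K) with hL
  have hsym : ∀ ω : K → ℝ, (H₀ + ∑ k, ((ω k : ℂ) • V k)).IsSymmetric := by
    intro ω u v
    simp only [LinearMap.add_apply, LinearMap.sum_apply, LinearMap.smul_apply, inner_add_left, inner_add_right,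
      sum_inner, inner_sum, inner_smul_left, inner_smul_right, Complex.conj_ofReal, hH₀ u v, hV _ u v]
  have hcont : ∀ (ε : ℝ), 0 < ε → ∀ φ : E, Continuous fun q : (K → ℝ) × ℝ =>
      wgR (wgT (H₀ + ∑ k, ((q.1 k : ℂ) • V k)) ε q.2) φ := by
    intro ε hε φ
    rw [continuous_iff_continuousAt]
    intro q
    have h1 : Continuous fun q : (K → ℝ) × ℝ => wgT (H₀ + ∑ k, ((q.1 k : ℂ) • V k)) ε q.2 := by
      simp only [wgT, map_add, map_sum, map_smul]
      fun_prop
    exact ContinuousAt.comp (g := fun T => wgR T φ)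
      (wg_R_diff _ (wg_unit _ ε hε (wgT_im _ (hsym q.1) ε q.2)) φ).continuousAt h1.continuousAt
  have key : ∀ δ ε : ℝ, 0 < δ → 0 < ε →
      ENNReal.ofReal (2 * Real.arctan (δ / ε)) * L ≤ ENNReal.ofReal ((b - a + 2 * δ) * (Real.pi * C)) := by
    intro δ ε hδ hε
    have : SFinite (couplingMeasure f K) := by unfold couplingMeasure; infer_instance
    have hm : ∀ φ : E, Measurable fun q : (K → ℝ) × ℝ =>
        ENNReal.ofReal (wgR (wgT (H₀ + ∑ k, ((q.1 k : ℂ) • V k)) ε q.2) φ).im := fun φ =>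
      (Complex.continuous_im.comp (hcont ε hε φ)).measurable.ennreal_ofReal
    have hm1 : ∀ (φ : E) x, Measurable fun ω : (K → ℝ) =>
        ENNReal.ofReal (wgR (wgT (H₀ + ∑ k, ((ω k : ℂ) • V k)) ε x) φ).im := by
      intro φ x
      have h2 : Measurable fun ω : K → ℝ => (ω, x) := measurable_prodMk_right
      have h3 := (hm φ).comp h2
      simp only [Function.comp_def] at h3
      exact h3
    calc ENNReal.ofReal (2 * Real.arctan (δ / ε)) * L
        = ∫⁻ ω, ENNReal.ofReal (2 * Real.arctan (δ / ε)) *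
          (eigCount (H₀ + ∑ k, ((ω k : ℂ) • V k)) J : ℝ≥0∞) ∂(couplingMeasure f K) :=
          (lintegral_const_mul' _ _ ENNReal.ofReal_ne_top).symm
      _ ≤ ∫⁻ ω, (∫⁻ x in Set.Icc (a - δ) (b + δ), ∑ j, ∑ i,
        ENNReal.ofReal (wgR (wgT (H₀ + ∑ k, ((ω k : ℂ) • V k)) ε x)
          (stdOrthonormalBasis ℂ ↥(LinearMap.range (P j)) i : E)).im) ∂(couplingMeasure f K) :=
          lintegral_mono fun ω => wg_eig P hPsymm hPidem hPsum _ (hsym ω) J a b δ ε hJ hδ hε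
      _ = ∫⁻ x in Set.Icc (a - δ) (b + δ), ∫⁻ ω, ∑ j, ∑ i,
        ENNReal.ofReal (wgR (wgT (H₀ + ∑ k, ((ω k : ℂ) • V k)) ε x)
          (stdOrthonormalBasis ℂ ↥(LinearMap.range (P j)) i : E)).im ∂(couplingMeasure f K) := by
          rw [lintegral_lintegral_swap]
          apply Measurable.aemeasurable
          exact Finset.measurable_sum _ fun j _ => Finset.measurable_sum _ fun i _ => hm _
      _ ≤ ∫⁻ x in Set.Icc (a - δ) (b + δ), ENNReal.ofReal (Real.pi * C) := by
          refine lintegral_mono fun x => ?_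
          rw [lintegral_finsetSum _ fun j _ => Finset.measurable_sum _ fun i _ => hm1 _ x]
          have e : Real.pi * C = ∑ j, ∑ i : Fin (Module.finrank ℂ ↥(LinearMap.range (P j))),
              Real.pi * ((∑ k, |t j k|) * (eVariationOn f Set.univ).toReal) := by
            simp only [Finset.sum_const, Finset.card_univ, Fintype.card_fin, nsmul_eq_mul, hC, Finset.mul_sum (s := (Finset.univ : Finset Λ))]
            refine Finset.sum_congr rfl fun j _ => ?_
            ring
          have hp : ∀ j, 0 ≤ Real.pi * ((∑ k, |t j k|) * (eVariationOn f Set.univ).toReal) := fun j => by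
            have := Real.pi_pos; positivity
          rw [e, ENNReal.ofReal_sum_of_nonneg fun j _ => Finset.sum_nonneg fun i _ => hp j]
          refine Finset.sum_le_sum fun j _ => ?_
          rw [lintegral_finsetSum _ fun i _ => hm1 _ x, ENNReal.ofReal_sum_of_nonneg fun i _ => hp j]
          refine Finset.sum_le_sum fun i _ => ?_
          refine wg_one H₀ hH₀ V hV (P j) (hPsymm j) (hPidem j) f hfmeas hfpos hfBV hfsupp hfint (t j) (ht j)
            _ ?_ ?_ ε x hε hsym (hm1 _ x)
          · exact (stdOrthonormalBasis ℂ ↥(LinearMap.range (P j))).orthonormal.1 i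
          · obtain ⟨y, hy⟩ := (stdOrthonormalBasis ℂ ↥(LinearMap.range (P j)) i).2
            rw [← hy]
            exact congrArg (fun L : E →ₗ[ℂ] E => L y) (hPidem j)
      _ = _ := by
          rw [lintegral_const, Measure.restrict_apply_univ, Real.volume_Icc, mul_comm,
            ← ENNReal.ofReal_mul (by linarith)]
          congr 1; ring
  have l1 : Filter.Tendsto (fun δ : ℝ => ENNReal.ofReal (2 * Real.arctan (δ / δ ^ 2)) * L)
      (nhdsWithin 0 (Set.Ioi 0)) (nhds (ENNReal.ofReal (2 * (Real.pi / 2)) * L)) := by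
    refine ENNReal.Tendsto.mul_const (ENNReal.tendsto_ofReal (Filter.Tendsto.const_mul _ ?_)) (Or.inl ?_)
    · have h1 : Filter.Tendsto Real.arctan Filter.atTop (nhds (Real.pi / 2)) :=
        Real.tendsto_arctan_atTop.mono_right nhdsWithin_le_nhds
      have h2 := h1.comp (tendsto_inv_nhdsGT_zero (𝕜 := ℝ))
      refine h2.congr' ?_
      filter_upwards [self_mem_nhdsWithin] with δ hδ
      have : δ ≠ 0 := (Set.mem_Ioi.mp hδ).ne'
      simp only [Function.comp]
      congr 1
      field_simp
    · have := Real.pi_pos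
      simp [this]
  have l2 : Filter.Tendsto (fun δ : ℝ => ENNReal.ofReal ((b - a + 2 * δ) * (Real.pi * C)))
      (nhdsWithin 0 (Set.Ioi 0)) (nhds (ENNReal.ofReal ((b - a + 2 * 0) * (Real.pi * C)))) := by
    refine ENNReal.tendsto_ofReal (Filter.Tendsto.mono_left ?_ nhdsWithin_le_nhds)
    exact Continuous.tendsto (by fun_prop : Continuous fun δ : ℝ => (b - a + 2 * δ) * (Real.pi * C)) 0
  have h3 := le_of_tendsto_of_tendsto l1 l2 (by
    filter_upwards [self_mem_nhdsWithin] with δ hδ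
    exact key δ (δ ^ 2) hδ (pow_pos (Set.mem_Ioi.mp hδ) 2))
  have hpi : ENNReal.ofReal Real.pi ≠ 0 := by simp [Real.pi_pos]
  rw [← ENNReal.mul_le_mul_iff_right hpi ENNReal.ofReal_ne_top, ← ENNReal.ofReal_mul hC0,
    ← ENNReal.ofReal_mul Real.pi_pos.le]
  have q1 : 2 * (Real.pi / 2) = Real.pi := by ring
  have q2 : (b - a + 2 * 0) * (Real.pi * C) = Real.pi * (C * (b - a)) := by ring
  rw [q1, q2] at h3
  exact h3

lemma wg_vol_top (J : Set ℝ) (hJ : J.OrdConnected) (hne : J.Nonempty)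
    (h : ¬ (BddBelow J ∧ BddAbove J)) : volume J = ⊤ := by
  obtain ⟨x, hx⟩ := hne
  rw [not_and_or] at h
  refine ENNReal.eq_top_of_forall_nnreal_le fun r => ?_
  rcases h with h | h
  · rw [not_bddBelow_iff] at h
    obtain ⟨y, hy, hyr⟩ := h (x - r)
    refine le_trans ?_ (measure_mono (hJ.out hy hx))
    rw [Real.volume_Icc, ← ENNReal.ofReal_coe_nnreal]
    exact ENNReal.ofReal_le_ofReal (by linarith)
  · rw [not_bddAbove_iff] at h
    obtain ⟨y, hy, hyr⟩ := h (x + r)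
    refine le_trans ?_ (measure_mono (hJ.out hx hy))
    rw [Real.volume_Icc, ← ENNReal.ofReal_coe_nnreal]
    exact ENNReal.ofReal_le_ofReal (by linarith)

lemma wg_vol_ge (J : Set ℝ) (hJ : J.OrdConnected) (hne : J.Nonempty)
    (h1 : BddBelow J) (h2 : BddAbove J) : ENNReal.ofReal (sSup J - sInf J) ≤ volume J := by
  rw [← Real.volume_Ioo]
  refine measure_mono fun x hx => ?_
  obtain ⟨y, hy, hyx⟩ := exists_lt_of_csInf_lt hne hx.1
  obtain ⟨z, hz, hxz⟩ := exists_lt_of_lt_csSup hne hx.2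
  exact hJ.out hy hz ⟨hyx.le, hxz.le⟩

end final


theorem abstract_wegner_estimate
    {E : Type*} [NormedAddCommGroup E] [InnerProductSpace ℂ E] [FiniteDimensional ℂ E]
    {K Λ : Type*} [Fintype K] [Fintype Λ]
    (H₀ : E →ₗ[ℂ] E) (hH₀ : H₀.IsSymmetric)
    (V : K → E →ₗ[ℂ] E) (hV : ∀ k, (V k).IsSymmetric)
    (P : Λ → E →ₗ[ℂ] E)
    (hPsymm : ∀ j, (P j).IsSymmetric)
    (hPidem : ∀ j, P j ∘ₗ P j = P j)
    (hPsum : ∑ j, P j = LinearMap.id)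
    (f : ℝ → ℝ) (hfmeas : Measurable f) (hfpos : ∀ x, 0 ≤ f x)
    (hfBV : BoundedVariationOn f Set.univ) (hfsupp : HasCompactSupport f)
    (hfint : ∫ x, f x = 1)
    (t : Λ → K → ℝ)
    (ht : ∀ j, ∀ x : E,
      (⟪x, P j x⟫_ℂ).re ≤ (⟪x, (∑ k, (t j k : ℂ) • V k) x⟫_ℂ).re)
    (J : Set ℝ) (hJ : J.OrdConnected) :
    (∫⁻ ω, (eigCount (H₀ + ∑ k, ((ω k : ℂ) • V k)) J : ℝ≥0∞)
        ∂(couplingMeasure f K))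
      ≤ ENNReal.ofReal
          ((eVariationOn f Set.univ).toReal *
            ∑ j, (Module.finrank ℂ ↥(LinearMap.range (P j)) : ℝ) * ∑ k, |t j k|)
        * volume J := by
  rcases J.eq_empty_or_nonempty with rfl | hne
  · have hz : ∀ H : E →ₗ[ℂ] E, eigCount H (∅ : Set ℝ) = 0 := fun H => by
      unfold eigCount
      rw [show (⨆ μ ∈ (∅ : Set ℝ), Module.End.eigenspace H (μ : ℂ)) = ⊥ by simp]
      exact finrank_bot ℂ E
    simp only [hz]
    simp
  by_cases hb : BddBelow J ∧ BddAbove J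
  · have hle : sInf J ≤ sSup J := csInf_le_csSup hne hb.1 hb.2
    refine (wg_bdd H₀ hH₀ V hV P hPsymm hPidem hPsum f hfmeas hfpos hfBV hfsupp hfint t ht J
      (sInf J) (sSup J) hle (fun x hx => ⟨csInf_le hb.1 hx, le_csSup hb.2 hx⟩)).trans ?_
    gcongr
    exact wg_vol_ge J hJ hne hb.1 hb.2
  rw [wg_vol_top J hJ hne hb]
  set C : ℝ := (eVariationOn f Set.univ).toReal *
            ∑ j, (Module.finrank ℂ ↥(LinearMap.range (P j)) : ℝ) * ∑ k, |t j k| with hC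
  have hC0 : 0 ≤ C := by positivity
  rcases hC0.eq_or_lt with h0 | h0
  · have hvar : (eVariationOn f Set.univ).toReal ≠ 0 := by
      intro hv
      have : f = 0 := by
        ext x
        have := wg_f_le f hfBV hfsupp x
        rw [hv] at this
        exact abs_eq_zero.mp (le_antisymm this (abs_nonneg _))
      rw [this] at hfint
      simp at hfint
    have hs := (mul_eq_zero.mp (hC ▸ h0.symm)).resolve_left hvar
    rw [Finset.sum_eq_zero_iff_of_nonneg (fun j _ => by positivity)] at hs
    have hP0 : ∀ j, P j = 0 := by
      intro j
      rcases mul_eq_zero.mp (hs j (Finset.mem_univ j)) with h | h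
      · have h1 : Module.finrank ℂ ↥(LinearMap.range (P j)) = 0 := by exact_mod_cast h
        rw [Submodule.finrank_eq_zero, LinearMap.range_eq_bot] at h1
        exact h1
      · rw [Finset.sum_eq_zero_iff_of_nonneg (fun k _ => abs_nonneg _)] at h
        have h1 : ∀ k, t j k = 0 := fun k => abs_eq_zero.mp (h k (Finset.mem_univ k))
        ext u
        have h2 := ht j u
        simp only [h1] at h2
        have h4 : ⟪u, P j u⟫_ℂ = ⟪P j u, P j u⟫_ℂ := by
          rw [hPsymm j u (P j u)]
          exact congrArg (fun L : E →ₗ[ℂ] E => ⟪u, L u⟫_ℂ) (hPidem j).symm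
        have h3 : (⟪P j u, P j u⟫_ℂ).re = ‖P j u‖ ^ 2 := inner_self_eq_norm_sq (𝕜 := ℂ) (P j u)
        rw [h4, h3] at h2
        simp at h2
        simpa using h2
    have hsubs : Subsingleton E := by
      refine subsingleton_of_forall_eq 0 fun u => ?_
      have := congrArg (fun L : E →ₗ[ℂ] E => L u) hPsum
      simpa [hP0] using this.symm
    have hz : ∀ H : E →ₗ[ℂ] E, eigCount H J = 0 := fun H => Module.finrank_zero_of_subsingleton
    simp [hz]
  · have : ENNReal.ofReal C ≠ 0 := by simpa using h0
    rw [ENNReal.mul_top this]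
    exact le_top

end
end

section
/- Let H₀ and V be bounded self-adjoint operators on a complex Hilbert space with V ≥ 0, let V^{1/2} be the nonnegative square root of V, let t₁ ≤ t₂ be real numbers, and let z ∈ ℂ with Im z > 0. Then for every s ∈ [t₁, t₂] the operator H₀ + sV − z is boundedly invertible, and for every vector φ one has 0 ≤ Im ∫_{t₁}^{t₂} ⟨φ, V^{1/2} (H₀ + sV − z)⁻¹ V^{1/2} φ⟩ ds ≤ π ‖φ‖². -/
/-!
Statement 11 (Herglotz bound on the averaged sandwiched resolvent):
Let `H₀, V` be bounded self-adjoint with `V ≥ 0`, `V^{1/2}` its nonnegative square root,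
`t₁ ≤ t₂`, `Im z > 0`. Then `H₀ + sV - z` is boundedly invertible for `s ∈ [t₁,t₂]` and
`0 ≤ Im ∫_{t₁}^{t₂} ⟨φ, V^{1/2} (H₀ + sV - z)⁻¹ V^{1/2} φ⟩ ds ≤ π ‖φ‖²` for every `φ`.
-/

open scoped InnerProductSpace

section
variable {H : Type*} [NormedAddCommGroup H] [InnerProductSpace ℂ H] [CompleteSpace H]

lemma aux_im_s11 (H₀ V S : H →L[ℂ] H) (hH₀ : IsSelfAdjoint H₀) (hS : IsSelfAdjoint S)
    (hSS : S.comp S = V) (z w : ℂ) (x : H) :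
    (⟪x, (H₀ + w • V - z • (1 : H →L[ℂ] H)) x⟫_ℂ).im = w.im * ‖S x‖ ^ 2 - z.im * ‖x‖ ^ 2 := by
  have h1 : (⟪x, H₀ x⟫_ℂ).im = 0 := by
    have := (ContinuousLinearMap.isSelfAdjoint_iff_isSymmetric.mp hH₀).im_inner_self_apply x
    simpa using this
  have h2 : ⟪x, V x⟫_ℂ = ((‖S x‖ ^ 2 : ℝ) : ℂ) := by
    have := (ContinuousLinearMap.isSelfAdjoint_iff_isSymmetric.mp hS) x (S x)
    subst hSS
    simp only [ContinuousLinearMap.coe_coe] at this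
    rw [ContinuousLinearMap.comp_apply, ← this, inner_self_eq_norm_sq_to_K]
    simp
  have h3 : ⟪x, x⟫_ℂ = ((‖x‖ ^ 2 : ℝ) : ℂ) := by
    rw [inner_self_eq_norm_sq_to_K]; simp
  simp only [sub_apply, add_apply,
    smul_apply, one_apply_eq_self, inner_sub_right, inner_add_right,
    inner_smul_right, h2, h3, Complex.sub_im, Complex.add_im, h1, Complex.im_mul_ofReal]
  ring

lemma aux_unit_s11 (H₀ V S : H →L[ℂ] H) (hH₀ : IsSelfAdjoint H₀) (hS : IsSelfAdjoint S)
    (hSS : S.comp S = V) (z w : ℂ) (hz : 0 < z.im) (hw : w.im ≤ 0) :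
    IsUnit (H₀ + w • V - z • (1 : H →L[ℂ] H)) := by
  refine ContinuousLinearMap.isUnit_of_forall_le_norm_inner_map _ (c := ⟨z.im, hz.le⟩) hz ?_
  intro x
  rw [norm_inner_symm]
  refine le_trans ?_ (Complex.abs_im_le_norm _)
  rw [aux_im_s11 H₀ V S hH₀ hS hSS]
  refine le_trans ?_ (neg_le_abs _)
  change ‖x‖ ^ 2 * z.im ≤ _
  nlinarith [mul_nonneg (neg_nonneg.mpr hw) (sq_nonneg ‖S x‖)]

lemma aux_bounds (H₀ V S : H →L[ℂ] H) (hH₀ : IsSelfAdjoint H₀) (hS : IsSelfAdjoint S)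
    (hSS : S.comp S = V) (z w : ℂ) (hz : 0 < z.im) (hw : w.im ≤ 0) (φ : H) (F : ℂ)
    (hF : F = ⟪φ, S (Ring.inverse (H₀ + w • V - z • (1 : H →L[ℂ] H)) (S φ))⟫_ℂ) :
    0 ≤ F.im ∧ ‖F‖ ≤ ‖S φ‖ ^ 2 / z.im ∧ (- w.im) * ‖F‖ ≤ ‖φ‖ ^ 2 := by
  have hu := aux_unit_s11 H₀ V S hH₀ hS hSS z w hz hw
  have hA := aux_im_s11 H₀ V S hH₀ hS hSS z w
  set A := H₀ + w • V - z • (1 : H →L[ℂ] H) with hAdef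
  set ψ := Ring.inverse A (S φ) with hψ
  have hAψ : A ψ = S φ := by
    have := congrArg (fun T : H →L[ℂ] H => T (S φ)) (Ring.mul_inverse_cancel A hu)
    simpa using this
  have hsym := ContinuousLinearMap.isSelfAdjoint_iff_isSymmetric.mp hS
  have hF2 : F = ⟪S φ, ψ⟫_ℂ := by
    rw [hF]; exact (hsym φ ψ).symm
  have h1 := hA ψ
  rw [hAψ] at h1
  have h2 : F.im = - (⟪ψ, S φ⟫_ℂ).im := by
    rw [hF2, ← inner_conj_symm (S φ) ψ, Complex.conj_im]
  rw [h1] at h2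
  have p1 : 0 ≤ (-w.im) * ‖S ψ‖ ^ 2 := mul_nonneg (neg_nonneg.mpr hw) (sq_nonneg _)
  have p2 : 0 ≤ z.im * ‖ψ‖ ^ 2 := by positivity
  have h3 : F.im ≤ ‖F‖ := Complex.im_le_norm _
  have h4 : ‖F‖ ≤ ‖S φ‖ * ‖ψ‖ := by rw [hF2]; exact norm_inner_le_norm _ _
  have h5 : ‖F‖ ≤ ‖φ‖ * ‖S ψ‖ := by rw [hF]; exact norm_inner_le_norm _ _
  refine ⟨by linarith, ?_, ?_⟩
  · have : z.im * ‖ψ‖ ≤ ‖S φ‖ := by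
      rcases (norm_nonneg ψ).eq_or_lt with h | h
      · rw [← h]; simp
      · refine le_of_mul_le_mul_right ?_ h
        nlinarith
    rw [le_div_iff₀ hz]
    nlinarith [norm_nonneg (S φ)]
  · have : (-w.im) * ‖S ψ‖ ≤ ‖φ‖ := by
      rcases (norm_nonneg (S ψ)).eq_or_lt with h | h
      · rw [← h]; simp
      · refine le_of_mul_le_mul_right ?_ h
        nlinarith
    nlinarith [norm_nonneg φ, mul_le_mul_of_nonneg_left h5 (neg_nonneg.mpr hw)]

lemma aux_diff (H₀ V S : H →L[ℂ] H) (hH₀ : IsSelfAdjoint H₀) (hS : IsSelfAdjoint S)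
    (hSS : S.comp S = V) (z w : ℂ) (hz : 0 < z.im) (hw : w.im ≤ 0) (φ : H) :
    DifferentiableAt ℂ
      (fun w : ℂ => ⟪φ, S (Ring.inverse (H₀ + w • V - z • (1 : H →L[ℂ] H)) (S φ))⟫_ℂ) w := by
  have hu := aux_unit_s11 H₀ V S hH₀ hS hSS z w hz hw
  have h1 : DifferentiableAt ℂ
      (fun w : ℂ => Ring.inverse (H₀ + w • V - z • (1 : H →L[ℂ] H))) w :=
    DifferentiableAt.inverse (by fun_prop) hu
  have h2 : DifferentiableAt ℂ
      (fun w : ℂ => (S (Ring.inverse (H₀ + w • V - z • (1 : H →L[ℂ] H)) (S φ)))) w :=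
    S.differentiableAt.comp w (h1.clm_apply (differentiableAt_const _))
  exact (innerSL ℂ φ).differentiableAt.comp w h2
end

open Complex in
lemma aux_step (f : ℂ → ℂ) (N t₁ t₂ M : ℝ) (ht : t₁ ≤ t₂)
    (hM1 : ∀ s ∈ Set.Icc t₁ t₂, |s| ≤ M) (hM : 0 ≤ M)
    (hd : ∀ w : ℂ, w.im ≤ 0 → DifferentiableAt ℂ f w)
    (hpos : ∀ w : ℂ, w.im ≤ 0 → 0 ≤ (f w).im)
    (hN : ∀ w : ℂ, w.im ≤ 0 → (- w.im) * ‖f w‖ ≤ N)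
    (R d : ℝ) (hd0 : 0 < d) (hdR : d < R) (hMR : M ≤ R) :
    (2 * R - d) * d ^ 2 / (2 * Real.pi * R * (M + d) ^ 2) *
      ∫ s in t₁..t₂, (f (circleMap (-(R * I)) R (Real.pi / 2 - s / R))).im ≤ N := by
  have hR : 0 < R := hd0.trans hdR
  set c : ℂ := -(R * I) with hc
  set w : ℂ := -(d * I) with hw
  have hlow : ∀ ζ ∈ Metric.closedBall c R, ζ.im ≤ 0 := by
    intro ζ hζ
    rw [mem_closedBall_iff_norm] at hζ
    have := (Complex.im_le_norm _).trans hζ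
    simp [hc] at this
    linarith
  have hcirc : ∀ θ, circleMap c R θ ∈ Metric.closedBall c R :=
    fun θ => circleMap_mem_closedBall c hR.le θ
  have hdiff : DiffContOnCl ℂ f (Metric.ball c R) := by
    apply DifferentiableOn.diffContOnCl
    intro x hx
    rw [closure_ball c hR.ne'] at hx
    exact (hd x (hlow x hx)).differentiableWithinAt
  have hwc : ‖w - c‖ = R - d := by
    have : w - c = ((R - d : ℝ) : ℂ) * I := by rw [hw, hc]; push_cast; ring
    rw [this, norm_mul, Complex.norm_I, mul_one, Complex.norm_of_nonneg (sub_pos.mpr hdR).le]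
  have hwb : w ∈ Metric.ball c R := by
    rw [mem_ball_iff_norm, hwc]; linarith
  have hP := hdiff.circleAverage_poissonKernel_smul hwb
  have hne : ∀ θ, circleMap c R θ - w ≠ 0 := by
    intro θ h
    have h1 : circleMap c R θ = w := sub_eq_zero.mp h
    have h2 := circleMap_mem_sphere c hR.le θ
    rw [h1, mem_sphere_iff_norm, hwc] at h2
    linarith
  have hker : ∀ θ, poissonKernel c w (circleMap c R θ)
      = (2 * R - d) * d / ‖circleMap c R θ - w‖ ^ 2 := by
    intro θ
    rw [poissonKernel_def, hwc]
    have : ‖circleMap c R θ - c‖ = R := by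
      have h2 := circleMap_mem_sphere c hR.le θ
      rwa [mem_sphere_iff_norm] at h2
    rw [this, sub_sub_sub_cancel_right]
    congr 1; ring
  have hfc : Continuous fun θ => f (circleMap c R θ) := by
    rw [continuous_iff_continuousAt]
    intro θ
    exact ContinuousAt.comp (hd _ (hlow _ (hcirc θ))).continuousAt
      (continuous_circleMap c R).continuousAt
  have hkc : Continuous fun θ => poissonKernel c w (circleMap c R θ) := by
    simp_rw [hker]
    refine Continuous.div (by fun_prop) (by fun_prop) ?_
    intro θ
    have := hne θ
    positivity
  set g : ℝ → ℝ := fun θ => poissonKernel c w (circleMap c R θ) * (f (circleMap c R θ)).im with hg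
  have hgc : Continuous g := hkc.mul (Complex.continuous_im.comp hfc)
  have hg0 : ∀ θ, 0 ≤ g θ := by
    intro θ
    refine mul_nonneg ?_ (hpos _ (hlow _ (hcirc θ)))
    rw [hker]
    have : 0 < 2 * R - d := by linarith
    positivity
  have hI : (2 * Real.pi)⁻¹ * ∫ θ in 0..2 * Real.pi, g θ = (f w).im := by
    rw [← hP, Real.circleAverage_def]
    have := Complex.imCLM.intervalIntegral_comp_comm (a := 0) (b := 2 * Real.pi)
      (μ := MeasureTheory.volume)
      (f := fun θ => (poissonKernel c w • f) (circleMap c R θ))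
      (Continuous.intervalIntegrable (by
        exact hkc.smul hfc) _ _)
    simp only [Complex.imCLM_apply] at this
    rw [Complex.smul_im, ← this]
    simp [hg]
  have hfw : d * (f w).im ≤ N := by
    have h1 := hN w (hlow w (Metric.ball_subset_closedBall hwb))
    have : - w.im = d := by simp [hw]
    rw [this] at h1
    exact (mul_le_mul_of_nonneg_left (Complex.im_le_norm _) hd0.le).trans h1
  have hsub : ∫ s in t₁..t₂, g (Real.pi / 2 - s / R) ≤ R * ∫ θ in 0..2 * Real.pi, g θ := by
    rw [intervalIntegral.integral_comp_sub_div _ hR.ne', smul_eq_mul]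
    refine mul_le_mul_of_nonneg_left ?_ hR.le
    have a1 : |t₁| ≤ M := hM1 _ ⟨le_rfl, ht⟩
    have a2 : |t₂| ≤ M := hM1 _ ⟨ht, le_rfl⟩
    have b1 : -1 ≤ t₁ / R := by
      rw [le_div_iff₀ hR]; linarith [(abs_le.mp a1).1]
    have b2 : t₂ / R ≤ 1 := by
      rw [div_le_iff₀ hR]; linarith [(abs_le.mp a2).2]
    have := Real.pi_gt_three
    apply intervalIntegral.integral_mono_interval
    · linarith
    · gcongr
    · linarith
    · exact Filter.Eventually.of_forall hg0
    · exact hgc.intervalIntegrable _ _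
  have hdist : ∀ s ∈ Set.Icc t₁ t₂, ‖circleMap c R (Real.pi / 2 - s / R) - w‖ ≤ M + d := by
    intro s hs
    have e : circleMap c R (Real.pi / 2 - s / R) - w
        = (R * I) * (Complex.exp (I * ((-(s / R) : ℝ) : ℂ)) - 1) + d * I := by
      have : ((Real.pi / 2 - s / R : ℝ) : ℂ) * I
          = Real.pi / 2 * I + I * ((-(s / R) : ℝ) : ℂ) := by push_cast; ring
      rw [circleMap, this, Complex.exp_add, Complex.exp_pi_div_two_mul_I, hc, hw]
      ring
    rw [e]
    refine (norm_add_le _ _).trans ?_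
    have h1 := Real.norm_exp_I_mul_ofReal_sub_one_le (x := -(s / R))
    rw [norm_mul]
    have h2 : ‖(R : ℂ) * I‖ = R := by simp [abs_of_pos hR]
    have h3 : ‖(d : ℂ) * I‖ = d := by simp [abs_of_pos hd0]
    rw [h2, h3]
    have h4 : R * ‖-(s / R)‖ = |s| := by
      rw [norm_neg, Real.norm_eq_abs, abs_div, abs_of_pos hR]; field_simp
    have := mul_le_mul_of_nonneg_left h1 hR.le
    rw [h4] at this
    linarith [hM1 s hs]
  have hlb : (2 * R - d) * d / (M + d) ^ 2 *
      ∫ s in t₁..t₂, (f (circleMap c R (Real.pi / 2 - s / R))).im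
        ≤ ∫ s in t₁..t₂, g (Real.pi / 2 - s / R) := by
    rw [← intervalIntegral.integral_const_mul]
    apply intervalIntegral.integral_mono_on ht
    · apply Continuous.intervalIntegrable
      exact continuous_const.mul (Complex.continuous_im.comp (hfc.comp (by fun_prop)))
    · exact (hgc.comp (by fun_prop)).intervalIntegrable _ _
    · intro s hs
      simp only [hg]
      refine mul_le_mul_of_nonneg_right ?_ (hpos _ (hlow _ (hcirc _)))
      rw [hker]
      have h1 : 0 < ‖circleMap c R (Real.pi / 2 - s / R) - w‖ := norm_pos_iff.mpr (hne _)
      have h2 := hdist s hs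
      have : 0 < 2 * R - d := by linarith
      gcongr
  have hpi := Real.pi_pos
  calc _ = d / (2 * Real.pi * R) * ((2 * R - d) * d / (M + d) ^ 2 *
      ∫ s in t₁..t₂, (f (circleMap c R (Real.pi / 2 - s / R))).im) := by
        field_simp
    _ ≤ d / (2 * Real.pi * R) * (R * ∫ θ in 0..2 * Real.pi, g θ) := by
        exact mul_le_mul_of_nonneg_left (hlb.trans hsub) (by positivity)
    _ = d * ((2 * Real.pi)⁻¹ * ∫ θ in 0..2 * Real.pi, g θ) := by field_simp
    _ = d * (f w).im := by rw [hI]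
    _ ≤ N := hfw

open Complex Filter Topology in
lemma aux_circ (s : ℝ) :
    Tendsto (fun d : ℝ => circleMap (-(((d ^ 2 : ℝ) : ℂ) * I)) (d ^ 2) (Real.pi / 2 - s / d ^ 2))
      atTop (𝓝 (s : ℂ)) := by
  rw [tendsto_iff_norm_sub_tendsto_zero]
  have hlim : Tendsto (fun d : ℝ => s ^ 2 / d ^ 2) atTop (𝓝 0) :=
    tendsto_const_nhds.div_atTop (tendsto_pow_atTop two_ne_zero)
  refine squeeze_zero' (Eventually.of_forall fun _ => norm_nonneg _) ?_ hlim
  have h2 : Tendsto (fun d : ℝ => d ^ 2) atTop atTop := tendsto_pow_atTop two_ne_zero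
  filter_upwards [h2.eventually_ge_atTop |s|, h2.eventually_gt_atTop 0] with d hd hR
  set R := d ^ 2
  have hx : ‖(-(s / R : ℝ) : ℂ) * I‖ = |s| / R := by
    simp [abs_of_pos hR]
  have e : circleMap (-((R : ℂ) * I)) R (Real.pi / 2 - s / R) - s
        = (R * I) * (Complex.exp ((-(s / R : ℝ) : ℂ) * I) - 1 - (-(s / R : ℝ) : ℂ) * I) := by
    have : ((Real.pi / 2 - s / R : ℝ) : ℂ) * I
          = Real.pi / 2 * I + (-(s / R : ℝ) : ℂ) * I := by push_cast; ring
    rw [circleMap, this, Complex.exp_add, Complex.exp_pi_div_two_mul_I]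
    have hRc : (R : ℂ) ≠ 0 := by exact_mod_cast hR.ne'
    have hs : (s : ℂ) = R * (s / R : ℝ) := by push_cast; field_simp
    rw [hs]
    have hI := I_mul_I
    push_cast
    linear_combination (-(R : ℂ) * (s / R)) * hI
  rw [e, norm_mul]
  have hb := Complex.norm_exp_sub_one_sub_id_le (x := (-(s / R : ℝ) : ℂ) * I)
    (by rw [hx, div_le_one hR]; exact hd)
  rw [hx] at hb
  have h3 : ‖(R : ℂ) * I‖ = R := by simp [abs_of_pos hR]
  rw [h3]
  refine (mul_le_mul_of_nonneg_left hb hR.le).trans (le_of_eq ?_)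
  rw [div_pow, sq_abs]
  field_simp

open Complex Filter Topology in
lemma aux_main_s11 (f : ℂ → ℂ) (N B t₁ t₂ : ℝ) (ht : t₁ ≤ t₂)
    (hd : ∀ w : ℂ, w.im ≤ 0 → DifferentiableAt ℂ f w)
    (hpos : ∀ w : ℂ, w.im ≤ 0 → 0 ≤ (f w).im)
    (hB : ∀ w : ℂ, w.im ≤ 0 → ‖f w‖ ≤ B)
    (hN : ∀ w : ℂ, w.im ≤ 0 → (- w.im) * ‖f w‖ ≤ N) :
    ∫ s in t₁..t₂, (f s).im ≤ Real.pi * N := by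
  obtain ⟨M, hM, hM1⟩ : ∃ M : ℝ, 0 ≤ M ∧ ∀ s ∈ Set.Icc t₁ t₂, |s| ≤ M := by
    refine ⟨max |t₁| |t₂|, by positivity, fun s hs => abs_le_max_abs_abs hs.1 hs.2⟩
  have hlow : ∀ d θ : ℝ, (circleMap (-(((d ^ 2 : ℝ) : ℂ) * I)) (d ^ 2) θ).im ≤ 0 := by
    intro d θ
    have : (circleMap (-(((d ^ 2 : ℝ) : ℂ) * I)) (d ^ 2) θ).im
      = -(d ^ 2) + d ^ 2 * Real.sin θ := by
      simp only [circleMap, Complex.add_im, Complex.im_ofReal_mul, Complex.exp_ofReal_mul_I_im,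
        Complex.neg_im, Complex.I_im]
      ring
    rw [this]
    nlinarith [Real.sin_le_one θ, sq_nonneg d]
  have hT : Tendsto (fun d : ℝ => ∫ s in t₁..t₂,
      (f (circleMap (-(((d ^ 2 : ℝ) : ℂ) * I)) (d ^ 2) (Real.pi / 2 - s / d ^ 2))).im) atTop
      (𝓝 (∫ s in t₁..t₂, (f s).im)) := by
    refine intervalIntegral.tendsto_integral_filter_of_dominated_convergence (fun _ => B) ?_ ?_ ?_ ?_
    · refine Eventually.of_forall fun d => ?_
      refine Continuous.aestronglyMeasurable ?_
      refine Complex.continuous_im.comp ?_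
      rw [continuous_iff_continuousAt]
      intro s
      exact ContinuousAt.comp (f := fun s : ℝ => circleMap (-(((d ^ 2 : ℝ) : ℂ) * I)) (d ^ 2) (Real.pi / 2 - s / d ^ 2)) (hd _ (hlow _ _)).continuousAt
        (by fun_prop)
    · refine Eventually.of_forall fun d => Eventually.of_forall fun s _ => ?_
      exact (Complex.abs_im_le_norm _).trans (hB _ (hlow _ _))
    · exact intervalIntegrable_const
    · refine Eventually.of_forall fun s _ => ?_
      have h1 : ContinuousAt (fun w => (f w).im) (s : ℂ) :=
        Complex.continuous_im.continuousAt.comp (hd s (by simp)).continuousAt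
      exact h1.tendsto.comp (aux_circ s)
  have hk : Tendsto (fun d : ℝ => (2 * d ^ 2 - d) * d ^ 2 /
      (2 * Real.pi * d ^ 2 * (M + d) ^ 2)) atTop (𝓝 (1 / Real.pi)) := by
    have hi : Tendsto (fun d : ℝ => d⁻¹) atTop (𝓝 0) := tendsto_inv_atTop_zero
    have h1 : Tendsto (fun d : ℝ => (2 - d⁻¹) / (2 * Real.pi * (M * d⁻¹ + 1) ^ 2)) atTop
        (𝓝 ((2 - 0) / (2 * Real.pi * (M * 0 + 1) ^ 2))) := by
      refine Tendsto.div (tendsto_const_nhds.sub hi)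
        ((((tendsto_const_nhds.mul hi).add_const 1).pow 2).const_mul _) ?_
      have := Real.pi_pos
      simp
    have e : (2 - 0) / (2 * Real.pi * (M * 0 + 1) ^ 2) = 1 / Real.pi := by
      have := Real.pi_pos
      field_simp; ring
    rw [e] at h1
    refine h1.congr' ?_
    filter_upwards [eventually_gt_atTop 0] with d hd
    have := Real.pi_pos
    field_simp
  have hfin := le_of_tendsto (hk.mul hT) (b := N) ?_
  · have := Real.pi_pos
    rw [one_div, inv_mul_le_iff₀ this] at hfin
    exact hfin
  · filter_upwards [eventually_gt_atTop 1, eventually_ge_atTop M] with d h1 h2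
    exact aux_step f N t₁ t₂ M ht hM1 hM hd hpos hN (d ^ 2) d (by linarith) (by nlinarith)
      (by nlinarith)

theorem averaged_resolvent_imaginary_part_bound
    {H : Type*} [NormedAddCommGroup H] [InnerProductSpace ℂ H] [CompleteSpace H]
    (H₀ V sqrtV : H →L[ℂ] H)
    (hH₀ : IsSelfAdjoint H₀) (hV : IsSelfAdjoint V)
    (hVpos : ∀ x : H, 0 ≤ (⟪x, V x⟫_ℂ).re)
    (hsqrtV : IsSelfAdjoint sqrtV)
    (hsqrtVpos : ∀ x : H, 0 ≤ (⟪x, sqrtV x⟫_ℂ).re)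
    (hsqrtVsq : sqrtV.comp sqrtV = V)
    (t₁ t₂ : ℝ) (ht : t₁ ≤ t₂)
    (z : ℂ) (hz : 0 < z.im) (φ : H) :
    (∀ s ∈ Set.Icc t₁ t₂,
      IsUnit (H₀ + (s : ℂ) • V - z • (1 : H →L[ℂ] H))) ∧
    0 ≤ (∫ s in t₁..t₂,
        (⟪φ, sqrtV (Ring.inverse (H₀ + (s : ℂ) • V - z • (1 : H →L[ℂ] H)) (sqrtV φ))⟫_ℂ).im) ∧
    (∫ s in t₁..t₂,
        (⟪φ, sqrtV (Ring.inverse (H₀ + (s : ℂ) • V - z • (1 : H →L[ℂ] H)) (sqrtV φ))⟫_ℂ).im)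
      ≤ Real.pi * ‖φ‖ ^ 2 := by
  have hunit := fun w hw => aux_unit_s11 H₀ V sqrtV hH₀ hsqrtV hsqrtVsq z w hz hw
  have hb := fun w hw => aux_bounds H₀ V sqrtV hH₀ hsqrtV hsqrtVsq z w hz hw φ _ rfl
  refine ⟨fun s _ => hunit s (by simp), ?_, ?_⟩
  · exact intervalIntegral.integral_nonneg ht fun s _ => (hb s (by simp)).1
  · exact aux_main_s11
      (fun w : ℂ => ⟪φ, sqrtV (Ring.inverse (H₀ + w • V - z • (1 : H →L[ℂ] H)) (sqrtV φ))⟫_ℂ)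
      (‖φ‖ ^ 2) (‖sqrtV φ‖ ^ 2 / z.im) t₁ t₂ ht
      (fun w hw => aux_diff H₀ V sqrtV hH₀ hsqrtV hsqrtVsq z w hz hw φ)
      (fun w hw => (hb w hw).1) (fun w hw => (hb w hw).2.1) (fun w hw => (hb w hw).2.2)
end
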